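/- arXiv:1912.08402 — 2 statements merged into one kernel-verified Lean document; each statement's English description precedes it below -/
import Mathlib

section
/- Let w be an Oleinik solution on [0,X]. For any 0 < ε < X and any integers k ≥ 0 and m ≥ 0 there exist δ > 0 and a constant C > 0, independent of ψ, such that |∂ₓ^k ∂_ψ^m (w(x,ψ)^{−1/2})| ≤ C ψ^{−1/2−m} for all (x,ψ) ∈ [ε,X]×(0,δ]. -/
open Set

/-- Iterated partial derivative `∂ₓ^k ∂_ψ^m w` of a function of two real variables. -/
noncomputable def pd (k m : ℕ) (w : ℝ → ℝ → ℝ) (x ψ : ℝ) : ℝ :=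
  iteratedDeriv k (fun x' => iteratedDeriv m (w x') ψ) x

/-- Von Mises formulation of the steady Prandtl equation with favorable pressure:
`w` is an Oleinik solution on `[0,X]` with structural constants `α, m, M, C₀, δ₁`. -/
structure OleinikSolution (X : ℝ) (p : ℝ → ℝ) (w : ℝ → ℝ → ℝ)
    (α m M C₀ δ₁ : ℝ) : Prop where
  hX : 0 < X
  hp : ContDiff ℝ (⊤ : ℕ∞) p
  hfav : ∀ x : ℝ, deriv p x ≤ 0
  hα : α ∈ Set.Ioo (0 : ℝ) (1 / 2)
  hm : 0 < m
  hmM : m < M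
  hC₀ : 0 < C₀
  hδ₁ : δ₁ ∈ Set.Ioo (0 : ℝ) 1
  cont : ContinuousOn (fun z : ℝ × ℝ => w z.1 z.2) (Set.Icc 0 X ×ˢ Set.Ici 0)
  smooth : ContDiffOn ℝ (⊤ : ℕ∞) (fun z : ℝ × ℝ => w z.1 z.2) (Set.Ioc 0 X ×ˢ Set.Ioi 0)
  bdry : ∀ x ∈ Set.Icc (0 : ℝ) X, w x 0 = 0
  eqn : ∀ x ∈ Set.Ioc (0 : ℝ) X, ∀ ψ ∈ Set.Ioi (0 : ℝ),
    pd 1 0 w x ψ - Real.sqrt (w x ψ) * pd 0 2 w x ψ = -2 * deriv p x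
  slope_lb : ∀ x ∈ Set.Icc (0 : ℝ) X, ∀ ψ ∈ Set.Icc (0 : ℝ) δ₁, m < pd 0 1 w x ψ
  slope_ub : ∀ x ∈ Set.Icc (0 : ℝ) X, ∀ ψ ∈ Set.Icc (0 : ℝ) δ₁, pd 0 1 w x ψ < M
  growth_lb : ∀ x ∈ Set.Icc (0 : ℝ) X, ∀ ψ ∈ Set.Ioc (0 : ℝ) δ₁, m * ψ < w x ψ
  growth_ub : ∀ x ∈ Set.Icc (0 : ℝ) X, ∀ ψ ∈ Set.Ioc (0 : ℝ) δ₁, w x ψ < M * ψ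
  dx_bound : ∀ x ∈ Set.Icc (0 : ℝ) X, ∀ ψ ∈ Set.Icc (0 : ℝ) δ₁,
    |pd 1 0 w x ψ| ≤ C₀ * ψ ^ ((1 : ℝ) / 2 + α)

noncomputable section

def Dt (f : ℝ → ℝ → ℝ) : ℝ → ℝ → ℝ := fun x y => deriv (fun x' => f x' y) x
def Dy (f : ℝ → ℝ → ℝ) : ℝ → ℝ → ℝ := fun x y => deriv (f x) y

/-- smoothness on `I × (0,d)` -/
def SmI (I : Set ℝ) (d : ℝ) (f : ℝ → ℝ → ℝ) : Prop :=
  ContDiffOn ℝ (⊤ : ℕ∞) (fun z : ℝ × ℝ => f z.1 z.2) (I ×ˢ Ioo 0 d)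

abbrev Sm (X d : ℝ) (f : ℝ → ℝ → ℝ) : Prop := SmI (Ioo 0 X) d f

def EqU (X d : ℝ) (f g : ℝ → ℝ → ℝ) : Prop := ∀ x ∈ Ioo 0 X, ∀ y ∈ Ioo 0 d, f x y = g x y

lemma EqU.symm {X d : ℝ} {f g : ℝ → ℝ → ℝ} (h : EqU X d f g) : EqU X d g f :=
  fun x hx y hy => (h x hx y hy).symm
lemma EqU.trans {X d : ℝ} {f g k : ℝ → ℝ → ℝ} (h : EqU X d f g) (h' : EqU X d g k) :
    EqU X d f k :=
  fun x hx y hy => (h x hx y hy).trans (h' x hx y hy)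
lemma EqU.refl {X d : ℝ} (f : ℝ → ℝ → ℝ) : EqU X d f f := fun _ _ _ _ => rfl

lemma EqU.dt {X d : ℝ} {f g : ℝ → ℝ → ℝ} (h : EqU X d f g) : EqU X d (Dt f) (Dt g) := by
  intro x hx y hy
  apply Filter.EventuallyEq.deriv_eq
  filter_upwards [Ioo_mem_nhds hx.1 hx.2] with x' hx'
  exact h x' hx' y hy

lemma EqU.dy {X d : ℝ} {f g : ℝ → ℝ → ℝ} (h : EqU X d f g) : EqU X d (Dy f) (Dy g) := by
  intro x hx y hy
  apply Filter.EventuallyEq.deriv_eq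
  filter_upwards [Ioo_mem_nhds hy.1 hy.2] with x' hx'
  exact h x hx x' hx'

lemma EqU.dt_iter {X d : ℝ} {f g : ℝ → ℝ → ℝ} (h : EqU X d f g) (n : ℕ) :
    EqU X d (Dt^[n] f) (Dt^[n] g) := by
  induction n generalizing f g with
  | zero => exact h
  | succ n ih => simpa using ih h.dt

section
variable {I : Set ℝ} {d : ℝ} {f g : ℝ → ℝ → ℝ}

lemma SmI.congr (hf : SmI I d f) (h : ∀ x ∈ I, ∀ y ∈ Ioo 0 d, g x y = f x y) : SmI I d g :=
  ContDiffOn.congr hf (fun z hz => h z.1 hz.1 z.2 hz.2)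
lemma SmI.add (hf : SmI I d f) (hg : SmI I d g) : SmI I d (f + g) := ContDiffOn.add hf hg
lemma SmI.sub (hf : SmI I d f) (hg : SmI I d g) : SmI I d (f - g) := ContDiffOn.sub hf hg
lemma SmI.mul (hf : SmI I d f) (hg : SmI I d g) : SmI I d (f * g) := ContDiffOn.mul hf hg
lemma SmI.neg (hf : SmI I d f) : SmI I d (-f) := ContDiffOn.neg hf
lemma SmI.const (c : ℝ) : SmI I d (fun _ _ => c) := contDiffOn_const
lemma SmI.ofT {q : ℝ → ℝ} (hq : ContDiff ℝ (⊤ : ℕ∞) q) : SmI I d (fun x _ => q x) :=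
  (hq.comp contDiff_fst).contDiffOn
lemma SmI.mono {J : Set ℝ} (hf : SmI I d f) (h : J ⊆ I) : SmI J d f :=
  ContDiffOn.mono hf (prod_mono h le_rfl)

lemma SmI.hasY (hf : SmI I d f) {x y : ℝ} (hx : x ∈ I) (hy : y ∈ Ioo 0 d) :
    HasDerivAt (f x) (fderivWithin ℝ (fun z : ℝ × ℝ => f z.1 z.2) (I ×ˢ Ioo 0 d) (x, y) (0, 1)) y := by
  have h1 : HasFDerivWithinAt (fun z : ℝ × ℝ => f z.1 z.2) _ (I ×ˢ Ioo 0 d) (x, y) :=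
    ((ContDiffOn.differentiableOn hf (by simp)) (x, y) ⟨hx, hy⟩).hasFDerivWithinAt
  have h2 : HasDerivWithinAt (fun y' : ℝ => ((x, y') : ℝ × ℝ)) (0, 1) (Ioo 0 d) y :=
    (HasDerivAt.prodMk (hasDerivAt_const y x) (hasDerivAt_id y)).hasDerivWithinAt
  have hm : MapsTo (fun y' : ℝ => ((x, y') : ℝ × ℝ)) (Ioo 0 d) (I ×ˢ Ioo 0 d) :=
    fun y' hy' => mk_mem_prod hx hy'
  have h3 := HasFDerivWithinAt.comp_hasDerivWithinAt y h1 h2 hm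
  exact h3.hasDerivAt (Ioo_mem_nhds hy.1 hy.2)

lemma SmI.dy (hI : UniqueDiffOn ℝ I) (hf : SmI I d f) : SmI I d (Dy f) := by
  have h1 : ContDiffOn ℝ (⊤ : ℕ∞) (fun z => fderivWithin ℝ (fun z : ℝ × ℝ => f z.1 z.2)
      (I ×ˢ Ioo 0 d) z (0, 1)) (I ×ˢ Ioo 0 d) :=
    (ContDiffOn.fderivWithin hf (hI.prod isOpen_Ioo.uniqueDiffOn) (by simp)).clm_apply
      contDiffOn_const
  refine h1.congr fun z hz => ?_
  exact (hf.hasY hz.1 hz.2).deriv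
end

section
variable {X d : ℝ} {f g : ℝ → ℝ → ℝ}

lemma SmI.hasDy {I : Set ℝ} (hf : SmI I d f) {x y : ℝ} (hx : x ∈ I) (hy : y ∈ Ioo 0 d) :
    HasDerivAt (f x) (Dy f x y) y := by
  have := hf.hasY hx hy
  rwa [Dy, this.deriv]

lemma SmI.contAt (hf : Sm X d f) {x y : ℝ} (hx : x ∈ Ioo 0 X) (hy : y ∈ Ioo 0 d) :
    ContDiffAt ℝ (⊤ : ℕ∞) (fun z : ℝ × ℝ => f z.1 z.2) (x, y) :=
  ContDiffOn.contDiffAt hf ((isOpen_Ioo.prod isOpen_Ioo).mem_nhds ⟨hx, hy⟩)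

lemma SmI.hasT (hf : Sm X d f) {x y : ℝ} (hx : x ∈ Ioo 0 X) (hy : y ∈ Ioo 0 d) :
    HasDerivAt (fun x' => f x' y) (fderiv ℝ (fun z : ℝ × ℝ => f z.1 z.2) (x, y) (1, 0)) x := by
  have h1 := ((hf.contAt hx hy).differentiableAt (by simp)).hasFDerivAt
  have h2 : HasDerivAt (fun x' : ℝ => ((x', y) : ℝ × ℝ)) (1, 0) x :=
    (HasDerivAt.prodMk (hasDerivAt_id x) (hasDerivAt_const x y))
  exact h1.comp_hasDerivAt x h2

lemma SmI.hasYU (hf : Sm X d f) {x y : ℝ} (hx : x ∈ Ioo 0 X) (hy : y ∈ Ioo 0 d) :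
    HasDerivAt (f x) (fderiv ℝ (fun z : ℝ × ℝ => f z.1 z.2) (x, y) (0, 1)) y := by
  have h1 := ((hf.contAt hx hy).differentiableAt (by simp)).hasFDerivAt
  have h2 : HasDerivAt (fun y' : ℝ => ((x, y') : ℝ × ℝ)) (0, 1) y :=
    (HasDerivAt.prodMk (hasDerivAt_const y x) (hasDerivAt_id y))
  exact h1.comp_hasDerivAt y h2

lemma SmI.hasDt (hf : Sm X d f) {x y : ℝ} (hx : x ∈ Ioo 0 X) (hy : y ∈ Ioo 0 d) :
    HasDerivAt (fun x' => f x' y) (Dt f x y) x := by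
  have := hf.hasT hx hy
  rwa [Dt, this.deriv]

lemma SmI.dt (hf : Sm X d f) : Sm X d (Dt f) := by
  have ho : IsOpen (Ioo 0 X ×ˢ Ioo 0 d) := isOpen_Ioo.prod isOpen_Ioo
  have h1 : ContDiffOn ℝ (⊤ : ℕ∞) (fun z => fderiv ℝ (fun z : ℝ × ℝ => f z.1 z.2)
      z (1, 0)) (Ioo 0 X ×ˢ Ioo 0 d) :=
    (ContDiffOn.fderiv_of_isOpen hf ho (by simp)).clm_apply contDiffOn_const
  refine h1.congr fun z hz => ?_
  exact (hf.hasT hz.1 hz.2).deriv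

lemma SmI.dyU (hf : Sm X d f) : Sm X d (Dy f) := SmI.dy isOpen_Ioo.uniqueDiffOn hf

lemma SmI.dt_iter (hf : Sm X d f) (n : ℕ) : Sm X d (Dt^[n] f) := by
  induction n generalizing f with
  | zero => exact hf
  | succ n ih => simpa using ih hf.dt

lemma SmI.dy_iter {I : Set ℝ} (hI : UniqueDiffOn ℝ I) (hf : SmI I d f) (n : ℕ) :
    SmI I d (Dy^[n] f) := by
  induction n generalizing f with
  | zero => exact hf
  | succ n ih => simpa using ih (hf.dy hI)

lemma dd_aux {F : ℝ × ℝ → ℝ} {z a b : ℝ × ℝ} {γ : ℝ → ℝ × ℝ} {x : ℝ} (hz : γ x = z)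
    (hd : DifferentiableAt ℝ (fderiv ℝ F) z) (hγ : HasDerivAt γ a x) :
    HasDerivAt (fun x' => fderiv ℝ F (γ x') b) (fderiv ℝ (fderiv ℝ F) z a b) x := by
  subst hz
  have h1 := hd.hasFDerivAt.comp_hasDerivAt x hγ
  exact ((ContinuousLinearMap.apply ℝ ℝ b).hasFDerivAt).comp_hasDerivAt x h1

lemma dt_dy_comm (hf : Sm X d f) : EqU X d (Dt (Dy f)) (Dy (Dt f)) := by
  intro x hx y hy
  have hc := hf.contAt hx hy
  have hsym := hc.isSymmSndFDerivAt (by simp; exact WithTop.coe_le_coe.2 (le_top : (2 : ℕ∞) ≤ ⊤))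
  have hd := (hc.fderiv_right (m := 1) (by norm_cast)).differentiableAt (by simp)
  have hline1 : HasDerivAt (fun x' : ℝ => ((x', y) : ℝ × ℝ)) (1, 0) x :=
    (HasDerivAt.prodMk (hasDerivAt_id x) (hasDerivAt_const x y))
  have hline2 : HasDerivAt (fun y' : ℝ => ((x, y') : ℝ × ℝ)) (0, 1) y :=
    (HasDerivAt.prodMk (hasDerivAt_const y x) (hasDerivAt_id y))
  have h1 := dd_aux (b := (0, 1)) (γ := fun x' : ℝ => ((x', y) : ℝ × ℝ)) rfl hd hline1
  have h2 := dd_aux (b := (1, 0)) (γ := fun y' : ℝ => ((x, y') : ℝ × ℝ)) rfl hd hline2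
  have e1 := (h1.congr_of_eventuallyEq (f₁ := fun x' => Dy f x' y) (by
    filter_upwards [Ioo_mem_nhds hx.1 hx.2] with x' hx'
    exact (hf.hasYU hx' hy).deriv)).deriv
  have e2 := (h2.congr_of_eventuallyEq (f₁ := fun y' => Dt f x y') (by
    filter_upwards [Ioo_mem_nhds hy.1 hy.2] with x' hx'
    exact (hf.hasT hx hx').deriv)).deriv
  exact e1.trans ((hsym _ _).trans e2.symm)

lemma dt_add (hf : Sm X d f) (hg : Sm X d g) : EqU X d (Dt (f + g)) (Dt f + Dt g) :=
  fun _ hx _ hy => ((hf.hasDt hx hy).add (hg.hasDt hx hy)).deriv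
lemma dt_sub (hf : Sm X d f) (hg : Sm X d g) : EqU X d (Dt (f - g)) (Dt f - Dt g) :=
  fun _ hx _ hy => ((hf.hasDt hx hy).sub (hg.hasDt hx hy)).deriv
lemma dt_mul (hf : Sm X d f) (hg : Sm X d g) : EqU X d (Dt (f * g)) (Dt f * g + f * Dt g) :=
  fun _ hx _ hy => ((hf.hasDt hx hy).mul (hg.hasDt hx hy)).deriv
lemma dy_add (hf : Sm X d f) (hg : Sm X d g) : EqU X d (Dy (f + g)) (Dy f + Dy g) :=
  fun _ hx _ hy => ((hf.hasDy hx hy).add (hg.hasDy hx hy)).deriv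
lemma dy_sub (hf : Sm X d f) (hg : Sm X d g) : EqU X d (Dy (f - g)) (Dy f - Dy g) :=
  fun _ hx _ hy => ((hf.hasDy hx hy).sub (hg.hasDy hx hy)).deriv
lemma dy_mul (hf : Sm X d f) (hg : Sm X d g) : EqU X d (Dy (f * g)) (Dy f * g + f * Dy g) :=
  fun _ hx _ hy => ((hf.hasDy hx hy).mul (hg.hasDy hx hy)).deriv

lemma dt_iter_dy_comm (hf : Sm X d f) (n : ℕ) : EqU X d (Dt^[n] (Dy f)) (Dy (Dt^[n] f)) := by
  induction n generalizing f with
  | zero => exact EqU.refl _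
  | succ n ih =>
    simp only [Function.iterate_succ, Function.comp]
    exact ((dt_dy_comm hf).dt_iter n).trans (ih hf.dt)

lemma dy_iter_dt_comm (hf : Sm X d f) (n : ℕ) : EqU X d (Dy^[n] (Dt f)) (Dt (Dy^[n] f)) := by
  induction n with
  | zero => exact EqU.refl _
  | succ n ih =>
    simp only [Function.iterate_succ', Function.comp]
    exact ih.dy.trans (dt_dy_comm (hf.dy_iter isOpen_Ioo.uniqueDiffOn n)).symm
end

lemma pd_eq (k m : ℕ) (f : ℝ → ℝ → ℝ) (x y : ℝ) :
    iteratedDeriv k (fun x' => iteratedDeriv m (f x') y) x = (Dt^[k] (Dy^[m] f)) x y := by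
  have h1 : ∀ (m : ℕ) (f : ℝ → ℝ → ℝ), (fun x' y => iteratedDeriv m (f x') y) = Dy^[m] f := by
    intro m
    induction m with
    | zero => intro f; simp
    | succ m ih => intro f; simp only [iteratedDeriv_succ', Function.iterate_succ, Function.comp]; exact ih (Dy f)
  have h2 : ∀ (k : ℕ) (f : ℝ → ℝ → ℝ), (fun x y => iteratedDeriv k (fun x' => f x' y) x) = Dt^[k] f := by
    intro k
    induction k with
    | zero => intro f; simp
    | succ m ih => intro f; simp only [iteratedDeriv_succ', Function.iterate_succ, Function.comp]; exact ih (Dt f)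
  rw [← h1, ← h2]
end

noncomputable section

def Bd (X ε δ a : ℝ) (f : ℝ → ℝ → ℝ) : Prop :=
  ∃ C, ∀ t ∈ Ico ε X, ∀ y ∈ Ioc 0 δ, |f t y| ≤ C * y ^ a

def Cl (X ε δ : ℝ) (n m : ℕ) (a : ℝ) (f : ℝ → ℝ → ℝ) : Prop :=
  ∀ j ≤ n, ∀ l ≤ m, Bd X ε δ (a - l) (Dt^[j] (Dy^[l] f))

section
variable {X d ε δ a b : ℝ} {f g : ℝ → ℝ → ℝ} {n m : ℕ}

lemma Bd.pos (h : Bd X ε δ a f) : ∃ C > 0, ∀ t ∈ Ico ε X, ∀ y ∈ Ioc 0 δ, |f t y| ≤ C * y ^ a := by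
  obtain ⟨C, h⟩ := h
  refine ⟨|C| + 1, by positivity, fun t ht y hy => (h t ht y hy).trans ?_⟩
  have : 0 < y ^ a := Real.rpow_pos_of_pos hy.1 _
  have := le_abs_self C
  gcongr; linarith

lemma Bd.congr (hε : 0 < ε) (hδ : δ < d) (h : EqU X d f g) (hf : Bd X ε δ a f) : Bd X ε δ a g := by
  obtain ⟨C, hC⟩ := hf
  refine ⟨C, fun t ht y hy => ?_⟩
  rw [← h t ⟨hε.trans_le ht.1, ht.2⟩ y ⟨hy.1, hy.2.trans_lt hδ⟩]
  exact hC t ht y hy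

lemma Bd.mono' {ε' δ' : ℝ} (hε : ε ≤ ε') (hδ : δ' ≤ δ) (hf : Bd X ε δ a f) : Bd X ε' δ' a f := by
  obtain ⟨C, hC⟩ := hf
  exact ⟨C, fun t ht y hy => hC t ⟨hε.trans ht.1, ht.2⟩ y ⟨hy.1, hy.2.trans hδ⟩⟩

lemma Bd.weak (hδ : δ ≤ 1) (hab : b ≤ a) (hf : Bd X ε δ a f) : Bd X ε δ b f := by
  obtain ⟨C, h0, hC⟩ := hf.pos
  refine ⟨C, fun t ht y hy => (hC t ht y hy).trans ?_⟩
  exact mul_le_mul_of_nonneg_left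
    (Real.rpow_le_rpow_of_exponent_ge hy.1 (hy.2.trans hδ) hab) h0.le

lemma Bd.add (hf : Bd X ε δ a f) (hg : Bd X ε δ a g) : Bd X ε δ a (f + g) := by
  obtain ⟨C, hC⟩ := hf
  obtain ⟨D, hD⟩ := hg
  refine ⟨C + D, fun t ht y hy => ?_⟩
  have := hC t ht y hy
  have := hD t ht y hy
  calc |f t y + g t y| ≤ |f t y| + |g t y| := abs_add_le _ _
    _ ≤ _ := by linarith

lemma Bd.neg (hf : Bd X ε δ a f) : Bd X ε δ a (-f) := by
  obtain ⟨C, hC⟩ := hf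
  exact ⟨C, fun t ht y hy => by simpa using hC t ht y hy⟩

lemma Bd.mul (hf : Bd X ε δ a f) (hg : Bd X ε δ b g) : Bd X ε δ (a + b) (f * g) := by
  obtain ⟨C, c0, hC⟩ := hf.pos
  obtain ⟨D, d0, hD⟩ := hg.pos
  refine ⟨C * D, fun t ht y hy => ?_⟩
  have h1 := hC t ht y hy
  have h2 := hD t ht y hy
  calc |f t y * g t y| = |f t y| * |g t y| := abs_mul _ _
    _ ≤ (C * y ^ a) * (D * y ^ b)  :=
        mul_le_mul h1 h2 (abs_nonneg _) ((abs_nonneg _).trans h1)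
    _ = _ := by rw [Real.rpow_add hy.1]; ring

lemma Cl.mono {n' m' : ℕ} (hn : n' ≤ n) (hm : m' ≤ m) (h : Cl X ε δ n m a f) : Cl X ε δ n' m' a f :=
  fun j hj l hl => h j (hj.trans hn) l (hl.trans hm)

lemma Cl.mono' {ε' δ' : ℝ} (hε : ε ≤ ε') (hδ : δ' ≤ δ) (h : Cl X ε δ n m a f) :
    Cl X ε' δ' n m a f := fun j hj l hl => (h j hj l hl).mono' hε hδ

lemma Cl.weak (hδ : δ ≤ 1) (hab : b ≤ a) (h : Cl X ε δ n m a f) : Cl X ε δ n m b f :=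
  fun j hj l hl => (h j hj l hl).weak hδ (by linarith)

lemma Cl.bd (h : Cl X ε δ n m a f) : Bd X ε δ a f := by
  simpa using h 0 (Nat.zero_le _) 0 (Nat.zero_le _)

lemma cl_zero (h : Bd X ε δ a f) : Cl X ε δ 0 0 a f := by
  intro j hj l hl
  obtain rfl : j = 0 := by omega
  obtain rfl : l = 0 := by omega
  simpa using h

lemma EqU.dy_iter (h : EqU X d f g) (n : ℕ) : EqU X d (Dy^[n] f) (Dy^[n] g) := by
  induction n generalizing f g with
  | zero => exact h
  | succ n ih => simpa using ih h.dy

lemma Cl.congr (hε : 0 < ε) (hδ : δ < d) (h : EqU X d f g) (hf : Cl X ε δ n m a f) :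
    Cl X ε δ n m a g :=
  fun j hj l hl => (hf j hj l hl).congr hε hδ ((h.dy_iter l).dt_iter j)

lemma Cl.succ_y (h : Cl X ε δ n 0 a f) (h' : Cl X ε δ n m (a - 1) (Dy f)) :
    Cl X ε δ n (m + 1) a f := by
  intro j hj l hl
  rcases l with _ | l
  · exact h j hj 0 le_rfl
  · have := h' j hj l (by omega)
    simp only [Function.iterate_succ, Function.comp]
    convert this using 1
    push_cast; ring

lemma Cl.dy (h : Cl X ε δ n (m + 1) a f) : Cl X ε δ n m (a - 1) (Dy f) := by
  intro j hj l hl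
  have := h j hj (l + 1) (by omega)
  simp only [Function.iterate_succ, Function.comp] at this
  convert this using 1
  push_cast; ring

lemma Cl.succ_t (hε : 0 < ε) (hδ : δ < d) (hs : Sm X d f) (h : Cl X ε δ 0 m a f)
    (h' : Cl X ε δ n m a (Dt f)) : Cl X ε δ (n + 1) m a f := by
  intro j hj l hl
  rcases j with _ | j
  · exact h 0 le_rfl l hl
  · have := h' j (by omega) l hl
    simp only [Function.iterate_succ, Function.comp]
    exact this.congr hε hδ ((dy_iter_dt_comm hs l).dt_iter j)

lemma Cl.dt (hε : 0 < ε) (hδ : δ < d) (hs : Sm X d f) (h : Cl X ε δ (n + 1) m a f) :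
    Cl X ε δ n m a (Dt f) := by
  intro j hj l hl
  have := h (j + 1) (by omega) l hl
  simp only [Function.iterate_succ, Function.comp] at this
  exact this.congr hε hδ ((dy_iter_dt_comm hs l).dt_iter j).symm

/-- general induction principle -/
lemma Cl.add (hε : 0 < ε) (hδ : δ < d) (hsf : Sm X d f) (hsg : Sm X d g)
    (hf : Cl X ε δ n m a f) (hg : Cl X ε δ n m a g) : Cl X ε δ n m a (f + g) := by
  have hy : ∀ l, EqU X d (Dy^[l] (f + g)) (Dy^[l] f + Dy^[l] g) := by
    intro l
    induction l with
    | zero => exact EqU.refl _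
    | succ l ih =>
      simp only [Function.iterate_succ', Function.comp]
      exact ih.dy.trans (dy_add (hsf.dy_iter isOpen_Ioo.uniqueDiffOn l)
        (hsg.dy_iter isOpen_Ioo.uniqueDiffOn l))
  have ht : ∀ j (F G : ℝ → ℝ → ℝ), Sm X d F → Sm X d G →
      EqU X d (Dt^[j] (F + G)) (Dt^[j] F + Dt^[j] G) := by
    intro j F G hF hG
    induction j with
    | zero => exact EqU.refl _
    | succ l ih =>
      simp only [Function.iterate_succ', Function.comp]
      exact ih.dt.trans (dt_add (hF.dt_iter l) (hG.dt_iter l))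
  intro j hj l hl
  refine ((hf j hj l hl).add (hg j hj l hl)).congr hε hδ ?_
  exact (((hy l).dt_iter j).trans (ht j _ _ (hsf.dy_iter isOpen_Ioo.uniqueDiffOn l)
        (hsg.dy_iter isOpen_Ioo.uniqueDiffOn l))).symm

lemma Cl.mul (hε : 0 < ε) (hδ : δ < d) (hsf : Sm X d f) (hsg : Sm X d g)
    (hf : Cl X ε δ n m a f) (hg : Cl X ε δ n m b g) : Cl X ε δ n m (a + b) (f * g) := by
  induction n generalizing m f g a b with
  | zero =>
    induction m generalizing f g a b with
    | zero => exact cl_zero (hf.bd.mul hg.bd)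
    | succ m ih =>
      refine Cl.succ_y (cl_zero (hf.bd.mul hg.bd)) ?_
      refine Cl.congr hε hδ (dy_mul hsf hsg).symm ?_
      refine Cl.add hε hδ (hsf.dyU.mul hsg) (hsf.mul hsg.dyU) ?_ ?_
      · convert ih hsf.dyU hsg hf.dy (hg.mono le_rfl (Nat.le_succ _)) using 1; ring
      · convert ih hsf hsg.dyU (hf.mono le_rfl (Nat.le_succ _)) hg.dy using 1; ring
  | succ n ih =>
    have hn : n ≤ n + 1 := Nat.le_succ _
    refine Cl.succ_t hε hδ (hsf.mul hsg)
      ((ih hsf hsg (hf.mono hn le_rfl) (hg.mono hn le_rfl)).mono (Nat.zero_le _) le_rfl) ?_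
    refine Cl.congr hε hδ (dt_mul hsf hsg).symm ?_
    refine Cl.add hε hδ (hsf.dt.mul hsg) (hsf.mul hsg.dt) ?_ ?_
    · exact ih hsf.dt hsg (hf.dt hε hδ hsf) (hg.mono hn le_rfl)
    · exact ih hsf hsg.dt (hf.mono hn le_rfl) (hg.dt hε hδ hsg)

lemma Cl.ofT {q : ℝ → ℝ} (hε : 0 < ε) (hδ : δ < d) (hq : ContDiff ℝ (⊤ : ℕ∞) q) :
    Cl X ε δ n m 0 (fun x _ => q x) := by
  have hb : ∀ {q : ℝ → ℝ}, ContDiff ℝ (⊤ : ℕ∞) q → Bd X ε δ 0 (fun x _ => q x) := by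
    intro q hq
    obtain ⟨C, hC⟩ := (isCompact_Icc (a := ε) (b := X)).exists_bound_of_continuousOn
      hq.continuous.continuousOn
    exact ⟨C, fun t ht y hy => by simpa using hC t ⟨ht.1, ht.2.le⟩⟩
  have hz : ∀ (a : ℝ) (m n : ℕ), Cl X ε δ n m a (fun _ _ => (0:ℝ)) := by
    intro a m n j hj l hl
    have h1 : ∀ l, (Dy^[l] (fun _ _ => (0:ℝ))) = fun _ _ => 0 := by
      intro l
      induction l with
      | zero => rfl
      | succ l ih => rw [Function.iterate_succ', Function.comp, ih]; ext; simp [Dy]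
    have h2 : ∀ l, (Dt^[l] (fun _ _ => (0:ℝ))) = fun _ _ => 0 := by
      intro l
      induction l with
      | zero => rfl
      | succ l ih => rw [Function.iterate_succ', Function.comp, ih]; ext; simp [Dt]
    rw [h1, h2]
    exact ⟨0, by simp⟩
  induction n generalizing m q with
  | zero =>
    cases m with
    | zero => exact cl_zero (hb hq)
    | succ m =>
      refine Cl.succ_y (cl_zero (hb hq)) ?_
      have : Dy (fun x _ => q x) = fun _ _ => 0 := by ext; simp [Dy]
      rw [this]; exact hz _ _ _
  | succ n ih =>
    refine Cl.succ_t hε hδ (SmI.ofT hq) ((ih hq).mono (Nat.zero_le _) le_rfl) ?_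
    have : Dt (fun x _ => q x) = fun x _ => deriv q x := by ext; simp [Dt]
    rw [this]
    exact ih ((contDiff_infty_iff_deriv.1 hq).2)

lemma Cl.neg (hε : 0 < ε) (hδ : δ < d) (hsf : Sm X d f) 
    (hf : Cl X ε δ n m a f) : Cl X ε δ n m a (-f) := by
  have := Cl.mul hε hδ (SmI.const (-1)) hsf (Cl.ofT (q := fun _ => -1) hε hδ contDiff_const) hf
  rw [zero_add] at this
  refine Cl.congr hε hδ ?_ this
  intro x hx y hy; simp

lemma Cl.sub (hε : 0 < ε) (hδ : δ < d) (hsf : Sm X d f) (hsg : Sm X d g)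
    (hf : Cl X ε δ n m a f) (hg : Cl X ε δ n m a g) : Cl X ε δ n m a (f - g) := by
  rw [sub_eq_add_neg]
  exact hf.add hε hδ hsf hsg.neg (hg.neg hε hδ hsg)

lemma Cl.const_mul (c : ℝ) (hε : 0 < ε) (hδ : δ < d) (hsf : Sm X d f) 
    (hf : Cl X ε δ n m a f) : Cl X ε δ n m a ((fun _ _ => c) * f) := by
  have := Cl.mul hε hδ (SmI.const c) hsf (Cl.ofT (q := fun _ => c) hε hδ contDiff_const) hf
  rwa [zero_add] at this
end
end

noncomputable section

structure Setup (X d μ M C₀ α : ℝ) (q : ℝ → ℝ) (w r R : ℝ → ℝ → ℝ) : Prop where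
  hX : 0 < X
  hd : 0 < d
  hd1 : d ≤ 1
  hμ : 0 < μ
  hM : 0 < M
  hC₀ : 0 < C₀
  hα : 0 < α
  hq : ContDiff ℝ (⊤ : ℕ∞) q
  q0 : ∀ x, 0 ≤ q x
  sw : Sm X d w
  sr : Sm X d r
  sR : Sm X d R
  Rpos : ∀ x ∈ Ioo 0 X, ∀ y ∈ Ioo 0 d, 0 < R x y
  rR : ∀ x ∈ Ioo 0 X, ∀ y ∈ Ioo 0 d, r x y * R x y = 1
  RR : ∀ x ∈ Ioo 0 X, ∀ y ∈ Ioo 0 d, R x y ^ 2 = w x y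
  wlb : ∀ x ∈ Ioo 0 X, ∀ y ∈ Ioo 0 d, μ * y ≤ w x y
  wub : ∀ x ∈ Ioo 0 X, ∀ y ∈ Ioo 0 d, w x y ≤ M * y
  pde : ∀ x ∈ Ioo 0 X, ∀ y ∈ Ioo 0 d, Dt w x y = R x y * Dy (Dy w) x y + q x
  base : ∀ x ∈ Ioo 0 X, ∀ y ∈ Ioo 0 d, |Dt w x y| ≤ C₀ * y ^ ((1:ℝ) / 2 + α)

namespace Setup
variable {X d μ M C₀ α : ℝ} {q : ℝ → ℝ} {w r R : ℝ → ℝ → ℝ}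
variable (S : Setup X d μ M C₀ α q w r R)
include S

lemma rpos {x y : ℝ} (hx : x ∈ Ioo 0 X) (hy : y ∈ Ioo 0 d) : 0 < r x y := by
  have h1 := S.rR x hx y hy
  have h2 := S.Rpos x hx y hy
  by_contra h
  nlinarith

lemma dtw {x y : ℝ} (hx : x ∈ Ioo 0 X) (hy : y ∈ Ioo 0 d) :
    Dt w x y = 2 * R x y * Dt R x y := by
  have h : EqU X d w (R * R) := fun x hx y hy => by rw [← S.RR x hx y hy, sq]; rfl
  have h2 := dt_mul S.sR S.sR x hx y hy
  rw [h.dt x hx y hy, h2]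
  simp; ring

lemma dyw {x y : ℝ} (hx : x ∈ Ioo 0 X) (hy : y ∈ Ioo 0 d) :
    Dy w x y = 2 * R x y * Dy R x y := by
  have h : EqU X d w (R * R) := fun x hx y hy => by rw [← S.RR x hx y hy, sq]; rfl
  have h2 := dy_mul S.sR S.sR x hx y hy
  rw [h.dy x hx y hy, h2]
  simp; ring

lemma dtR {x y : ℝ} (hx : x ∈ Ioo 0 X) (hy : y ∈ Ioo 0 d) :
    Dt R x y = 1 / 2 * r x y * Dt w x y := by
  rw [S.dtw hx hy]; linear_combination -(S.rR x hx y hy) * Dt R x y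

lemma dyR {x y : ℝ} (hx : x ∈ Ioo 0 X) (hy : y ∈ Ioo 0 d) :
    Dy R x y = 1 / 2 * r x y * Dy w x y := by
  rw [S.dyw hx hy]; linear_combination -(S.rR x hx y hy) * Dy R x y

lemma dtr {x y : ℝ} (hx : x ∈ Ioo 0 X) (hy : y ∈ Ioo 0 d) :
    Dt r x y = -1 / 2 * r x y ^ 3 * Dt w x y := by
  have h : EqU X d (r * R) (fun _ _ => 1) := fun x hx y hy => S.rR x hx y hy
  have h1 := h.dt x hx y hy
  have h2 := dt_mul S.sr S.sR x hx y hy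
  have h3 : Dt (fun _ _ => (1:ℝ)) x y = 0 := by simp [Dt]
  rw [h1, h3] at h2
  simp only [Pi.add_apply, Pi.mul_apply] at h2
  rw [S.dtR hx hy] at h2
  have e := S.rR x hx y hy
  linear_combination -(Dt r x y) * e - r x y * h2

lemma dyr {x y : ℝ} (hx : x ∈ Ioo 0 X) (hy : y ∈ Ioo 0 d) :
    Dy r x y = -1 / 2 * r x y ^ 3 * Dy w x y := by
  have h : EqU X d (r * R) (fun _ _ => 1) := fun x hx y hy => S.rR x hx y hy
  have h1 := h.dy x hx y hy
  have h2 := dy_mul S.sr S.sR x hx y hy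
  have h3 : Dy (fun _ _ => (1:ℝ)) x y = 0 := by simp [Dy]
  rw [h1, h3] at h2
  simp only [Pi.add_apply, Pi.mul_apply] at h2
  rw [S.dyR hx hy] at h2
  have e := S.rR x hx y hy
  linear_combination -(Dy r x y) * e - r x y * h2

lemma wyy {x y : ℝ} (hx : x ∈ Ioo 0 X) (hy : y ∈ Ioo 0 d) :
    Dy (Dy w) x y = r x y * (Dt w x y - q x) := by
  have := S.pde x hx y hy
  have e := S.rR x hx y hy
  linear_combination -(Dy (Dy w) x y) * e - r x y * this

lemma r2 {x y : ℝ} (hx : x ∈ Ioo 0 X) (hy : y ∈ Ioo 0 d) : r x y ^ 2 ≤ 1 / (μ * y) := by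
  have h1 := S.rR x hx y hy
  have h2 := S.RR x hx y hy
  have h3 := S.wlb x hx y hy
  have h4 : 0 < μ * y := mul_pos S.hμ hy.1
  rw [le_div_iff₀ h4]
  calc r x y ^ 2 * (μ * y) ≤ r x y ^ 2 * R x y ^ 2 := by rw [h2]; gcongr
    _ = 1 := by rw [← mul_pow, h1, one_pow]

lemma bd_r {ε δ : ℝ} (hε : 0 < ε) (hδ : δ < d) : Bd X ε δ (-1/2) r := by
  refine ⟨√(1 / μ), fun t ht y hy => ?_⟩
  have hx : t ∈ Ioo 0 X := ⟨hε.trans_le ht.1, ht.2⟩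
  have hy' : y ∈ Ioo 0 d := ⟨hy.1, hy.2.trans_lt hδ⟩
  refine abs_le_of_sq_le_sq ?_ (by have := hy.1; positivity)
  rw [mul_pow, Real.sq_sqrt (by have := S.hμ; positivity), ← Real.rpow_natCast (y ^ _), ← Real.rpow_mul hy.1.le]
  norm_num
  rw [Real.rpow_neg_one]
  have := S.r2 hx hy'
  rw [one_div, mul_inv] at this
  exact this

lemma cl_r {ε δ : ℝ} (hε : 0 < ε) (hδ : δ < d) {n m : ℕ} (h : Cl X ε δ n m 1 w) :
    Cl X ε δ n m (-1/2) r := by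
  have key : ∀ {n m : ℕ} {b : ℝ} {g : ℝ → ℝ → ℝ}, Sm X d g → Cl X ε δ n m (-1/2) r → Cl X ε δ n m b g →
      Cl X ε δ n m (-3/2 + b) ((fun _ _ => (-1/2 : ℝ)) * (r * (r * (r * g)))) := by
    intro n m b g sg hr hg
    have s1 := S.sr.mul sg
    have s2 := S.sr.mul s1
    have := Cl.const_mul (-1/2) hε hδ (S.sr.mul s2) (hr.mul hε hδ S.sr s2 (hr.mul hε hδ S.sr s1 (hr.mul hε hδ S.sr sg hg)))
    convert this using 1; ring
  induction n generalizing m with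
  | zero =>
    induction m with
    | zero => exact cl_zero (S.bd_r hε hδ)
    | succ m ih =>
      have hr := ih (h.mono le_rfl (Nat.le_succ _))
      refine Cl.succ_y (hr.mono le_rfl (Nat.zero_le _)) ?_
      have := key S.sw.dyU hr h.dy
      have e : (-3/2 + (1 - 1) : ℝ) = -1/2 - 1 := by ring
      rw [e] at this
      refine this.congr hε hδ fun x hx y hy => ?_
      rw [S.dyr hx hy]; simp; ring
  | succ n ih =>
    have hr := ih (h.mono (Nat.le_succ _) le_rfl)
    refine Cl.succ_t hε hδ S.sr (hr.mono (Nat.zero_le _) le_rfl) ?_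
    have := key S.sw.dt hr (h.dt hε hδ S.sw)
    have e : (-3/2 + 1 : ℝ) = -1/2 := by ring
    rw [e] at this
    refine this.congr hε hδ fun x hx y hy => ?_
    rw [S.dtr hx hy]; simp; ring

lemma sq : Sm X d (fun x _ => q x) := SmI.ofT S.hq

lemma cl_wyy {ε δ : ℝ} (hε : 0 < ε) (hδ : δ < d) {n m : ℕ} (h : Cl X ε δ (n+1) m 1 w) :
    Cl X ε δ n m (-1/2) (Dy (Dy w)) := by
  have hδ1 : δ ≤ 1 := hδ.le.trans S.hd1
  have h1 : Cl X ε δ n m 0 (Dt w - fun x _ => q x) :=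
    Cl.sub hε hδ S.sw.dt S.sq ((h.dt hε hδ S.sw).weak hδ1 (by norm_num)) (Cl.ofT hε hδ S.hq)
  have h2 := (S.cl_r hε hδ (h.mono (Nat.le_succ _) le_rfl)).mul hε hδ S.sr (S.sw.dt.sub S.sq) h1
  rw [add_zero] at h2
  exact h2.congr hε hδ fun x hx y hy => by rw [S.wyy hx hy]; rfl

/-- mean value bound for `∂_y` -/
lemma dy_bound {ε δ : ℝ} (hε : 0 < ε) (hδ : δ < d) {f : ℝ → ℝ → ℝ} (hf : Sm X d f)
    (h1 : Bd X ε δ 1 f) (h2 : Bd X ε δ (-1/2) (Dy (Dy f))) : Bd X ε (δ/2) 0 (Dy f) := by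
  have hδ1 : δ ≤ 1 := hδ.le.trans S.hd1
  obtain ⟨C, c0, hC⟩ := h1.pos
  obtain ⟨D, d0, hD⟩ := (h2.weak hδ1 (show (-1:ℝ) ≤ -1/2 by norm_num)).pos
  refine ⟨3 * C + D, fun t ht y hy => ?_⟩
  have hx : t ∈ Ioo 0 X := ⟨hε.trans_le ht.1, ht.2⟩
  have y0 := hy.1
  have hyd : 2 * y ≤ δ := by linarith [hy.2]
  have hsub : ∀ z ∈ Icc y (2 * y), z ∈ Ioo 0 d := fun z hz => ⟨y0.trans_le hz.1, by linarith [hz.2]⟩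
  have hsub2 : ∀ z ∈ Icc y (2 * y), z ∈ Ioc 0 δ := fun z hz => ⟨y0.trans_le hz.1, by linarith [hz.2]⟩
  obtain ⟨ξ, hξ, e1⟩ := exists_hasDerivAt_eq_slope (f t) (Dy f t) (show y < 2 * y by linarith)
    (fun z hz => (hf.hasDy hx (hsub z hz)).continuousAt.continuousWithinAt)
    (fun z hz => hf.hasDy hx (hsub z ⟨hz.1.le, hz.2.le⟩))
  obtain ⟨ξ', hξ', e2⟩ := exists_hasDerivAt_eq_slope (Dy f t) (Dy (Dy f) t) hξ.1
    (fun z hz => (hf.dyU.hasDy hx (hsub z ⟨hz.1, hz.2.trans hξ.2.le⟩)).continuousAt.continuousWithinAt)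
    (fun z hz => hf.dyU.hasDy hx (hsub z ⟨hz.1.le, hz.2.le.trans hξ.2.le⟩))
  have a1 := hC t ht y (hsub2 y ⟨le_rfl, by linarith⟩)
  have a2 := hC t ht (2*y) (hsub2 _ ⟨by linarith, le_rfl⟩)
  have a3 := hD t ht ξ' (hsub2 _ ⟨hξ'.1.le, (hξ'.2.trans hξ.2).le⟩)
  rw [Real.rpow_one] at a1 a2
  rw [Real.rpow_neg_one] at a3
  rw [Real.rpow_zero, mul_one]
  have b1 : |Dy f t ξ| ≤ 3 * C := by
    rw [e1, abs_div, abs_of_pos (show 0 < 2 * y - y by linarith), div_le_iff₀ (by linarith)]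
    calc _ ≤ |f t (2*y)| + |f t y| := abs_sub _ _
      _ ≤ _ := by linarith
  have b2 : |Dy f t ξ - Dy f t y| ≤ D := by
    have hp : 0 < ξ - y := by linarith [hξ.1]
    have : Dy f t ξ - Dy f t y = Dy (Dy f) t ξ' * (ξ - y) := by rw [e2]; field_simp
    rw [this, abs_mul, abs_of_pos hp]
    have hξ0 : 0 < ξ' := y0.trans hξ'.1
    calc _ ≤ (D * ξ'⁻¹) * (ξ - y) := by gcongr
      _ ≤ (D * ξ'⁻¹) * ξ' := by gcongr; linarith [hξ.2, hξ'.1]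
      _ = D := by field_simp
  have : Dy f t y = Dy f t ξ - (Dy f t ξ - Dy f t y) := by ring
  rw [this]
  exact (abs_sub _ _).trans (add_le_add b1 b2)

lemma cl_y {ε δ : ℝ} (hε : 0 < ε) (hδ : δ < d) (h0 : 0 < δ) {n : ℕ} (h : Cl X ε δ (n+1) 0 1 w) :
    Cl X ε (δ/2) n 2 1 w := by
  have hδ' : δ/2 < d := by linarith
  have hδ1 : δ ≤ 1 := hδ.le.trans S.hd1
  have h2 := S.cl_wyy hε hδ h
  have h1 : Cl X ε (δ/2) n 0 (1-1) (Dy w) := by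
    intro j hj l hl
    obtain rfl : l = 0 := by omega
    simp only [Function.iterate_zero, id]
    have a1 := h j (by omega) 0 le_rfl
    have a2 := h2 j hj 0 le_rfl
    simp only [Function.iterate_zero, id] at a1 a2
    have a3 := S.dy_bound hε hδ (S.sw.dt_iter j) (by simpa using a1) (by
      refine Bd.congr hε hδ ?_ (by simpa using a2)
      exact (dt_iter_dy_comm S.sw.dyU j).trans (dt_iter_dy_comm S.sw j).dy)
    refine Bd.congr hε hδ' (dt_iter_dy_comm S.sw j).symm ?_
    simpa using a3
  refine Cl.succ_y ((h.mono (Nat.le_succ _) le_rfl).mono' le_rfl (by linarith)) (Cl.succ_y h1 ?_)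
  exact (h2.weak hδ1 (by norm_num)).mono' le_rfl (by linarith)

lemma cl_yy {ε δ : ℝ} (hε : 0 < ε) (hδ : δ < d) {n m : ℕ} (h : Cl X ε δ (n+1) m 1 w)
    (h1 : Cl X ε δ n 1 1 w) : Cl X ε δ n (m+2) 1 w := by
  have hδ1 : δ ≤ 1 := hδ.le.trans S.hd1
  refine Cl.succ_y (h1.mono le_rfl (by omega)) (Cl.succ_y h1.dy ?_)
  exact ((S.cl_wyy hε hδ h).weak hδ1 (by norm_num))

end Setup
end

noncomputable section

def gg (w R : ℝ → ℝ → ℝ) (n : ℕ) : ℝ → ℝ → ℝ := Dt^[n+1] w - R * Dy (Dy (Dt^[n] w))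

def BB (q : ℝ → ℝ) (w r : ℝ → ℝ → ℝ) (c : ℝ) : ℝ → ℝ → ℝ :=
  (fun _ _ => (1/2 : ℝ)) * (r * (r * ((fun _ _ => c) * Dt w - fun x _ => q x)))

def LL (w r : ℝ → ℝ → ℝ) : ℝ → ℝ → ℝ := (fun _ _ => (1/2 : ℝ)) * (r * (r * Dt w))

namespace Setup
variable {X d μ M C₀ α : ℝ} {q : ℝ → ℝ} {w r R : ℝ → ℝ → ℝ}
variable (S : Setup X d μ M C₀ α q w r R)
include S

lemma s_u (n : ℕ) : Sm X d (Dt^[n] w) := S.sw.dt_iter n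
lemma s_g (n : ℕ) : Sm X d (gg w R n) := (S.s_u _).sub (S.sR.mul (S.s_u _).dyU.dyU)
lemma s_cu (c : ℝ) : Sm X d ((fun _ _ => c) * Dt w - fun x _ => q x) :=
  ((SmI.const c).mul S.sw.dt).sub S.sq
lemma s_B (c : ℝ) : Sm X d (BB q w r c) :=
  (SmI.const _).mul (S.sr.mul (S.sr.mul (S.s_cu c)))
lemma s_L : Sm X d (LL w r) := (SmI.const _).mul (S.sr.mul (S.sr.mul S.sw.dt))

lemma cl_cu {ε δ : ℝ} (hε : 0 < ε) (hδ : δ < d) {n m : ℕ} (c : ℝ) (h : Cl X ε δ (n+1) m 1 w) :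
    Cl X ε δ n m 0 ((fun _ _ => c) * Dt w - fun x _ => q x) := by
  have hδ1 : δ ≤ 1 := hδ.le.trans S.hd1
  refine Cl.sub hε hδ ((SmI.const c).mul S.sw.dt) S.sq ?_ (Cl.ofT hε hδ S.hq)
  exact Cl.const_mul c hε hδ S.sw.dt ((h.dt hε hδ S.sw).weak hδ1 (by norm_num))

lemma cl_B {ε δ : ℝ} (hε : 0 < ε) (hδ : δ < d) {n m : ℕ} (c : ℝ) (h : Cl X ε δ (n+1) m 1 w) :
    Cl X ε δ n m (-1) (BB q w r c) := by
  have hr := S.cl_r hε hδ (h.mono (Nat.le_succ _) le_rfl)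
  have h3 := Cl.const_mul (1/2) hε hδ (S.sr.mul (S.sr.mul (S.s_cu c)))
    (hr.mul hε hδ S.sr (S.sr.mul (S.s_cu c)) (hr.mul hε hδ S.sr (S.s_cu c) (S.cl_cu hε hδ c h)))
  rw [show (-1/2 + (-1/2 + 0) : ℝ) = -1 by norm_num] at h3
  exact h3

lemma cl_L {ε δ : ℝ} (hε : 0 < ε) (hδ : δ < d) {n m : ℕ} (h : Cl X ε δ (n+1) m 1 w) :
    Cl X ε δ n m 0 (LL w r) := by
  have hr := S.cl_r hε hδ (h.mono (Nat.le_succ _) le_rfl)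
  have h3 := Cl.const_mul (1/2) hε hδ (S.sr.mul (S.sr.mul S.sw.dt))
    (hr.mul hε hδ S.sr (S.sr.mul S.sw.dt) (hr.mul hε hδ S.sr S.sw.dt (h.dt hε hδ S.sw)))
  rw [show (-1/2 + (-1/2 + 1) : ℝ) = 0 by norm_num] at h3
  exact h3

lemma cl_u {ε δ : ℝ} (hε : 0 < ε) (hδ : δ < d) {n m : ℕ} (k : ℕ) (h : Cl X ε δ (n+k) m 1 w) :
    Cl X ε δ n m 1 (Dt^[k] w) := by
  induction k generalizing n with
  | zero => exact h
  | succ k ih =>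
    rw [Function.iterate_succ', Function.comp]
    exact (ih (n := n + 1) (by rwa [show n + 1 + k = n + (k+1) by ring])).dt hε hδ (S.s_u k)

lemma uyy (n : ℕ) {x y : ℝ} (hx : x ∈ Ioo 0 X) (hy : y ∈ Ioo 0 d) :
    Dy (Dy (Dt^[n] w)) x y = r x y * (Dt^[n+1] w x y - gg w R n x y) := by
  have e := S.rR x hx y hy
  simp only [gg, Pi.sub_apply, Pi.mul_apply]
  linear_combination -(Dy (Dy (Dt^[n] w)) x y) * e

lemma g_rec (n : ℕ) {x y : ℝ} (hx : x ∈ Ioo 0 X) (hy : y ∈ Ioo 0 d) :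
    gg w R (n+1) x y = Dt (gg w R n) x y + LL w r x y * (Dt^[n+1] w x y - gg w R n x y) := by
  have h1 := dt_sub (S.s_u (n+1)) (S.sR.mul (S.s_u n).dyU.dyU) x hx y hy
  have h2 := dt_mul S.sR (S.s_u n).dyU.dyU x hx y hy
  have h3 : Dt (Dy (Dy (Dt^[n] w))) x y = Dy (Dy (Dt^[n+1] w)) x y := by
    rw [dt_dy_comm (S.s_u n).dyU x hx y hy, (dt_dy_comm (S.s_u n)).dy x hx y hy,
      Function.iterate_succ', Function.comp]
  have h4 := S.uyy n hx hy
  simp only [Pi.sub_apply, Pi.mul_apply, Pi.add_apply] at h1 h2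
  have h5 : Dt (gg w R n) x y = Dt (Dt^[n+1] w) x y - Dt (R * Dy (Dy (Dt^[n] w))) x y := h1
  have h6 : gg w R (n+1) x y = Dt (Dt^[n+1] w) x y - R x y * Dy (Dy (Dt^[n+1] w)) x y := by
    rw [gg, Function.iterate_succ' Dt (n+1)]; rfl
  rw [h5, h6, h2, h3, h4, S.dtR hx hy]
  simp only [LL, Pi.mul_apply]
  ring

lemma dtB (c : ℝ) {x y : ℝ} (hx : x ∈ Ioo 0 X) (hy : y ∈ Ioo 0 d) :
    Dt (BB q w r c) x y = 1/2 * r x y ^ 2 * (c * Dt (Dt w) x y - deriv q x)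
      - 1/2 * r x y ^ 4 * Dt w x y * (c * Dt w x y - q x) := by
  have h1 := S.sr.hasDt hx hy
  have h2 := S.sw.dt.hasDt hx hy
  have h3 : HasDerivAt q (deriv q x) x := (S.hq.differentiable (by simp) x).hasDerivAt
  have h4 := ((h1.mul (h1.mul ((h2.const_mul c).sub h3))).const_mul (1/2)).deriv
  have h5 : Dt (BB q w r c) x y = deriv (fun x' => 1/2 * (r x' y * (r x' y * (c * Dt w x' y - q x')))) x := rfl
  rw [h5]
  refine h4.trans ?_
  simp only [Pi.mul_apply, Pi.sub_apply]
  rw [S.dtr hx hy]; ring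

lemma key (n : ℕ) : ∃ (c : ℝ) (f : ℝ → ℝ → ℝ), Sm X d f ∧
    EqU X d (gg w R (n+1)) (BB q w r c * Dt^[n+1] w + f) ∧
    ∀ ε δ : ℝ, 0 < ε → δ < d → ∀ i m : ℕ, Cl X ε δ (n+i) m 1 w → Cl X ε δ i m 0 f := by
  have hq' : ContDiff ℝ (⊤ : ℕ∞) (deriv q) := (contDiff_infty_iff_deriv.1 S.hq).2
  induction n with
  | zero =>
    refine ⟨1, fun x _ => deriv q x, SmI.ofT hq', ?_, fun ε δ hε hδ i m _ => Cl.ofT hε hδ hq'⟩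
    intro x hx y hy
    rw [S.g_rec 0 hx hy]
    have h0 : EqU X d (gg w R 0) (fun x _ => q x) := fun x hx y hy => by
      have := S.pde x hx y hy
      simp [gg, this]
    rw [h0 x hx y hy, h0.dt x hx y hy]
    simp [Dt, BB, LL]; ring
  | succ n ih =>
    obtain ⟨c, f, sf, he, hf⟩ := ih
    have sB := S.s_B c
    have su := S.s_u (n+1)
    -- the derivative of g
    have hg : ∀ x ∈ Ioo 0 X, ∀ y ∈ Ioo 0 d, gg w R (n+1+1) x y =
        Dt (BB q w r c) x y * Dt^[n+1] w x y + BB q w r c x y * Dt^[n+1+1] w x y + Dt f x y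
        + LL w r x y * (Dt^[n+1+1] w x y - (BB q w r c x y * Dt^[n+1] w x y + f x y)) := by
      intro x hx y hy
      have h2 := dt_add (sB.mul su) sf x hx y hy
      have h3 := dt_mul sB su x hx y hy
      simp only [Pi.add_apply, Pi.mul_apply] at h2 h3
      rw [S.g_rec (n+1) hx hy, he.dt x hx y hy, he x hx y hy, h2, h3,
        Function.iterate_succ' Dt (n+1)]
      simp only [Pi.add_apply, Pi.mul_apply, Function.comp]
    have hrest : ∀ ε δ : ℝ, 0 < ε → δ < d → ∀ i m : ℕ, Cl X ε δ (n+1+i) m 1 w →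
        Cl X ε δ i m 0 (Dt f - LL w r * (BB q w r c * Dt^[n+1] w + f)) := by
      intro ε δ hε hδ i m hw
      have hw1 : Cl X ε δ (i+1) m 1 w := hw.mono (by omega) le_rfl
      have a1 : Cl X ε δ i m 0 (Dt f) :=
        (hf ε δ hε hδ (i+1) m (hw.mono (by omega) le_rfl)).dt hε hδ sf
      have a2 : Cl X ε δ i m 0 f := hf ε δ hε hδ i m (hw.mono (by omega) le_rfl)
      have a3 := (S.cl_B hε hδ c hw1).mul hε hδ sB su
        (S.cl_u hε hδ (n+1) (n := i) (hw.mono (by omega) le_rfl))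
      rw [show (-1 + 1 : ℝ) = 0 by norm_num] at a3
      have a4 := (S.cl_L hε hδ hw1).mul hε hδ S.s_L ((sB.mul su).add sf)
        (a3.add hε hδ (sB.mul su) sf a2)
      rw [show (0 + 0 : ℝ) = 0 by norm_num] at a4
      exact a1.sub hε hδ sf.dt (S.s_L.mul ((sB.mul su).add sf)) a4
    have srest : Sm X d (Dt f - LL w r * (BB q w r c * Dt^[n+1] w + f)) :=
      sf.dt.sub (S.s_L.mul ((sB.mul su).add sf))
    rcases Nat.eq_zero_or_pos n with hn | hn
    · subst hn
      have sqd : Sm X d (fun x _ => deriv q x) := SmI.ofT hq'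
      have s1 : Sm X d (r * (r * (fun x _ => deriv q x))) := S.sr.mul (S.sr.mul sqd)
      have s2 : Sm X d (r * (r * (LL w r * ((fun _ _ => c) * Dt w - fun x _ => q x)))) :=
        S.sr.mul (S.sr.mul (S.s_L.mul (S.s_cu c)))
      have s3 : Sm X d ((fun _ _ => (-1/2:ℝ)) * (r * (r * (fun x _ => deriv q x)))
        - r * (r * (LL w r * ((fun _ _ => c) * Dt w - fun x _ => q x)))) :=
        ((SmI.const _).mul s1).sub s2
      refine ⟨2 * c + 1, ((fun _ _ => (-1/2:ℝ)) * (r * (r * (fun x _ => deriv q x)))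
        - r * (r * (LL w r * ((fun _ _ => c) * Dt w - fun x _ => q x)))) * Dt w
          + (Dt f - LL w r * (BB q w r c * Dt^[0+1] w + f)), ?_, ?_, ?_⟩
      · exact (s3.mul S.sw.dt).add srest
      · intro x hx y hy
        rw [hg x hx y hy, S.dtB c hx hy]
        simp only [Pi.add_apply, Pi.mul_apply, Pi.sub_apply, BB, LL, Function.iterate_succ,
          Function.comp, Function.iterate_zero, id]
        ring
      · intro ε δ hε hδ i m hw
        have hw1 : Cl X ε δ (i+1) m 1 w := hw.mono (by omega) le_rfl
        have hr := S.cl_r hε hδ (hw1.mono (Nat.le_succ _) le_rfl)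
        have b1 := Cl.const_mul (-1/2) hε hδ s1 (hr.mul hε hδ S.sr (S.sr.mul sqd)
          (hr.mul hε hδ S.sr sqd (Cl.ofT hε hδ hq')))
        have b2 := hr.mul hε hδ S.sr (S.sr.mul (S.s_L.mul (S.s_cu c)))
          (hr.mul hε hδ S.sr (S.s_L.mul (S.s_cu c))
            ((S.cl_L hε hδ hw1).mul hε hδ S.s_L (S.s_cu c) (S.cl_cu hε hδ c hw1)))
        rw [show (-1/2 + (-1/2 + (0 + 0)) : ℝ) = -1 by norm_num] at b2
        rw [show (-1/2 + (-1/2 + 0) : ℝ) = -1 by norm_num] at b1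
        have b3 := (b1.sub hε hδ ((SmI.const _).mul s1) s2 b2).mul hε hδ s3 S.sw.dt
          (hw1.dt hε hδ S.sw)
        rw [show (-1 + 1 : ℝ) = 0 by norm_num] at b3
        exact b3.add hε hδ (s3.mul S.sw.dt) srest (hrest ε δ hε hδ i m hw)
    · refine ⟨c + 1, Dt (BB q w r c) * Dt^[n+1] w
          + (Dt f - LL w r * (BB q w r c * Dt^[n+1] w + f)), (sB.dt.mul su).add srest, ?_, ?_⟩
      · intro x hx y hy
        rw [hg x hx y hy]
        simp only [Pi.add_apply, Pi.mul_apply, Pi.sub_apply, BB, LL]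
        ring
      · intro ε δ hε hδ i m hw
        have b1 := ((S.cl_B hε hδ (n := i+1) c (hw.mono (by omega) le_rfl)).dt hε hδ sB).mul hε hδ
          sB.dt su (S.cl_u hε hδ (n+1) (n := i) (hw.mono (by omega) le_rfl))
        rw [show (-1 + 1 : ℝ) = 0 by norm_num] at b1
        exact b1.add hε hδ (sB.dt.mul su) srest (hrest ε δ hε hδ i m hw)

end Setup
end

noncomputable section

lemma second_deriv_le {f f' : ℝ → ℝ} {f'' c e x : ℝ} (hx : x ∈ Ioo c e)
    (hmax : ∀ y ∈ Ioo c e, f y ≤ f x)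
    (h1 : ∀ y ∈ Ioo c e, HasDerivAt f (f' y) y) (h2 : HasDerivAt f' f'' x) : f'' ≤ 0 := by
  by_contra h
  push Not at h
  have hn : Ioo c e ∈ nhds x := Ioo_mem_nhds hx.1 hx.2
  have hlm : IsLocalMax f x := by
    filter_upwards [hn] with y hy using hmax y hy
  have e1 : deriv f =ᶠ[nhds x] f' := by
    filter_upwards [hn] with y hy using (h1 y hy).deriv
  have e2 : deriv (deriv f) x = f'' := by rw [e1.deriv_eq, h2.deriv]
  have hmin : IsLocalMin f x := isLocalMin_of_deriv_deriv_pos (by rw [e2]; exact h)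
    hlm.deriv_eq_zero (h1 x hx).continuousAt
  have hc : f =ᶠ[nhds x] fun _ => f x := by
    filter_upwards [hlm, hmin] with y hy hy' using le_antisymm hy hy'
  have : deriv (deriv f) x = 0 := by
    have h3 : deriv f =ᶠ[nhds x] deriv (fun _ => f x) := hc.deriv
    rw [h3.deriv_eq]; simp
  linarith

lemma first_deriv_ge {f : ℝ → ℝ} {f' t0 t : ℝ} (ht : t0 < t)
    (hmax : ∀ s ∈ Ioc t0 t, f s ≤ f t) (h : HasDerivAt f f' t) : 0 ≤ f' := by
  have h2 := (hasDerivAt_iff_tendsto_slope_left_right.1 h).1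
  refine ge_of_tendsto h2 ?_
  filter_upwards [Ioo_mem_nhdsLT ht] with s hs
  rw [slope_def_field]
  exact div_nonneg_of_nonpos (by linarith [hmax s ⟨hs.1, hs.2.le⟩]) (by linarith [hs.2])

lemma max_principle {t0 T c e : ℝ} (F Ft Fy Fyy : ℝ → ℝ → ℝ)
    (hcont : ContinuousOn (fun z : ℝ × ℝ => F z.1 z.2) (Icc t0 T ×ˢ Icc c e))
    (h1 : ∀ t ∈ Ioc t0 T, ∀ y ∈ Ioo c e, HasDerivAt (fun s => F s y) (Ft t y) t)
    (h2 : ∀ t ∈ Ioc t0 T, ∀ y ∈ Ioo c e, HasDerivAt (F t) (Fy t y) y)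
    (h3 : ∀ t ∈ Ioc t0 T, ∀ y ∈ Ioo c e, HasDerivAt (Fy t) (Fyy t y) y)
    (b0 : ∀ y ∈ Icc c e, F t0 y ≤ 0) (bc : ∀ t ∈ Icc t0 T, F t c ≤ 0)
    (be : ∀ t ∈ Icc t0 T, F t e ≤ 0)
    (hin : ∀ t ∈ Ioc t0 T, ∀ y ∈ Ioo c e, 0 < F t y → 0 ≤ Ft t y → Fyy t y ≤ 0 → False) :
    ∀ t ∈ Icc t0 T, ∀ y ∈ Icc c e, F t y ≤ 0 := by
  intro t ht y hy
  obtain ⟨⟨t1, y1⟩, hz, hmax⟩ := (isCompact_Icc.prod isCompact_Icc).exists_isMaxOn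
    ⟨(t, y), ht, hy⟩ hcont
  have hmax' : ∀ s ∈ Icc t0 T, ∀ z ∈ Icc c e, F s z ≤ F t1 y1 := fun s hs z hz =>
    hmax (show (s, z) ∈ Icc t0 T ×ˢ Icc c e from ⟨hs, hz⟩)
  have ht1 : t1 ∈ Icc t0 T := hz.1
  have hy1 : y1 ∈ Icc c e := hz.2
  refine (hmax' t ht y hy).trans ?_
  by_contra hpos
  push Not at hpos
  have i1 : t0 < t1 := lt_of_le_of_ne ht1.1 (by rintro rfl; linarith [b0 y1 hy1])
  have i2 : c < y1 := lt_of_le_of_ne hy1.1 (by rintro rfl; linarith [bc t1 ht1])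
  have i3 : y1 < e := lt_of_le_of_ne hy1.2 (by rintro rfl; linarith [be t1 ht1])
  have m1 : t1 ∈ Ioc t0 T := ⟨i1, ht1.2⟩
  have m2 : y1 ∈ Ioo c e := ⟨i2, i3⟩
  refine hin t1 m1 y1 m2 hpos ?_ ?_
  · exact first_deriv_ge i1 (fun s hs => hmax' s ⟨hs.1.le, hs.2.trans ht1.2⟩ y1 hy1) (h1 t1 m1 y1 m2)
  · exact second_deriv_le m2 (fun z hz => hmax' t1 ht1 z ⟨hz.1.le, hz.2.le⟩)
      (fun z hz => h2 t1 m1 z hz) (h3 t1 m1 y1 m2)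

lemma barrier {t0 T δ K N A : ℝ} (Z Zt Zy Zyy a B : ℝ → ℝ → ℝ) (φ φ' φ'' ω : ℝ → ℝ)
    (hK : 0 ≤ K) (hN : 0 ≤ N) (hNA : N < A)
    (hcont : ContinuousOn (fun z : ℝ × ℝ => Z z.1 z.2) (Icc t0 T ×ˢ Ioc 0 δ))
    (h1 : ∀ t ∈ Ioc t0 T, ∀ y ∈ Ioo 0 δ, HasDerivAt (fun s => Z s y) (Zt t y) t)
    (h2 : ∀ t ∈ Ioc t0 T, ∀ y ∈ Ioo 0 δ, HasDerivAt (Z t) (Zy t y) y)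
    (h3 : ∀ t ∈ Ioc t0 T, ∀ y ∈ Ioo 0 δ, HasDerivAt (Zy t) (Zyy t y) y)
    (p0 : ContinuousOn φ (Ioc 0 δ)) (p1 : ∀ y ∈ Ioo 0 δ, HasDerivAt φ (φ' y) y)
    (p2 : ∀ y ∈ Ioo 0 δ, HasDerivAt φ' (φ'' y) y) (p3 : ∀ y ∈ Ioc 0 δ, 0 ≤ φ y)
    (ha : ∀ t ∈ Ioc t0 T, ∀ y ∈ Ioo 0 δ, 0 ≤ a t y)
    (hω : ∀ y ∈ Ioo 0 δ, 0 < ω y)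
    (haφ : ∀ t ∈ Ioc t0 T, ∀ y ∈ Ioo 0 δ, a t y * φ'' y ≤ -ω y)
    (hB : ∀ t ∈ Ioc t0 T, ∀ y ∈ Ioo 0 δ, B t y ≤ K)
    (heq : ∀ t ∈ Ioc t0 T, ∀ y ∈ Ioo 0 δ,
      Zt t y - a t y * Zyy t y ≤ B t y * Z t y + N * ω y)
    (b0 : ∀ y ∈ Ioc 0 δ, Z t0 y ≤ 0) (b1 : ∀ t ∈ Icc t0 T, Z t δ ≤ A * φ δ)
    (b2 : ∀ ν > 0, ∃ κ > 0, ∀ t ∈ Icc t0 T, ∀ y ∈ Ioc 0 δ, y < κ → Z t y ≤ ν) :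
    ∀ t ∈ Icc t0 T, ∀ y ∈ Ioc 0 δ, Z t y ≤ A * Real.exp (K * (t - t0)) * φ y := by
  intro t ht y hy
  have hA : 0 < A := by linarith
  have δ0 : 0 < δ := hy.1.trans_le hy.2
  have key : ∀ ν > 0, Real.exp (-K * (t - t0)) * Z t y - A * φ y - ν ≤ 0 := by
    intro ν hν
    obtain ⟨κ, hκ, hb⟩ := b2 ν hν
    obtain ⟨c, hc0, hc1⟩ := exists_between (show 0 < min κ y from lt_min hκ hy.1)
    have hcκ := hc1.trans_le (min_le_left _ _)
    have hcy := hc1.trans_le (min_le_right _ _)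
    have sub1 : ∀ z ∈ Icc c δ, z ∈ Ioc 0 δ := fun z hz => ⟨hc0.trans_le hz.1, hz.2⟩
    have sub2 : ∀ z ∈ Ioo c δ, z ∈ Ioo 0 δ := fun z hz => ⟨hc0.trans hz.1, hz.2⟩
    have exple : ∀ s ∈ Icc t0 T, Real.exp (-K * (s - t0)) ≤ 1 := fun s hs =>
      Real.exp_le_one_iff.2 (by nlinarith [hs.1])
    have small : ∀ s ∈ Icc t0 T, ∀ b : ℝ, 0 ≤ b → ∀ z : ℝ, z ≤ b → Real.exp (-K * (s - t0)) * z ≤ b := by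
      intro s hs b hb z hz
      have e0 := Real.exp_pos (-K * (s - t0))
      have e1 := exple s hs
      calc _ ≤ Real.exp (-K * (s - t0)) * b := by gcongr
        _ ≤ 1 * b := by gcongr
        _ = b := one_mul b
    refine max_principle (t0 := t0) (T := T) (c := c) (e := δ)
      (fun t y => Real.exp (-K * (t - t0)) * Z t y - A * φ y - ν)
      (fun t y => Real.exp (-K * (t - t0)) * (Zt t y - K * Z t y))
      (fun t y => Real.exp (-K * (t - t0)) * Zy t y - A * φ' y)
      (fun t y => Real.exp (-K * (t - t0)) * Zyy t y - A * φ'' y) ?_ ?_ ?_ ?_ ?_ ?_ ?_ ?_ t ht y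
      ⟨hcy.le, hy.2⟩
    · refine ContinuousOn.sub (ContinuousOn.sub (ContinuousOn.mul ?_ ?_) ?_) continuousOn_const
      · fun_prop
      · exact hcont.mono (prod_mono le_rfl sub1)
      · refine continuousOn_const.mul (p0.comp continuousOn_snd fun z hz => sub1 _ hz.2)
    · intro s hs z hz
      have d1 : HasDerivAt (fun s => Real.exp (-K * (s - t0))) (Real.exp (-K * (s - t0)) * (-K)) s := by
        have := (((hasDerivAt_id s).sub_const t0).const_mul (-K)).exp
        simpa using this
      have := ((d1.mul (h1 s hs z (sub2 z hz))).sub_const (A * φ z)).sub_const ν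
      exact this.congr_deriv (by ring)
    · intro s hs z hz
      exact (((h2 s hs z (sub2 z hz)).const_mul _).sub ((p1 z (sub2 z hz)).const_mul A)).sub_const ν
    · intro s hs z hz
      exact (((h3 s hs z (sub2 z hz)).const_mul _).sub ((p2 z (sub2 z hz)).const_mul A))
    · intro z hz
      have := b0 z (sub1 z hz)
      have := p3 z (sub1 z hz)
      simp; nlinarith
    · intro s hs
      have hcm := sub1 c ⟨le_rfl, hcy.le.trans hy.2⟩
      have h5 := small s hs ν hν.le _ (hb s hs c hcm hcκ)
      have := p3 c hcm
      have := mul_nonneg hA.le this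
      show _ - _ - _ ≤ _
      linarith
    · intro s hs
      have hcm := p3 δ ⟨δ0, le_rfl⟩
      have h5 := small s hs _ (mul_nonneg hA.le hcm) _ (b1 s hs)
      show _ - _ - _ ≤ _
      linarith
    · intro s hs z hz hF hFt hFyy
      have z' := sub2 z hz
      have e0 := Real.exp_pos (-K * (s - t0))
      have e1 := exple s ⟨hs.1.le, hs.2⟩
      set E := Real.exp (-K * (s - t0))
      have hφ := p3 z ⟨z'.1, z'.2.le⟩
      have hZ : 0 < Z s z := by
        have : 0 < E * Z s z := by nlinarith
        exact (pos_iff_pos_of_mul_pos this).1 e0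
      have i1 := heq s hs z z'
      have i2 := hB s hs z z'
      have i3 := haφ s hs z z'
      have i4 := hω z z'
      have i5 := ha s hs z z'
      have j1 : 0 ≤ E * (Zt s z - K * Z s z) - a s z * (E * Zyy s z - A * φ'' z) := by
        have := mul_nonneg i5 (neg_nonneg.2 hFyy)
        linarith
      have j2 : E * (Zt s z - K * Z s z) - a s z * (E * Zyy s z - A * φ'' z)
          = E * ((Zt s z - a s z * Zyy s z) - K * Z s z) + A * (a s z * φ'' z) := by ring
      have j3 : (Zt s z - a s z * Zyy s z) - K * Z s z ≤ N * ω z := by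
        have := mul_le_mul_of_nonneg_right i2 hZ.le
        linarith
      have j4 : E * ((Zt s z - a s z * Zyy s z) - K * Z s z) ≤ N * ω z := by
        have hNω : 0 ≤ N * ω z := by positivity
        calc _ ≤ E * (N * ω z) := by gcongr
          _ ≤ 1 * (N * ω z) := by gcongr
          _ = _ := one_mul _
      have j5 := mul_le_mul_of_nonneg_left i3 hA.le
      have j6 := mul_lt_mul_of_pos_right hNA i4
      rw [j2] at j1
      linarith
  have h0 : Real.exp (-K * (t - t0)) * Z t y - A * φ y ≤ 0 := by
    refine le_of_forall_pos_le_add fun ν hν => ?_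
    linarith [key ν hν]
  have e : Real.exp (K * (t - t0)) * Real.exp (-K * (t - t0)) = 1 := by
    rw [← Real.exp_add]; simp
  have e0 := Real.exp_pos (K * (t - t0))
  calc Z t y = Real.exp (K * (t - t0)) * (Real.exp (-K * (t - t0)) * Z t y) := by
        rw [← mul_assoc, e, one_mul]
    _ ≤ Real.exp (K * (t - t0)) * (A * φ y) := mul_le_mul_of_nonneg_left (by linarith) e0.le
    _ = _ := by ring

lemma bern1 {K η ζ ζ1 ζ2 a v vy vG j : ℝ} (hK : 1 ≤ K) (hj : 1 ≤ j) (η0 : 0 ≤ η) (ηK : η ≤ K)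
    (ζ0 : 0 ≤ ζ) (ζ1' : ζ ≤ 1) (hz1 : ζ1 ^ 2 ≤ 16 * j ^ 4) (hz2 : ζ2 = -8 * j ^ 4) (a0 : 0 ≤ a)
    (aj : a * j ^ 4 ≤ K * j ^ 3) (hG : vG ≤ K * (v ^ 2 + 1)) :
    2 * η * ζ ^ 4 * v ^ 2 + 2 * η ^ 2 * ζ ^ 4 * vG
      - a * (η ^ 2 * (12 * ζ ^ 2 * ζ1 ^ 2 * v ^ 2 + 4 * ζ ^ 3 * ζ2 * v ^ 2 + 16 * ζ ^ 3 * ζ1 * v * vy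
        + 2 * ζ ^ 4 * vy ^ 2))
      ≤ (2 + 354 * K ^ 2) * (η * ζ ^ 2 * v ^ 2 * j ^ 3) + 2 * K ^ 3 := by
  have z2 : ζ ^ 2 ≤ 1 := pow_le_one₀ ζ0 ζ1'
  have z4 : ζ ^ 4 ≤ 1 := pow_le_one₀ ζ0 ζ1'
  have z3 : ζ ^ 3 ≤ ζ ^ 2 := pow_le_pow_of_le_one ζ0 ζ1' (by norm_num)
  have z42 : ζ ^ 4 ≤ ζ ^ 2 := pow_le_pow_of_le_one ζ0 ζ1' (by norm_num)
  have j3 : 1 ≤ j ^ 3 := one_le_pow₀ hj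
  have K0 : 0 ≤ K := by linarith
  have P : 0 ≤ η * ζ ^ 2 * v ^ 2 := by positivity
  have P2 : η * ζ ^ 2 * v ^ 2 ≤ η * ζ ^ 2 * v ^ 2 * j ^ 3 := le_mul_of_one_le_right P j3
  have a1 : 2 * η * ζ ^ 4 * v ^ 2 ≤ 2 * (η * ζ ^ 2 * v ^ 2 * j ^ 3) := by
    have : η * ζ ^ 4 * v ^ 2 ≤ η * ζ ^ 2 * v ^ 2 := by gcongr
    linarith
  have a2 : 2 * η ^ 2 * ζ ^ 4 * vG ≤ 2 * K ^ 2 * (η * ζ ^ 2 * v ^ 2 * j ^ 3) + 2 * K ^ 3 := by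
    have e1 : η ^ 2 * ζ ^ 4 * v ^ 2 ≤ K * (η * ζ ^ 2 * v ^ 2) := by
      calc η ^ 2 * ζ ^ 4 * v ^ 2 = η * (η * ζ ^ 4 * v ^ 2) := by ring
        _ ≤ K * (η * ζ ^ 2 * v ^ 2) := by gcongr
    have e2 : η ^ 2 * ζ ^ 4 ≤ K ^ 2 * 1 := by gcongr
    calc 2 * η ^ 2 * ζ ^ 4 * vG ≤ 2 * η ^ 2 * ζ ^ 4 * (K * (v ^ 2 + 1)) := by gcongr
      _ = 2 * K * (η ^ 2 * ζ ^ 4 * v ^ 2) + 2 * K * (η ^ 2 * ζ ^ 4) := by ring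
      _ ≤ 2 * K * (K * (η * ζ ^ 2 * v ^ 2 * j ^ 3)) + 2 * K * (K ^ 2 * 1) := by
        have e3 := e1.trans (mul_le_mul_of_nonneg_left P2 K0)
        exact add_le_add (mul_le_mul_of_nonneg_left e3 (by positivity))
          (mul_le_mul_of_nonneg_left e2 (by positivity))
      _ = _ := by ring
  have a3 : - a * (η ^ 2 * (12 * ζ ^ 2 * ζ1 ^ 2 * v ^ 2 + 4 * ζ ^ 3 * ζ2 * v ^ 2 + 16 * ζ ^ 3 * ζ1 * v * vy
        + 2 * ζ ^ 4 * vy ^ 2)) ≤ 352 * K ^ 2 * (η * ζ ^ 2 * v ^ 2 * j ^ 3) := by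
    have e1 : -(12 * ζ ^ 2 * ζ1 ^ 2 * v ^ 2 + 4 * ζ ^ 3 * ζ2 * v ^ 2 + 16 * ζ ^ 3 * ζ1 * v * vy
        + 2 * ζ ^ 4 * vy ^ 2) ≤ 352 * j ^ 4 * ζ ^ 2 * v ^ 2 := by
      have s1 : 0 ≤ 2 * (ζ ^ 2 * vy + 4 * ζ * ζ1 * v) ^ 2 := by positivity
      have s2 : ζ ^ 2 * v ^ 2 * ζ1 ^ 2 ≤ ζ ^ 2 * v ^ 2 * (16 * j ^ 4) := by gcongr
      have s3 : ζ ^ 3 * (v ^ 2 * j ^ 4) ≤ ζ ^ 2 * (v ^ 2 * j ^ 4) := by gcongr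
      rw [hz2]
      nlinarith
    calc _ = a * η ^ 2 * -(12 * ζ ^ 2 * ζ1 ^ 2 * v ^ 2 + 4 * ζ ^ 3 * ζ2 * v ^ 2 + 16 * ζ ^ 3 * ζ1 * v * vy
        + 2 * ζ ^ 4 * vy ^ 2) := by ring
      _ ≤ a * η ^ 2 * (352 * j ^ 4 * ζ ^ 2 * v ^ 2) := by gcongr
      _ = 352 * (a * j ^ 4) * η * (η * ζ ^ 2 * v ^ 2) := by ring
      _ ≤ 352 * (K * j ^ 3) * K * (η * ζ ^ 2 * v ^ 2) := by gcongr
      _ = _ := by ring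
  linarith

lemma bern2 {K η ζ ζ1 ζ2 a ay uy uyy v g gy j : ℝ} (hK : 1 ≤ K) (hj : 1 ≤ j) (η0 : 0 ≤ η) (ηK : η ≤ K)
    (ζ0 : 0 ≤ ζ) (ζ1' : ζ ≤ 1) (hz1 : ζ1 ^ 2 ≤ 16 * j ^ 4) (hz2 : ζ2 = -8 * j ^ 4) (a0 : 0 < a)
    (aj : a * j ≤ K) (aj' : 1 ≤ K * (a * j)) (hay : |ay| ≤ K * j) (hv : v = a * uyy + g) (hg : |g| ≤ K)
    (hgy : |gy| ≤ K * (|uy| + 1) * j ^ 2) :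
    ζ ^ 2 * uy ^ 2 + 2 * η * ζ ^ 2 * uy * (ay * uyy + gy)
      - a * (η * (2 * ζ1 ^ 2 * uy ^ 2 + 2 * ζ * ζ2 * uy ^ 2 + 8 * ζ * ζ1 * uy * uyy + 2 * ζ ^ 2 * uyy ^ 2))
      ≤ -(η * ζ ^ 2 * v ^ 2 * j) / (2 * K) + (1 + 2 * K ^ 4 + 531 * K ^ 2) * (uy ^ 2 * j ^ 3)
        + (K ^ 2 + K ^ 4) * j ^ 2 := by
  have z2 : ζ ^ 2 ≤ 1 := pow_le_one₀ ζ0 ζ1'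
  have j3 : 1 ≤ j ^ 3 := one_le_pow₀ hj
  have j0 : 0 < j := by linarith
  have j23 : j ^ 2 ≤ j ^ 3 := pow_le_pow_right₀ hj (by norm_num)
  have j12 : j ≤ j ^ 2 := by nlinarith
  have K0 : 0 < K := by linarith
  have aj4 : a * j ^ 4 ≤ K * j ^ 3 := by
    calc a * j ^ 4 = (a * j) * j ^ 3 := by ring
      _ ≤ _ := by gcongr
  have c1 : ζ ^ 2 * uy ^ 2 ≤ uy ^ 2 * j ^ 3 := by
    calc ζ ^ 2 * uy ^ 2 ≤ 1 * uy ^ 2 := by gcongr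
      _ = uy ^ 2 * 1 := by ring
      _ ≤ _ := by gcongr
  -- ay term
  have c2 : 2 * η * ζ ^ 2 * uy * (ay * uyy) ≤ 1/2 * (a * η * ζ ^ 2 * uyy ^ 2) + 2 * K ^ 4 * (uy ^ 2 * j ^ 3) := by
    have e1 : 2 * uy * (ay * uyy) ≤ 1/2 * a * uyy ^ 2 + 2 * K ^ 3 * (uy ^ 2 * j ^ 3) := by
      have hay2 : ay ^ 2 ≤ (K * j) ^ 2 := by rw [← sq_abs]; gcongr
      have e3 : ay ^ 2 / a ≤ K ^ 3 * j ^ 3 := by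
        rw [div_le_iff₀ a0]
        calc ay ^ 2 ≤ (K * j) ^ 2 * 1 := by linarith
          _ ≤ (K * j) ^ 2 * (K * (a * j)) := by gcongr
          _ = _ := by ring
      have e4 : 2 * uy * (ay * uyy) ≤ 1/2 * a * uyy ^ 2 + 2 * uy ^ 2 * (ay ^ 2 / a) := by
        have : 0 ≤ (a * uyy - 2 * uy * ay) ^ 2 / (2 * a) := by positivity
        have e5 : (a * uyy - 2 * uy * ay) ^ 2 / (2 * a) =
          1/2 * a * uyy ^ 2 + 2 * uy ^ 2 * (ay ^ 2 / a) - 2 * uy * (ay * uyy) := by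
          field_simp; ring
        linarith
      have e6 : uy ^ 2 * (ay ^ 2 / a) ≤ uy ^ 2 * (K ^ 3 * j ^ 3) := by gcongr
      linarith
    have e7 : η * ζ ^ 2 ≤ K := by
      calc η * ζ ^ 2 ≤ K * 1 := by gcongr
        _ = K := mul_one K
    calc _ = η * ζ ^ 2 * (2 * uy * (ay * uyy)) := by ring
      _ ≤ η * ζ ^ 2 * (1/2 * a * uyy ^ 2 + 2 * K ^ 3 * (uy ^ 2 * j ^ 3)) := by gcongr
      _ = 1/2 * (a * η * ζ ^ 2 * uyy ^ 2) + (η * ζ ^ 2) * (2 * K ^ 3 * (uy ^ 2 * j ^ 3)) := by ring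
      _ ≤ 1/2 * (a * η * ζ ^ 2 * uyy ^ 2) + K * (2 * K ^ 3 * (uy ^ 2 * j ^ 3)) := by gcongr
      _ = _ := by ring
  have c3 : 2 * η * ζ ^ 2 * uy * gy ≤ 3 * K ^ 2 * (uy ^ 2 * j ^ 3) + K ^ 2 * j ^ 2 := by
    have e1 : 2 * uy * gy ≤ K * (3 * uy ^ 2 + 1) * j ^ 2 := by
      calc 2 * uy * gy ≤ |2 * uy * gy| := le_abs_self _
        _ = 2 * |uy| * |gy| := by rw [abs_mul, abs_mul]; simp
        _ ≤ 2 * |uy| * (K * (|uy| + 1) * j ^ 2) := by gcongr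
        _ = K * (2 * |uy| ^ 2 + 2 * |uy|) * j ^ 2 := by ring
        _ ≤ K * (3 * |uy| ^ 2 + 1) * j ^ 2 := by
          have h : 2*|uy|^2+2*|uy| ≤ 3*|uy|^2+1 := by nlinarith [sq_nonneg (|uy| - 1)]
          exact mul_le_mul_of_nonneg_right (mul_le_mul_of_nonneg_left h K0.le) (by positivity)
        _ = _ := by rw [sq_abs]
    have e7 : η * ζ ^ 2 ≤ K := by
      calc η * ζ ^ 2 ≤ K * 1 := by gcongr
        _ = K := mul_one K
    calc _ = η * ζ ^ 2 * (2 * uy * gy) := by ring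
      _ ≤ η * ζ ^ 2 * (K * (3 * uy ^ 2 + 1) * j ^ 2) := by gcongr
      _ ≤ K * (K * (3 * uy ^ 2 + 1) * j ^ 2) := by gcongr
      _ = 3 * K ^ 2 * (uy ^ 2 * j ^ 2) + K ^ 2 * j ^ 2 := by ring
      _ ≤ _ := by gcongr
  have c4 : - (a * (η * (2 * ζ1 ^ 2 * uy ^ 2 + 2 * ζ * ζ2 * uy ^ 2 + 8 * ζ * ζ1 * uy * uyy)))
      ≤ 1/2 * (a * η * ζ ^ 2 * uyy ^ 2) + 528 * K ^ 2 * (uy ^ 2 * j ^ 3) := by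
    have e1 : -(2 * ζ1 ^ 2 * uy ^ 2 + 2 * ζ * ζ2 * uy ^ 2 + 8 * ζ * ζ1 * uy * uyy)
        ≤ 1/2 * (ζ ^ 2 * uyy ^ 2) + 528 * (j ^ 4 * uy ^ 2) := by
      have s1 : 0 ≤ 1/2 * (ζ * uyy + 8 * ζ1 * uy) ^ 2 := by positivity
      have s2 : uy ^ 2 * ζ1 ^ 2 ≤ uy ^ 2 * (16 * j ^ 4) := by gcongr
      have s3 : ζ * (uy ^ 2 * j ^ 4) ≤ 1 * (uy ^ 2 * j ^ 4) := by gcongr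
      have s4 : 0 ≤ ζ1 ^ 2 * uy ^ 2 := by positivity
      rw [hz2]
      nlinarith
    calc _ = a * η * -(2 * ζ1 ^ 2 * uy ^ 2 + 2 * ζ * ζ2 * uy ^ 2 + 8 * ζ * ζ1 * uy * uyy) := by ring
      _ ≤ a * η * (1/2 * (ζ ^ 2 * uyy ^ 2) + 528 * (j ^ 4 * uy ^ 2)) := by gcongr
      _ = 1/2 * (a * η * ζ ^ 2 * uyy ^ 2) + 528 * (a * j ^ 4) * η * uy ^ 2 := by ring
      _ ≤ 1/2 * (a * η * ζ ^ 2 * uyy ^ 2) + 528 * (K * j ^ 3) * K * uy ^ 2 := by gcongr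
      _ = _ := by ring
  have c5 : - (a * η * ζ ^ 2 * uyy ^ 2) ≤ -(η * ζ ^ 2 * v ^ 2 * j) / (2 * K) + K ^ 4 * j ^ 2 := by
    have g2 : g ^ 2 ≤ K ^ 2 := by rw [← sq_abs]; gcongr
    have e1 : v ^ 2 * j / (2 * K) - K ^ 3 * j ≤ a * uyy ^ 2 := by
      have e2 : a * uyy ^ 2 = (v - g) ^ 2 / a := by rw [hv]; field_simp; ring
      have e3 : v ^ 2 / 2 - K ^ 2 ≤ (v - g) ^ 2 := by nlinarith [sq_nonneg (v - 2 * g)]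
      have e4 : 1 / a ≤ K * j := by rw [div_le_iff₀ a0]; linarith
      have e5 : j / K ≤ 1 / a := by rw [div_le_div_iff₀ K0 a0]; linarith
      have e6 : 0 ≤ 1 / a := by positivity
      rw [e2]
      calc v ^ 2 * j / (2 * K) - K ^ 3 * j = v ^ 2 / 2 * (j / K) - K ^ 2 * (K * j) := by
            field_simp
        _ ≤ v ^ 2 / 2 * (1 / a) - K ^ 2 * (1 / a) := by gcongr
        _ = (v ^ 2 / 2 - K ^ 2) * (1 / a) := by ring
        _ ≤ (v - g) ^ 2 * (1 / a) := by gcongr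
        _ = _ := by ring
    have e7 : η * ζ ^ 2 ≤ K := by
      calc η * ζ ^ 2 ≤ K * 1 := by gcongr
        _ = K := mul_one K
    calc _ = - (η * ζ ^ 2 * (a * uyy ^ 2)) := by ring
      _ ≤ - (η * ζ ^ 2 * (v ^ 2 * j / (2 * K) - K ^ 3 * j)) := by gcongr
      _ = -(η * ζ ^ 2 * v ^ 2 * j) / (2 * K) + η * ζ ^ 2 * (K ^ 3 * j) := by ring
      _ ≤ -(η * ζ ^ 2 * v ^ 2 * j) / (2 * K) + K * (K ^ 3 * j ^ 2) := by gcongr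
      _ = _ := by ring
  linarith

end

noncomputable section

lemma bern_main {K t0 T s j : ℝ} (u uy uyy uyyy v vy vyy vt a ay g gy G : ℝ → ℝ → ℝ)
    (hK : 1 ≤ K) (hj : 1 ≤ j) (hjs : j ^ 2 * s = 1) (hT : T - t0 ≤ K)
    (cu : ContinuousOn (fun z : ℝ × ℝ => u z.1 z.2) (Icc t0 T ×ˢ Icc (s/2) (3*s/2)))
    (cuy : ContinuousOn (fun z : ℝ × ℝ => uy z.1 z.2) (Icc t0 T ×ˢ Icc (s/2) (3*s/2)))
    (cv : ContinuousOn (fun z : ℝ × ℝ => v z.1 z.2) (Icc t0 T ×ˢ Icc (s/2) (3*s/2)))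
    (hut : ∀ t ∈ Ioc t0 T, ∀ y ∈ Ioo (s/2) (3*s/2), HasDerivAt (fun x => u x y) (v t y) t)
    (huyt : ∀ t ∈ Ioc t0 T, ∀ y ∈ Ioo (s/2) (3*s/2), HasDerivAt (fun x => uy x y) (vy t y) t)
    (hvt : ∀ t ∈ Ioc t0 T, ∀ y ∈ Ioo (s/2) (3*s/2), HasDerivAt (fun x => v x y) (vt t y) t)
    (huy : ∀ t ∈ Ioc t0 T, ∀ y ∈ Ioo (s/2) (3*s/2), HasDerivAt (u t) (uy t y) y)
    (huyy : ∀ t ∈ Ioc t0 T, ∀ y ∈ Ioo (s/2) (3*s/2), HasDerivAt (uy t) (uyy t y) y)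
    (huyyy : ∀ t ∈ Ioc t0 T, ∀ y ∈ Ioo (s/2) (3*s/2), HasDerivAt (uyy t) (uyyy t y) y)
    (hvy : ∀ t ∈ Ioc t0 T, ∀ y ∈ Ioo (s/2) (3*s/2), HasDerivAt (v t) (vy t y) y)
    (hvyy : ∀ t ∈ Ioc t0 T, ∀ y ∈ Ioo (s/2) (3*s/2), HasDerivAt (vy t) (vyy t y) y)
    (e1 : ∀ t ∈ Ioc t0 T, ∀ y ∈ Ioo (s/2) (3*s/2), v t y = a t y * uyy t y + g t y)
    (e2 : ∀ t ∈ Ioc t0 T, ∀ y ∈ Ioo (s/2) (3*s/2),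
      vy t y = a t y * uyyy t y + ay t y * uyy t y + gy t y)
    (e3 : ∀ t ∈ Ioc t0 T, ∀ y ∈ Ioo (s/2) (3*s/2), vt t y = a t y * vyy t y + G t y)
    (ba0 : ∀ t ∈ Ioc t0 T, ∀ y ∈ Ioo (s/2) (3*s/2), 0 < a t y)
    (ba1 : ∀ t ∈ Ioc t0 T, ∀ y ∈ Ioo (s/2) (3*s/2), a t y * j ≤ K)
    (ba2 : ∀ t ∈ Ioc t0 T, ∀ y ∈ Ioo (s/2) (3*s/2), 1 ≤ K * (a t y * j))
    (bay : ∀ t ∈ Ioc t0 T, ∀ y ∈ Ioo (s/2) (3*s/2), |ay t y| ≤ K * j)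
    (bg : ∀ t ∈ Ioc t0 T, ∀ y ∈ Ioo (s/2) (3*s/2), |g t y| ≤ K)
    (bgy : ∀ t ∈ Ioc t0 T, ∀ y ∈ Ioo (s/2) (3*s/2), |gy t y| ≤ K * (|uy t y| + 1) * j ^ 2)
    (bG : ∀ t ∈ Ioc t0 T, ∀ y ∈ Ioo (s/2) (3*s/2), v t y * G t y ≤ K * (v t y ^ 2 + 1))
    (bu : ∀ t ∈ Icc t0 T, ∀ y ∈ Icc (s/2) (3*s/2), |u t y| ≤ K * s) :
    ∃ D, D = (fun K : ℝ => (K * (2 + 354 * K ^ 2) * (1 + 2 * K ^ 4 + 531 * K ^ 2) * K) * K ^ 2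
        + (2 * K ^ 3 + 2 * K * (2 + 354 * K ^ 2) * (K ^ 2 + K ^ 4) +
          2 * (K * (2 + 354 * K ^ 2) * (1 + 2 * K ^ 4 + 531 * K ^ 2) * K) * K ^ 2 + 1) * K) K ∧
      ∀ t ∈ Icc t0 T, (t - t0) ^ 2 * v t s ^ 2 ≤ D * j ^ 4 := by
  refine ⟨_, rfl, ?_⟩
  intro t ht
  have K0 : 0 < K := by linarith
  have j0 : 0 < j := by linarith
  have s0 : 0 < s := by
    by_contra h
    have : j ^ 2 * s ≤ 0 := mul_nonpos_of_nonneg_of_nonpos (by positivity) (by linarith)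
    linarith
  obtain ⟨A, hA⟩ : ∃ A, A = 2 * K * (2 + 354 * K ^ 2) := ⟨_, rfl⟩
  obtain ⟨E, hE⟩ : ∃ E, E = K * (2 + 354 * K ^ 2) * (1 + 2 * K ^ 4 + 531 * K ^ 2) * K := ⟨_, rfl⟩
  obtain ⟨N, hN⟩ : ∃ N, N = 2 * K ^ 3 + A * (K ^ 2 + K ^ 4) + 2 * E * K ^ 2 + 1 := ⟨_, rfl⟩
  have A0 : 0 < A := by rw [hA]; positivity
  have E0 : 0 < E := by rw [hE]; positivity
  have N0 : 0 < N := by rw [hN]; positivity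
  have hu2 : ∀ t ∈ Icc t0 T, ∀ y ∈ Icc (s/2) (3*s/2), E * j ^ 6 * u t y ^ 2 ≤ E * K ^ 2 * j ^ 2 := by
    intro t ht y hy
    have h1 : u t y ^ 2 ≤ (K * s) ^ 2 := by rw [← sq_abs]; exact pow_le_pow_left₀ (abs_nonneg _) (bu t ht y hy) 2
    calc E * j ^ 6 * u t y ^ 2 ≤ E * j ^ 6 * (K * s) ^ 2 := by gcongr
      _ = E * K ^ 2 * j ^ 2 * (j ^ 2 * s) ^ 2 := by ring
      _ = _ := by rw [hjs]; ring
  let ζ : ℝ → ℝ := fun y => 1 - 4 * j ^ 4 * (y - s) ^ 2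
  have hζ : ∀ y, ζ y = 1 - 4 * j ^ 4 * (y - s) ^ 2 := fun y => rfl
  have dζ : ∀ y, HasDerivAt ζ (-8 * j ^ 4 * (y - s)) y := fun y => by
    have := ((((hasDerivAt_id y).sub_const s).pow 2).const_mul (4 * j ^ 4)).const_sub 1
    exact this.congr_deriv (by simp; ring)
  have dζ2 : ∀ y, HasDerivAt (fun y => -8 * j ^ 4 * (y - s)) (-8 * j ^ 4) y := fun y => by
    have := (((hasDerivAt_id y).sub_const s).const_mul (-8 * j ^ 4))
    exact this.congr_deriv (by simp)
  have main := max_principle (t0 := t0) (T := T) (c := s/2) (e := 3*s/2)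
    (fun t y => (t - t0) ^ 2 * ζ y ^ 4 * v t y ^ 2 + A * j ^ 2 * (t - t0) * ζ y ^ 2 * uy t y ^ 2
      + E * j ^ 6 * u t y ^ 2 - E * K ^ 2 * j ^ 2 - N * j ^ 4 * (t - t0))
    (fun t y => 2 * (t - t0) * ζ y ^ 4 * v t y ^ 2 + 2 * (t - t0) ^ 2 * ζ y ^ 4 * v t y * vt t y
      + A * j ^ 2 * (ζ y ^ 2 * uy t y ^ 2 + 2 * (t - t0) * ζ y ^ 2 * uy t y * vy t y)
      + 2 * E * j ^ 6 * u t y * v t y - N * j ^ 4)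
    (fun t y => (t - t0) ^ 2 * (4 * ζ y ^ 3 * (-8 * j ^ 4 * (y - s)) * v t y ^ 2
        + 2 * ζ y ^ 4 * v t y * vy t y)
      + A * j ^ 2 * (t - t0) * (2 * ζ y * (-8 * j ^ 4 * (y - s)) * uy t y ^ 2
        + 2 * ζ y ^ 2 * uy t y * uyy t y) + 2 * E * j ^ 6 * u t y * uy t y)
    (fun t y => (t - t0) ^ 2 * (12 * ζ y ^ 2 * (-8 * j ^ 4 * (y - s)) ^ 2 * v t y ^ 2
        + 4 * ζ y ^ 3 * (-8 * j ^ 4) * v t y ^ 2 + 16 * ζ y ^ 3 * (-8 * j ^ 4 * (y - s)) * v t y * vy t y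
        + 2 * ζ y ^ 4 * (vy t y ^ 2 + v t y * vyy t y))
      + A * j ^ 2 * (t - t0) * (2 * (-8 * j ^ 4 * (y - s)) ^ 2 * uy t y ^ 2
        + 2 * ζ y * (-8 * j ^ 4) * uy t y ^ 2 + 8 * ζ y * (-8 * j ^ 4 * (y - s)) * uy t y * uyy t y
        + 2 * ζ y ^ 2 * (uyy t y ^ 2 + uy t y * uyyy t y))
      + 2 * E * j ^ 6 * (uy t y ^ 2 + u t y * uyy t y)) ?_ ?_ ?_ ?_ ?_ ?_ ?_ ?_ t ht s
      ⟨by linarith, by linarith⟩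
  · have hz : ζ s = 1 := by rw [hζ]; ring
    simp only [hz] at main
    have h1 : 0 ≤ A * j ^ 2 * (t - t0) * 1 ^ 2 * uy t s ^ 2 := by
      have := sub_nonneg.2 ht.1
      positivity
    have h2 : 0 ≤ E * j ^ 6 * u t s ^ 2 := by positivity
    have h3 : N * j ^ 4 * (t - t0) ≤ N * j ^ 4 * K := by
      have : t - t0 ≤ K := by linarith [ht.2]
      gcongr
    have h4 : E * K ^ 2 * j ^ 2 ≤ E * K ^ 2 * j ^ 4 := by
      have := pow_le_pow_right₀ hj (show 2 ≤ 4 by norm_num)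
      gcongr
    have : (t - t0) ^ 2 * v t s ^ 2 ≤ (E * K ^ 2 + N * K) * j ^ 4 := by linarith
    rw [hN, hA, hE] at this
    exact this
  · have c1 : ContinuousOn (fun z : ℝ × ℝ => ζ z.2) (Icc t0 T ×ˢ Icc (s/2) (3*s/2)) := by
      simp only [hζ]; fun_prop
    have c2 : ContinuousOn (fun z : ℝ × ℝ => z.1 - t0) (Icc t0 T ×ˢ Icc (s/2) (3*s/2)) := by
      fun_prop
    have := (((((c2.pow 2).mul (c1.pow 4)).mul (cv.pow 2)).add
      ((((continuousOn_const (c := A * j ^ 2)).mul c2).mul (c1.pow 2)).mul (cuy.pow 2))).add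
      ((continuousOn_const (c := E * j ^ 6)).mul (cu.pow 2))).sub
      (continuousOn_const (c := E * K ^ 2 * j ^ 2))
    exact this.sub ((continuousOn_const (c := N * j ^ 4)).mul c2)
  · intro t ht y hy
    have dt : HasDerivAt (fun t => t - t0) 1 t := (hasDerivAt_id t).sub_const t0
    have := ((((((dt.pow 2).mul_const (ζ y ^ 4)).mul ((hvt t ht y hy).pow 2)).add
      ((((dt.const_mul (A * j ^ 2)).mul_const (ζ y ^ 2))).mul ((huyt t ht y hy).pow 2))).add
      (((hut t ht y hy).pow 2).const_mul (E * j ^ 6))).sub_const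
      (E * K ^ 2 * j ^ 2)).sub (dt.const_mul (N * j ^ 4))
    refine this.congr_deriv ?_
    simp
    ring
  · intro t ht y hy
    have := (((((((dζ y).pow 4).const_mul ((t-t0)^2)).mul ((hvy t ht y hy).pow 2)).add
      ((((dζ y).pow 2).const_mul (A * j ^ 2 * (t - t0))).mul ((huyy t ht y hy).pow 2))).add
      (((huy t ht y hy).pow 2).const_mul (E * j ^ 6))).sub_const
      (E * K ^ 2 * j ^ 2)).sub_const (N * j ^ 4 * (t - t0))
    refine this.congr_deriv ?_
    simp
    ring
  · intro t ht y hy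
    have := ((((((((dζ y).pow 3).const_mul 4).mul (dζ2 y)).mul ((hvy t ht y hy).pow 2)).add
        (((((dζ y).pow 4).const_mul 2).mul (hvy t ht y hy)).mul (hvyy t ht y hy))).const_mul ((t-t0)^2)).add
      ((((((dζ y).const_mul 2).mul (dζ2 y)).mul ((huyy t ht y hy).pow 2)).add
        (((((dζ y).pow 2).const_mul 2).mul (huyy t ht y hy)).mul (huyyy t ht y hy))).const_mul
          (A * j ^ 2 * (t - t0)))).add
      ((((huy t ht y hy).const_mul (2 * E * j ^ 6))).mul (huyy t ht y hy))
    refine this.congr_deriv ?_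
    simp
    ring
  · intro y hy
    by_cases h : t0 ≤ T
    · have := hu2 t0 ⟨le_rfl, h⟩ y hy
      simp
      linarith
    · exact absurd (ht.1.trans ht.2) h
  · intro t ht
    have := hu2 t ht (s/2) ⟨le_rfl, by linarith⟩
    have hz : ζ (s/2) = 0 := by
      rw [hζ, show 1 - 4 * j ^ 4 * (s/2 - s)^2 = 1 - (j^2*s)^2 by ring, hjs]; norm_num
    have h3 : 0 ≤ N * j ^ 4 * (t - t0) := by
      have := sub_nonneg.2 ht.1
      positivity
    simp [hz]
    linarith
  · intro t ht
    have := hu2 t ht (3*s/2) ⟨by linarith, le_rfl⟩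
    have hz : ζ (3*s/2) = 0 := by
      rw [hζ, show 1 - 4 * j ^ 4 * (3*s/2 - s)^2 = 1 - (j^2*s)^2 by ring, hjs]; norm_num
    have h3 : 0 ≤ N * j ^ 4 * (t - t0) := by
      have := sub_nonneg.2 ht.1
      positivity
    simp [hz]
    linarith
  · intro t ht y hy _ hFt hFyy
    have ys : (y - s) ^ 2 ≤ (s/2)^2 := by
      apply sq_le_sq'
      · linarith [hy.1]
      · linarith [hy.2]
    have js2 : j ^ 4 * s ^ 2 = 1 := by
      calc j ^ 4 * s ^ 2 = (j ^ 2 * s) ^ 2 := by ring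
        _ = 1 := by rw [hjs]; norm_num
    have jy : j ^ 4 * (y - s) ^ 2 ≤ 1/4 := by
      calc j ^ 4 * (y - s) ^ 2 ≤ j ^ 4 * (s/2)^2 := by gcongr
        _ = (j ^ 4 * s ^ 2)/4 := by ring
        _ = 1/4 := by rw [js2]
    have z0 : 0 ≤ ζ y := by rw [hζ]; linarith
    have z1 : ζ y ≤ 1 := by
      rw [hζ]
      have : 0 ≤ j ^ 4 * (y - s) ^ 2 := by positivity
      linarith
    have zz : (-8 * j ^ 4 * (y - s)) ^ 2 ≤ 16 * j ^ 4 := by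
      calc (-8 * j ^ 4 * (y - s)) ^ 2 = 64 * j ^ 4 * (j ^ 4 * (y - s) ^ 2) := by ring
        _ ≤ 64 * j ^ 4 * (1/4) := by gcongr
        _ = _ := by ring
    have η0 : 0 ≤ t - t0 := by linarith [ht.1]
    have ηK : t - t0 ≤ K := by linarith [ht.2]
    have a0 := ba0 t ht y hy
    have a1 := ba1 t ht y hy
    have a2 := ba2 t ht y hy
    have hg := bg t ht y hy
    have aj4 : a t y * j ^ 4 ≤ K * j ^ 3 := by
      calc a t y * j ^ 4 = (a t y * j) * j ^ 3 := by ring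
        _ ≤ _ := by gcongr
    have B1 := bern1 (vy := vy t y) hK hj η0 ηK z0 z1 zz rfl a0.le aj4 (bG t ht y hy)
    have B2 := bern2 hK hj η0 ηK z0 z1 zz rfl a0 a1 a2 (bay t ht y hy) (e1 t ht y hy) hg (bgy t ht y hy)
    have hu := bu t ⟨ht.1.le, ht.2⟩ y ⟨hy.1.le, hy.2.le⟩
    have B3 : 2 * E * j ^ 6 * (u t y * g t y - a t y * uy t y ^ 2) ≤
        2 * E * K ^ 2 * j ^ 4 - 2 * E / K * (uy t y ^ 2 * j ^ 5) := by
      have h1 : u t y * g t y ≤ K * s * K := by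
        calc u t y * g t y ≤ |u t y * g t y| := le_abs_self _
          _ = |u t y| * |g t y| := abs_mul _ _
          _ ≤ _ := by gcongr
      have h2 : 1 / K ≤ a t y * j := by rw [div_le_iff₀ K0]; linarith
      calc 2 * E * j ^ 6 * (u t y * g t y - a t y * uy t y ^ 2)
          = 2 * E * j ^ 6 * (u t y * g t y) - 2 * E * (uy t y ^ 2 * j ^ 5) * (a t y * j) := by ring
        _ ≤ 2 * E * j ^ 6 * (K * s * K) - 2 * E * (uy t y ^ 2 * j ^ 5) * (1 / K) := by gcongr
        _ = 2 * E * K ^ 2 * j ^ 4 * (j ^ 2 * s) - 2 * E / K * (uy t y ^ 2 * j ^ 5) := by ring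
        _ = _ := by rw [hjs]; ring
    have B2' := mul_le_mul_of_nonneg_left B2 (show 0 ≤ A * j ^ 2 by positivity)
    have x1 : A * j ^ 2 * (-((t - t0) * ζ y ^ 2 * v t y ^ 2 * j) / (2 * K)) =
        - ((2 + 354 * K ^ 2) * ((t - t0) * ζ y ^ 2 * v t y ^ 2 * j ^ 3)) := by
      rw [hA]; field_simp
    have x2 : 2 * E / K * (uy t y ^ 2 * j ^ 5) =
        A * j ^ 2 * ((1 + 2 * K ^ 4 + 531 * K ^ 2) * (uy t y ^ 2 * j ^ 3)) := by
      rw [hA, hE]; field_simp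
    have x3 : 2 * K ^ 3 ≤ 2 * K ^ 3 * j ^ 4 := le_mul_of_one_le_right (by positivity) (one_le_pow₀ hj)
    have x4 : N * j ^ 4 = 2 * K ^ 3 * j ^ 4 + A * j ^ 2 * ((K ^ 2 + K ^ 4) * j ^ 2)
        + 2 * E * K ^ 2 * j ^ 4 + j ^ 4 := by rw [hN]; ring
    have x5 : 0 < j ^ 4 := by positivity
    have x6 := mul_nonneg a0.le (neg_nonneg.2 hFyy)
    have e1' := e1 t ht y hy
    have e2' := e2 t ht y hy
    have e3' := e3 t ht y hy
    rw [mul_add (A * j ^ 2), mul_add (A * j ^ 2), x1] at B2'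
    have tot : (2 * (t - t0) * ζ y ^ 4 * v t y ^ 2 + 2 * (t - t0) ^ 2 * ζ y ^ 4 * v t y * vt t y
      + A * j ^ 2 * (ζ y ^ 2 * uy t y ^ 2 + 2 * (t - t0) * ζ y ^ 2 * uy t y * vy t y)
      + 2 * E * j ^ 6 * u t y * v t y - N * j ^ 4) - a t y * ((t - t0) ^ 2 * (12 * ζ y ^ 2 * (-8 * j ^ 4 * (y - s)) ^ 2 * v t y ^ 2
        + 4 * ζ y ^ 3 * (-8 * j ^ 4) * v t y ^ 2 + 16 * ζ y ^ 3 * (-8 * j ^ 4 * (y - s)) * v t y * vy t y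
        + 2 * ζ y ^ 4 * (vy t y ^ 2 + v t y * vyy t y))
      + A * j ^ 2 * (t - t0) * (2 * (-8 * j ^ 4 * (y - s)) ^ 2 * uy t y ^ 2
        + 2 * ζ y * (-8 * j ^ 4) * uy t y ^ 2 + 8 * ζ y * (-8 * j ^ 4 * (y - s)) * uy t y * uyy t y
        + 2 * ζ y ^ 2 * (uyy t y ^ 2 + uy t y * uyyy t y))
      + 2 * E * j ^ 6 * (uy t y ^ 2 + u t y * uyy t y)) =
      (2 * (t - t0) * ζ y ^ 4 * v t y ^ 2 + 2 * (t - t0) ^ 2 * ζ y ^ 4 * (v t y * G t y)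
      - a t y * ((t - t0) ^ 2 * (12 * ζ y ^ 2 * (-8 * j ^ 4 * (y - s)) ^ 2 * v t y ^ 2 + 4 * ζ y ^ 3 * (-8 * j ^ 4) * v t y ^ 2 + 16 * ζ y ^ 3 * (-8 * j ^ 4 * (y - s)) * v t y * vy t y
        + 2 * ζ y ^ 4 * vy t y ^ 2))) +
      A * j ^ 2 * (ζ y ^ 2 * uy t y ^ 2 + 2 * (t - t0) * ζ y ^ 2 * uy t y * (ay t y * uyy t y + gy t y)
      - a t y * ((t - t0) * (2 * (-8 * j ^ 4 * (y - s)) ^ 2 * uy t y ^ 2 + 2 * ζ y * (-8 * j ^ 4) * uy t y ^ 2 + 8 * ζ y * (-8 * j ^ 4 * (y - s)) * uy t y * uyy t y + 2 * ζ y ^ 2 * uyy t y ^ 2)))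
      + 2 * E * j ^ 6 * (u t y * g t y - a t y * uy t y ^ 2) - N * j ^ 4 := by
      linear_combination (2 * (t - t0) ^ 2 * ζ y ^ 4 * v t y) * e3' +
        (A * j ^ 2 * (2 * (t - t0) * ζ y ^ 2 * uy t y)) * e2' + (2 * E * j ^ 6 * u t y) * e1'
    linarith

end

noncomputable section

lemma small_rpow {C a : ℝ} (ha : 0 < a) {ν : ℝ} (hν : 0 < ν) :
    ∃ κ > 0, ∀ y : ℝ, 0 < y → y < κ → C * y ^ a ≤ ν := by
  have h1 : Filter.Tendsto (fun y : ℝ => C * y ^ a) (nhds 0) (nhds (C * 0 ^ a)) :=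
    ((Real.continuousAt_rpow_const 0 a (Or.inr ha.le)).tendsto).const_mul C
  rw [Real.zero_rpow ha.ne', mul_zero] at h1
  obtain ⟨κ, hκ, h⟩ := Metric.eventually_nhds_iff.1 (h1.eventually (gt_mem_nhds hν))
  exact ⟨κ, hκ, fun y y0 hy => (h (by rw [Real.dist_eq, sub_zero, abs_of_pos y0]; exact hy)).le⟩

namespace Setup
variable {X d μ M C₀ α : ℝ} {q : ℝ → ℝ} {w r R : ℝ → ℝ → ℝ}
variable (S : Setup X d μ M C₀ α q w r R)
include S

lemma lift {t0 ε δ N K L c0 : ℝ} (h0 : 0 < t0) (hε : t0 < ε) (δ0 : 0 < δ) (hδ : δ < d)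
    (hN : 0 ≤ N) (hK : 0 ≤ K) (hL : 0 ≤ L) (φ φ' φ'' ω : ℝ → ℝ) (hc : 0 < c0)
    (p0 : ContinuousOn φ (Ioc 0 δ)) (p1 : ∀ y ∈ Ioo 0 δ, HasDerivAt φ (φ' y) y)
    (p2 : ∀ y ∈ Ioo 0 δ, HasDerivAt φ' (φ'' y) y) (p3 : ∀ y ∈ Ioc 0 δ, 0 < φ y)
    (hω : ∀ y ∈ Ioo 0 δ, 0 < ω y)
    (haφ : ∀ t ∈ Ioo 0 X, ∀ y ∈ Ioo 0 δ, R t y * φ'' y ≤ -(c0 * ω y)) :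
    ∃ C, ∀ z zt zy zyy B : ℝ → ℝ → ℝ,
      ContinuousOn (fun x : ℝ × ℝ => z x.1 x.2) (Ico t0 X ×ˢ Ioc 0 δ) →
      (∀ t ∈ Ioo t0 X, ∀ y ∈ Ioo 0 δ, HasDerivAt (fun s => z s y) (zt t y) t) →
      (∀ t ∈ Ioo t0 X, ∀ y ∈ Ioo 0 δ, HasDerivAt (z t) (zy t y) y) →
      (∀ t ∈ Ioo t0 X, ∀ y ∈ Ioo 0 δ, HasDerivAt (zy t) (zyy t y) y) →
      (∀ t ∈ Ioo t0 X, ∀ y ∈ Ioo 0 δ, B t y ≤ K) →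
      (∀ t ∈ Ioo t0 X, ∀ y ∈ Ioo 0 δ, |zt t y - R t y * zyy t y - B t y * z t y| ≤ N * ω y) →
      (∀ t ∈ Ioo t0 X, ∀ y ∈ Ioo 0 δ, |z t y| ≤ N * ω y) →
      (∀ t ∈ Ico t0 X, |z t δ| ≤ L) →
      (∀ ν > 0, ∃ κ > 0, ∀ t ∈ Ico t0 X, ∀ y ∈ Ioc 0 δ, y < κ → |z t y| ≤ ν) →
      ∀ t ∈ Ico ε X, ∀ y ∈ Ioc 0 δ, |z t y| ≤ C * φ y := by
  have hX := S.hX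
  have pδ := p3 δ ⟨δ0, le_rfl⟩
  obtain ⟨A, hA⟩ : ∃ A, A = (X + 1) * N / c0 + X * L / φ δ + 1 := ⟨_, rfl⟩
  have hN' : 0 ≤ (X + 1) * N / c0 := by positivity
  have hL' : 0 ≤ X * L / φ δ := by positivity
  have A0 : 0 < A := by rw [hA]; positivity
  have e0 : 0 < ε - t0 := by linarith
  refine ⟨A * Real.exp (K * X) / (ε - t0), ?_⟩
  -- one sided
  have one : ∀ z zt zy zyy B : ℝ → ℝ → ℝ,
      ContinuousOn (fun x : ℝ × ℝ => z x.1 x.2) (Ico t0 X ×ˢ Ioc 0 δ) →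
      (∀ t ∈ Ioo t0 X, ∀ y ∈ Ioo 0 δ, HasDerivAt (fun s => z s y) (zt t y) t) →
      (∀ t ∈ Ioo t0 X, ∀ y ∈ Ioo 0 δ, HasDerivAt (z t) (zy t y) y) →
      (∀ t ∈ Ioo t0 X, ∀ y ∈ Ioo 0 δ, HasDerivAt (zy t) (zyy t y) y) →
      (∀ t ∈ Ioo t0 X, ∀ y ∈ Ioo 0 δ, B t y ≤ K) →
      (∀ t ∈ Ioo t0 X, ∀ y ∈ Ioo 0 δ, |zt t y - R t y * zyy t y - B t y * z t y| ≤ N * ω y) →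
      (∀ t ∈ Ioo t0 X, ∀ y ∈ Ioo 0 δ, |z t y| ≤ N * ω y) →
      (∀ t ∈ Ico t0 X, |z t δ| ≤ L) →
      (∀ ν > 0, ∃ κ > 0, ∀ t ∈ Ico t0 X, ∀ y ∈ Ioc 0 δ, y < κ → |z t y| ≤ ν) →
      ∀ t ∈ Ico ε X, ∀ y ∈ Ioc 0 δ, z t y ≤ A * Real.exp (K * X) / (ε - t0) * φ y := by
    intro z zt zy zyy B hc1 h1 h2 h3 hB heq hz hzδ hv t ht y hy
    have hT : ∀ s ∈ Ioc t0 t, s ∈ Ioo t0 X := fun s hs => ⟨hs.1, hs.2.trans_lt ht.2⟩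
    have hT' : ∀ s ∈ Icc t0 t, s ∈ Ico t0 X := fun s hs => ⟨hs.1, hs.2.trans_lt ht.2⟩
    have main := barrier (t0 := t0) (T := t) (δ := δ) (K := K) (N := (X + 1) * N / c0) (A := A)
      (fun s y => (s - t0) * z s y) (fun s y => 1 * z s y + (s - t0) * zt s y)
      (fun s y => (s - t0) * zy s y) (fun s y => (s - t0) * zyy s y) R B φ φ' φ'' (fun y => c0 * ω y)
      hK hN' (by rw [hA]; linarith) ?_ ?_ ?_ ?_ p0 p1 p2 (fun y hy => (p3 y hy).le) ?_ ?_ ?_ ?_ ?_ ?_ ?_ ?_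
      t ⟨(hε.trans_le ht.1).le, le_rfl⟩ y hy
    · have hy0 := p3 y hy
      have x1 : Real.exp (K * (t - t0)) ≤ Real.exp (K * X) := by
        apply Real.exp_le_exp.2
        apply mul_le_mul_of_nonneg_left _ hK
        linarith [ht.2]
      have x2 : A * Real.exp (K * (t - t0)) * φ y ≤ A * Real.exp (K * X) * φ y := by gcongr
      have x3 : 0 < A * Real.exp (K * X) * φ y := by positivity
      have x4 : (t - t0) * z t y ≤ A * Real.exp (K * X) * φ y := main.trans x2
      rw [div_mul_eq_mul_div, le_div_iff₀ e0]
      by_cases hzp : 0 ≤ z t y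
      · have := mul_le_mul_of_nonneg_right (show ε - t0 ≤ t - t0 by linarith [ht.1]) hzp
        linarith
      · have : z t y * (ε - t0) ≤ 0 := mul_nonpos_of_nonpos_of_nonneg (by linarith) e0.le
        linarith
    · refine ContinuousOn.mul (by fun_prop) (hc1.mono (prod_mono hT' le_rfl))
    · intro s hs y hy
      exact ((hasDerivAt_id s).sub_const t0).mul (h1 s (hT s hs) y hy)
    · intro s hs y hy
      exact (h2 s (hT s hs) y hy).const_mul _
    · intro s hs y hy
      exact (h3 s (hT s hs) y hy).const_mul _
    · intro s hs y hy
      exact (S.Rpos s ⟨h0.trans hs.1, hs.2.trans_lt ht.2⟩ y ⟨hy.1, hy.2.trans hδ⟩).le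
    · intro y hy
      exact mul_pos hc (hω y hy)
    · intro s hs y hy
      exact haφ s ⟨h0.trans hs.1, hs.2.trans_lt ht.2⟩ y hy
    · intro s hs y hy
      exact hB s (hT s hs) y hy
    · intro s hs y hy
      have i1 := (abs_le.1 (heq s (hT s hs) y hy)).2
      have i2 := (abs_le.1 (hz s (hT s hs) y hy)).2
      have i3 : 0 ≤ s - t0 := by linarith [hs.1]
      have i4 : s - t0 ≤ X := by linarith [hs.2, ht.2]
      have i5 := mul_le_mul_of_nonneg_left i1 i3
      have i6 : 0 ≤ N * ω y := mul_nonneg hN (hω y hy).le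
      have i7 := mul_le_mul_of_nonneg_right i4 i6
      have i8 : (X + 1) * N / c0 * (c0 * ω y) = X * (N * ω y) + N * ω y := by field_simp
      rw [i8]
      linarith
    · intro y hy
      simp
    · intro s hs
      have i1 := (abs_le.1 (hzδ s (hT' s hs))).2
      have i3 : 0 ≤ s - t0 := by linarith [hs.1]
      have i4 : s - t0 ≤ X := by linarith [hs.2, ht.2]
      calc (s - t0) * z s δ ≤ (s - t0) * L := by gcongr
        _ ≤ X * L := by gcongr
        _ = X * L / φ δ * φ δ := by field_simp
        _ ≤ A * φ δ := by gcongr; rw [hA]; linarith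
    · intro ν hν
      obtain ⟨κ, κ0, hκ⟩ := hv (ν / X) (by positivity)
      refine ⟨κ, κ0, fun s hs y hy hyκ => ?_⟩
      have i1 := (abs_le.1 (hκ s (hT' s hs) y hy hyκ)).2
      have i3 : 0 ≤ s - t0 := by linarith [hs.1]
      have i4 : s - t0 ≤ X := by linarith [hs.2, ht.2]
      calc (s - t0) * z s y ≤ (s - t0) * (ν / X) := by gcongr
        _ ≤ X * (ν / X) := by gcongr
        _ = ν := by field_simp
  intro z zt zy zyy B hc1 h1 h2 h3 hB heq hz hzδ hv t ht y hy
  rw [abs_le']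
  refine ⟨one z zt zy zyy B hc1 h1 h2 h3 hB heq hz hzδ hv t ht y hy, ?_⟩
  refine one (fun t y => - z t y) (fun t y => - zt t y) (fun t y => - zy t y) (fun t y => - zyy t y) B
    hc1.neg (fun t ht y hy => (h1 t ht y hy).neg) (fun t ht y hy => (h2 t ht y hy).neg)
    (fun t ht y hy => (h3 t ht y hy).neg) hB ?_ ?_ ?_ ?_ t ht y hy
  · intro t ht y hy
    rw [show -zt t y - R t y * -zyy t y - B t y * -z t y =
      -(zt t y - R t y * zyy t y - B t y * z t y) by ring, abs_neg]
    exact heq t ht y hy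
  · simpa using hz
  · simpa using hzδ
  · simpa using hv

lemma Rlb {t y : ℝ} (ht : t ∈ Ioo 0 X) (hy : y ∈ Ioo 0 d) : √μ * y ^ ((1:ℝ)/2) ≤ R t y := by
  have h1 := S.RR t ht y hy
  have h2 := S.wlb t ht y hy
  have h3 := S.Rpos t ht y hy
  rw [← Real.sqrt_eq_rpow, ← Real.sqrt_mul S.hμ.le]
  exact Real.sqrt_le_iff.2 ⟨h3.le, by linarith⟩

lemma Rub {t y : ℝ} (ht : t ∈ Ioo 0 X) (hy : y ∈ Ioo 0 d) : R t y ≤ √M * y ^ ((1:ℝ)/2) := by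
  have h1 := S.RR t ht y hy
  have h2 := S.wub t ht y hy
  have h3 := S.Rpos t ht y hy
  rw [← Real.sqrt_eq_rpow, ← Real.sqrt_mul S.hM.le]
  exact Real.le_sqrt_of_sq_le (by linarith)

lemma liftA {t0 ε δ N K L : ℝ} (h0 : 0 < t0) (hε : t0 < ε) (δ0 : 0 < δ) (hδ : δ < d)
    (hN : 0 ≤ N) (hK : 0 ≤ K) (hL : 0 ≤ L) :
    ∃ C, ∀ z zt zy zyy B : ℝ → ℝ → ℝ,
      ContinuousOn (fun x : ℝ × ℝ => z x.1 x.2) (Ico t0 X ×ˢ Ioc 0 δ) →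
      (∀ t ∈ Ioo t0 X, ∀ y ∈ Ioo 0 δ, HasDerivAt (fun s => z s y) (zt t y) t) →
      (∀ t ∈ Ioo t0 X, ∀ y ∈ Ioo 0 δ, HasDerivAt (z t) (zy t y) y) →
      (∀ t ∈ Ioo t0 X, ∀ y ∈ Ioo 0 δ, HasDerivAt (zy t) (zyy t y) y) →
      (∀ t ∈ Ioo t0 X, ∀ y ∈ Ioo 0 δ, B t y ≤ K) →
      (∀ t ∈ Ioo t0 X, ∀ y ∈ Ioo 0 δ, |zt t y - R t y * zyy t y - B t y * z t y| ≤ N) →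
      (∀ t ∈ Ioo t0 X, ∀ y ∈ Ioo 0 δ, |z t y| ≤ N) →
      (∀ t ∈ Ico t0 X, |z t δ| ≤ L) →
      (∀ ν > 0, ∃ κ > 0, ∀ t ∈ Ico t0 X, ∀ y ∈ Ioc 0 δ, y < κ → |z t y| ≤ ν) →
      ∀ t ∈ Ico ε X, ∀ y ∈ Ioc 0 δ, |z t y| ≤ C * y := by
  have hm := S.hμ
  have key : ∀ y ∈ Ioc 0 δ, √δ * y ≤ 2 * √δ * y - y ^ ((3:ℝ)/2) := by
    intro y hy
    have : y ^ ((3:ℝ)/2) = y * √y := by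
      rw [Real.sqrt_eq_rpow, ← Real.rpow_one_add' hy.1.le (by norm_num)]; norm_num
    have h2 := mul_le_mul_of_nonneg_left (Real.sqrt_le_sqrt hy.2) hy.1.le
    rw [this]; linarith
  have sδ : 0 < √δ := Real.sqrt_pos.2 δ0
  have hl := S.lift (L := L) h0 hε δ0 hδ hN hK hL (fun y => 2 * √δ * y - y ^ ((3:ℝ)/2))
    (fun y => 2 * √δ - 3/2 * y ^ ((1:ℝ)/2)) (fun y => - (3/4 * y ^ (-(1:ℝ)/2))) (fun _ => 1)
    (c0 := 3/4 * √μ) (by positivity)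
  obtain ⟨C, hC⟩ := hl
    (by
      refine ContinuousOn.sub (by fun_prop) ?_
      exact continuousOn_id.rpow_const fun y hy => Or.inr (by norm_num))
    (by
      intro y hy
      have h1 := ((hasDerivAt_id y).const_mul (2 * √δ)).sub
        (Real.hasDerivAt_rpow_const (p := (3:ℝ)/2) (Or.inl hy.1.ne'))
      refine h1.congr_deriv ?_
      norm_num)
    (by
      intro y hy
      have h1 := ((Real.hasDerivAt_rpow_const (p := (1:ℝ)/2) (Or.inl hy.1.ne')).const_mul (3/2)).const_sub (2 * √δ)
      refine h1.congr_deriv ?_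
      norm_num; ring)
    (by
      intro y hy
      have : 0 < √δ * y := by have := hy.1; positivity
      linarith [key y hy])
    (by
      intro y hy; norm_num)
    (by
      intro t ht y hy
      have h1 := S.Rlb ht ⟨hy.1, hy.2.trans hδ⟩
      have h2 : 0 < y ^ (-(1:ℝ)/2) := Real.rpow_pos_of_pos hy.1 _
      have h3 := mul_le_mul_of_nonneg_right h1 h2.le
      rw [mul_assoc, ← Real.rpow_add hy.1] at h3
      norm_num at h3 ⊢
      linarith)
  refine ⟨|C| * (2 * √δ), ?_⟩
  intro z zt zy zyy B a1 a2 a3 a4 a5 a6 a7 a8 a9 t ht y hy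
  have h3 := hC z zt zy zyy B a1 a2 a3 a4 a5 (by simpa using a6) (by simpa using a7) a8 a9 t ht y hy
  have h4 : 0 < y ^ ((3:ℝ)/2) := Real.rpow_pos_of_pos hy.1 _
  have h5 := key y hy
  have h6 : 0 ≤ √δ * y := by have := hy.1; positivity
  calc |z t y| ≤ C * (2 * √δ * y - y ^ ((3:ℝ)/2)) := h3
    _ ≤ |C| * (2 * √δ * y - y ^ ((3:ℝ)/2)) := by
      apply mul_le_mul_of_nonneg_right (le_abs_self C); linarith
    _ ≤ |C| * (2 * √δ * y) := by gcongr; linarith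
    _ = _ := by ring

lemma liftB {t0 ε δ N K L : ℝ} (h0 : 0 < t0) (hε : t0 < ε) (δ0 : 0 < δ) (hδ : δ < d)
    (hN : 0 ≤ N) (hK : 0 ≤ K) (hL : 0 ≤ L) :
    ∃ C, ∀ z zt zy zyy B : ℝ → ℝ → ℝ,
      ContinuousOn (fun x : ℝ × ℝ => z x.1 x.2) (Ico t0 X ×ˢ Ioc 0 δ) →
      (∀ t ∈ Ioo t0 X, ∀ y ∈ Ioo 0 δ, HasDerivAt (fun s => z s y) (zt t y) t) →
      (∀ t ∈ Ioo t0 X, ∀ y ∈ Ioo 0 δ, HasDerivAt (z t) (zy t y) y) →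
      (∀ t ∈ Ioo t0 X, ∀ y ∈ Ioo 0 δ, HasDerivAt (zy t) (zyy t y) y) →
      (∀ t ∈ Ioo t0 X, ∀ y ∈ Ioo 0 δ, B t y ≤ K) →
      (∀ t ∈ Ioo t0 X, ∀ y ∈ Ioo 0 δ, |zt t y - R t y * zyy t y - B t y * z t y| ≤ N * y⁻¹) →
      (∀ t ∈ Ioo t0 X, ∀ y ∈ Ioo 0 δ, |z t y| ≤ N * y⁻¹) →
      (∀ t ∈ Ico t0 X, |z t δ| ≤ L) →
      (∀ ν > 0, ∃ κ > 0, ∀ t ∈ Ico t0 X, ∀ y ∈ Ioc 0 δ, y < κ → |z t y| ≤ ν) →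
      ∀ t ∈ Ico ε X, ∀ y ∈ Ioc 0 δ, |z t y| ≤ C * y ^ ((1:ℝ)/2) := by
  have hm := S.hμ
  refine S.lift (L := L) h0 hε δ0 hδ hN hK hL (fun y => y ^ ((1:ℝ)/2))
    (fun y => 1/2 * y ^ (-(1:ℝ)/2)) (fun y => - (1/4 * y ^ (-(3:ℝ)/2))) (fun y => y⁻¹)
    (c0 := 1/4 * √μ) (by positivity) ?_ ?_ ?_ ?_ ?_ ?_
  · exact continuousOn_id.rpow_const fun y hy => Or.inr (by norm_num)
  · intro y hy
    have h1 := (Real.hasDerivAt_rpow_const (p := (1:ℝ)/2) (Or.inl hy.1.ne'))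
    refine h1.congr_deriv ?_
    norm_num
  · intro y hy
    have h1 := ((Real.hasDerivAt_rpow_const (p := -(1:ℝ)/2) (Or.inl hy.1.ne')).const_mul (1/2))
    refine h1.congr_deriv ?_
    norm_num; ring
  · intro y hy
    exact Real.rpow_pos_of_pos hy.1 _
  · intro y hy; exact inv_pos.2 hy.1
  · intro t ht y hy
    have h1 := S.Rlb ht ⟨hy.1, hy.2.trans hδ⟩
    have h2 : 0 < y ^ (-(3:ℝ)/2) := Real.rpow_pos_of_pos hy.1 _
    have h3 := mul_le_mul_of_nonneg_right h1 h2.le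
    rw [mul_assoc, ← Real.rpow_add hy.1] at h3
    norm_num [Real.rpow_neg_one] at h3 ⊢
    linarith

end Setup
end

noncomputable section

lemma Bd.cast {X ε δ a b : ℝ} {f : ℝ → ℝ → ℝ} (h : Bd X ε δ a f) (e : a = b) : Bd X ε δ b f := e ▸ h

lemma SmI.contOn {X d t0 δ : ℝ} {f : ℝ → ℝ → ℝ} (hf : Sm X d f) (h0 : 0 < t0) (hδ : δ < d) :
    ContinuousOn (fun x : ℝ × ℝ => f x.1 x.2) (Ico t0 X ×ˢ Ioc 0 δ) :=
  (ContDiffOn.continuousOn hf).mono (prod_mono (fun _ hx => ⟨h0.trans_le hx.1, hx.2⟩)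
    (fun _ hy => ⟨hy.1, hy.2.trans_lt hδ⟩))

lemma Bd.diff {X d ε δ a : ℝ} {f : ℝ → ℝ → ℝ} (hf : Sm X d f) (hε : 0 < ε) (hδ : δ < d)
    (h : Bd X ε δ a (Dt f)) : ∃ C > 0, ∀ t ∈ Ico ε X, ∀ s ∈ Ico ε X, ∀ y ∈ Ioc 0 δ,
      |f t y - f s y| ≤ C * y ^ a * |t - s| := by
  obtain ⟨C, c0, hC⟩ := h.pos
  refine ⟨C, c0, fun t ht s hs y hy => ?_⟩
  have := Convex.norm_image_sub_le_of_norm_hasDerivWithin_le (f := fun x => f x y)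
    (f' := fun x => Dt f x y) (s := Ico ε X) (C := C * y ^ a) (x := s) (y := t)
    (fun x hx => (hf.hasDt ⟨hε.trans_le hx.1, hx.2⟩ ⟨hy.1, hy.2.trans_lt hδ⟩).hasDerivWithinAt)
    (fun x hx => hC x hx y hy) (convex_Ico _ _) hs ht
  exact this

namespace Setup
variable {X d μ M C₀ α : ℝ} {q : ℝ → ℝ} {w r R : ℝ → ℝ → ℝ}
variable (S : Setup X d μ M C₀ α q w r R)
include S

lemma bd_w {ε δ : ℝ} (hε : 0 < ε) (hδ : δ < d) : Bd X ε δ 1 w := by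
  refine ⟨M, fun t ht y hy => ?_⟩
  have hx : t ∈ Ioo 0 X := ⟨hε.trans_le ht.1, ht.2⟩
  have hy' : y ∈ Ioo 0 d := ⟨hy.1, hy.2.trans_lt hδ⟩
  have h1 := S.wlb t hx y hy'
  have h2 := S.wub t hx y hy'
  have := mul_pos S.hμ hy.1
  rw [Real.rpow_one, abs_of_nonneg (by linarith)]
  exact h2

lemma bd_R {ε δ : ℝ} (hε : 0 < ε) (hδ : δ < d) : Bd X ε δ (1/2) R := by
  refine ⟨√M, fun t ht y hy => ?_⟩
  have hx : t ∈ Ioo 0 X := ⟨hε.trans_le ht.1, ht.2⟩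
  have hy' : y ∈ Ioo 0 d := ⟨hy.1, hy.2.trans_lt hδ⟩
  rw [abs_of_pos (S.Rpos t hx y hy')]
  exact S.Rub hx hy'

lemma B_ub {ε δ : ℝ} (hε : 0 < ε) (hδ : δ < d) (h1 : Bd X ε δ 1 (Dt w)) (c : ℝ) :
    ∃ K ≥ 0, ∀ t ∈ Ico ε X, ∀ y ∈ Ioc 0 δ, BB q w r c t y ≤ K := by
  obtain ⟨C, c0, hC⟩ := h1.pos
  have hm := S.hμ
  refine ⟨1/2 * (|c| * C / μ), by positivity, fun t ht y hy => ?_⟩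
  have hx : t ∈ Ioo 0 X := ⟨hε.trans_le ht.1, ht.2⟩
  have hy' : y ∈ Ioo 0 d := ⟨hy.1, hy.2.trans_lt hδ⟩
  have h2 := S.r2 hx hy'
  have h3 := hC t ht y hy
  rw [Real.rpow_one] at h3
  have h4 := S.q0 t
  have y0 := hy.1
  have h5 : c * Dt w t y - q t ≤ |c| * (C * y) := by
    have : c * Dt w t y ≤ |c| * |Dt w t y| := by rw [← abs_mul]; exact le_abs_self _
    have : |c| * |Dt w t y| ≤ |c| * (C * y) := by gcongr
    linarith
  have h6 : BB q w r c t y = 1/2 * (r t y ^ 2 * (c * Dt w t y - q t)) := by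
    simp only [BB, Pi.mul_apply, Pi.sub_apply]; ring
  rw [h6]
  have h7 : r t y ^ 2 * (c * Dt w t y - q t) ≤ r t y ^ 2 * (|c| * (C * y)) := by gcongr
  have h8 : r t y ^ 2 * (|c| * (C * y)) ≤ 1 / (μ * y) * (|c| * (C * y)) := by gcongr
  have h9 : 1 / (μ * y) * (|c| * (C * y)) = |c| * C / μ := by field_simp
  linarith

lemma bd_dtR {ε δ : ℝ} (hε : 0 < ε) (hδ : δ < d) (h1 : Bd X ε δ 1 (Dt w)) :
    Bd X ε δ (1/2) (Dt R) := by
  have h := ((Cl.const_mul (1/2) hε hδ S.sr (cl_zero (S.bd_r hε hδ))).bd.mul h1).cast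
    (show (-1/2 + 1 : ℝ) = 1/2 by norm_num)
  refine h.congr hε hδ fun x hx y hy => ?_
  rw [S.dtR hx hy]; rfl

lemma bd_dyR {ε δ : ℝ} (hε : 0 < ε) (hδ : δ < d) (h1 : Bd X ε δ 0 (Dy w)) :
    Bd X ε δ (-1/2) (Dy R) := by
  have h := ((Cl.const_mul (1/2) hε hδ S.sr (cl_zero (S.bd_r hε hδ))).bd.mul h1).cast
    (show (-1/2 + 0 : ℝ) = -1/2 by norm_num)
  refine h.congr hε hδ fun x hx y hy => ?_
  rw [S.dyR hx hy]; rfl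

lemma base_step {ε : ℝ} (hε : 0 < ε) : Cl X ε (d/2) 1 0 1 w := by
  have hd := S.hd
  have hm := S.hμ
  have hC := S.hC₀
  have hδ : d/2 < d := by linarith
  obtain ⟨c, f, sf, he, hf⟩ := S.key 0
  have t00 : 0 < ε/2 := by positivity
  obtain ⟨N1, n10, hN1⟩ := ((hf (ε/2) (d/2) t00 hδ 0 0 (cl_zero (S.bd_w t00 hδ))).bd).pos
  have ypow : ∀ y ∈ Ioc 0 (d/2), y ^ ((1:ℝ)/2 + α) ≤ y ^ ((1:ℝ)/2) := fun y hy =>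
    Real.rpow_le_rpow_of_exponent_ge hy.1 (by linarith [hy.2, S.hd1]) (by linarith [S.hα])
  have yone : ∀ y ∈ Ioc 0 (d/2), y ^ ((1:ℝ)/2) ≤ 1 := fun y hy =>
    Real.rpow_le_one hy.1.le (by linarith [hy.2, S.hd1]) (by norm_num)
  have hb : ∀ t ∈ Ico (ε/2) X, ∀ y ∈ Ioc 0 (d/2), |Dt w t y| ≤ C₀ * y ^ ((1:ℝ)/2) := by
    intro t ht y hy
    have h1 := S.base t ⟨t00.trans_le ht.1, ht.2⟩ y ⟨hy.1, hy.2.trans_lt hδ⟩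
    have h2 := ypow y hy
    refine h1.trans ?_
    gcongr
  have hb1 : ∀ t ∈ Ico (ε/2) X, ∀ y ∈ Ioc 0 (d/2), |Dt w t y| ≤ C₀ := by
    intro t ht y hy
    have h2 := yone y hy
    refine (hb t ht y hy).trans ?_
    nlinarith
  obtain ⟨C, hC1⟩ := S.liftA (t0 := ε/2) (ε := ε) (δ := d/2) (N := C₀ + |c| * C₀ ^ 2 / μ + N1) (K := 0) (L := C₀)
    t00 (by linarith) (by linarith) hδ (by positivity) le_rfl hC.le
  have h1 : Bd X ε (d/2) 1 (Dt w) := by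
    refine ⟨C, fun t ht y hy => ?_⟩
    rw [Real.rpow_one]
    refine hC1 (Dt w) (Dt (Dt w)) (Dy (Dt w)) (Dy (Dy (Dt w))) (BB q w r 0)
      (S.sw.dt.contOn t00 hδ) ?_ ?_ ?_ ?_ ?_ ?_ ?_ ?_ t ht y hy
    · intro t ht y hy
      exact S.sw.dt.hasDt ⟨t00.trans ht.1, ht.2⟩ ⟨hy.1, hy.2.trans hδ⟩
    · intro t ht y hy
      exact S.sw.dt.hasDy ⟨t00.trans ht.1, ht.2⟩ ⟨hy.1, hy.2.trans hδ⟩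
    · intro t ht y hy
      exact S.sw.dt.dyU.hasDy ⟨t00.trans ht.1, ht.2⟩ ⟨hy.1, hy.2.trans hδ⟩
    · intro t ht y hy
      have h6 : BB q w r 0 t y = -(1/2 * (r t y ^ 2 * q t)) := by
        simp only [BB, Pi.mul_apply, Pi.sub_apply]; ring
      have := S.q0 t
      have : 0 ≤ 1/2 * (r t y ^ 2 * q t) := by positivity
      linarith
    · intro t ht y hy
      have hx : t ∈ Ioo 0 X := ⟨t00.trans ht.1, ht.2⟩
      have hy' : y ∈ Ioo 0 d := ⟨hy.1, hy.2.trans hδ⟩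
      have y0 := hy.1
      have e1 : Dt (Dt w) t y - R t y * Dy (Dy (Dt w)) t y = gg w R 1 t y := rfl
      have e2 : gg w R 1 t y = BB q w r c t y * Dt w t y + f t y := he t hx y hy'
      rw [e1, e2]
      have e3 : BB q w r c t y * Dt w t y + f t y - BB q w r 0 t y * Dt w t y
          = 1/2 * (c * (r t y ^ 2 * Dt w t y ^ 2)) + f t y := by
        simp only [BB, Pi.mul_apply, Pi.sub_apply]; ring
      rw [e3]
      have i1 := hN1 t ⟨ht.1.le, ht.2⟩ y ⟨hy.1, hy.2.le⟩
      rw [Real.rpow_zero, mul_one] at i1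
      have i2 := hb t ⟨ht.1.le, ht.2⟩ y ⟨hy.1, hy.2.le⟩
      have i3 : Dt w t y ^ 2 ≤ C₀ ^ 2 * y := by
        calc Dt w t y ^ 2 = |Dt w t y| ^ 2 := (sq_abs _).symm
          _ ≤ (C₀ * y ^ ((1:ℝ)/2)) ^ 2 := by gcongr
          _ = C₀ ^ 2 * (√y) ^ 2 := by rw [mul_pow, Real.sqrt_eq_rpow]
          _ = _ := by rw [Real.sq_sqrt hy.1.le]
      have i4 : r t y ^ 2 * Dt w t y ^ 2 ≤ C₀ ^ 2 / μ := by
        have := S.r2 hx hy'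
        calc r t y ^ 2 * Dt w t y ^ 2 ≤ 1 / (μ * y) * (C₀ ^ 2 * y) := by gcongr
          _ = _ := by field_simp
      have i5 : |c * (r t y ^ 2 * Dt w t y ^ 2)| ≤ |c| * C₀ ^ 2 / μ := by
        rw [abs_mul, abs_of_nonneg (show 0 ≤ r t y ^ 2 * Dt w t y ^ 2 by positivity), mul_div_assoc]
        gcongr
      have i6 := abs_add_le (1/2 * (c * (r t y ^ 2 * Dt w t y ^ 2))) (f t y)
      rw [abs_mul (1/2)] at i6
      have i7 : |(1/2:ℝ)| = 1/2 := by norm_num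
      rw [i7] at i6
      have i8 := abs_nonneg (c * (r t y ^ 2 * Dt w t y ^ 2))
      linarith
    · intro t ht y hy
      have i2 := hb1 t ⟨ht.1.le, ht.2⟩ y ⟨hy.1, hy.2.le⟩
      have : 0 ≤ |c| * C₀ ^ 2 / μ := by positivity
      linarith
    · intro t ht
      exact hb1 t ht (d/2) ⟨by linarith, le_rfl⟩
    · intro ν hν
      obtain ⟨κ, k0, hk⟩ := small_rpow (C := C₀) (a := 1/2) (by norm_num) hν
      exact ⟨κ, k0, fun t ht y hy hyk => (hb t ht y hy).trans (hk y hy.1 hyk)⟩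
  exact Cl.succ_t hε hδ S.sw (cl_zero (S.bd_w hε hδ)) (cl_zero h1)

lemma bd_dtw {ε δ : ℝ} {n : ℕ} (h : Cl X ε δ (n+1) 0 1 w) : Bd X ε δ 1 (Dt w) := by
  simpa using h 1 (by omega) 0 le_rfl

lemma bd_iter {ε δ : ℝ} {n : ℕ} (h : Cl X ε δ n 0 1 w) : Bd X ε δ 1 (Dt^[n] w) := by
  simpa using h n le_rfl 0 le_rfl

lemma bd_gg {ε δ : ℝ} (hε : 0 < ε) (hδ : δ < d) {n : ℕ} (h : Cl X ε δ (n+1) 0 1 w) :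
    Bd X ε δ 0 (gg w R (n+1)) := by
  obtain ⟨c, f, sf, he, hf⟩ := S.key n
  have h1 := ((S.cl_B hε hδ (n := 0) (m := 0) c (h.mono (by omega) le_rfl)).bd.mul (S.bd_iter h)).cast
    (show (-1 + 1 : ℝ) = 0 by norm_num)
  exact (h1.add (hf ε δ hε hδ 0 0 (h.mono (by omega) le_rfl)).bd).congr hε hδ he.symm

lemma step3 {ε ε' δ : ℝ} (hε : 0 < ε) (hεε : ε < ε') (δ0 : 0 < δ) (hδ : δ < d) {n : ℕ}
    (h : Cl X ε δ (n+1) 0 1 w) (hv : Bd X ε δ (1/2) (Dt^[n+2] w)) : Bd X ε' δ 1 (Dt^[n+2] w) := by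
  obtain ⟨c, f, sf, he, hf⟩ := S.key (n+1)
  obtain ⟨N1, n10, hN1⟩ := (hf ε δ hε hδ 0 0 h).bd.pos
  obtain ⟨K, k0, hK⟩ := S.B_ub hε hδ (S.bd_dtw h) c
  obtain ⟨N2, n20, hN2⟩ := hv.pos
  have yone : ∀ y ∈ Ioc 0 δ, y ^ ((1:ℝ)/2) ≤ 1 := fun y hy =>
    Real.rpow_le_one hy.1.le (by linarith [hy.2, S.hd1]) (by norm_num)
  have hb1 : ∀ t ∈ Ico ε X, ∀ y ∈ Ioc 0 δ, |Dt^[n+2] w t y| ≤ N2 := by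
    intro t ht y hy
    have h2 := yone y hy
    refine (hN2 t ht y hy).trans ?_
    nlinarith
  have sv := S.s_u (n+2)
  obtain ⟨C, hC1⟩ := S.liftA (t0 := ε) (ε := ε') (δ := δ) (N := N1 + N2) (K := K) (L := N2)
    hε hεε δ0 hδ (by positivity) k0 n20.le
  refine ⟨C, fun t ht y hy => ?_⟩
  rw [Real.rpow_one]
  refine hC1 (Dt^[n+2] w) (Dt (Dt^[n+2] w)) (Dy (Dt^[n+2] w)) (Dy (Dy (Dt^[n+2] w))) (BB q w r c)
      (sv.contOn hε hδ) ?_ ?_ ?_ ?_ ?_ ?_ ?_ ?_ t ht y hy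
  · intro t ht y hy
    exact sv.hasDt ⟨hε.trans ht.1, ht.2⟩ ⟨hy.1, hy.2.trans hδ⟩
  · intro t ht y hy
    exact sv.hasDy ⟨hε.trans ht.1, ht.2⟩ ⟨hy.1, hy.2.trans hδ⟩
  · intro t ht y hy
    exact sv.dyU.hasDy ⟨hε.trans ht.1, ht.2⟩ ⟨hy.1, hy.2.trans hδ⟩
  · intro t ht y hy
    exact hK t ⟨ht.1.le, ht.2⟩ y ⟨hy.1, hy.2.le⟩
  · intro t ht y hy
    have hx : t ∈ Ioo 0 X := ⟨hε.trans ht.1, ht.2⟩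
    have hy' : y ∈ Ioo 0 d := ⟨hy.1, hy.2.trans hδ⟩
    have e1 : Dt (Dt^[n+2] w) t y - R t y * Dy (Dy (Dt^[n+2] w)) t y = gg w R (n+2) t y := by
      rw [gg, Function.iterate_succ' Dt (n+2)]; rfl
    have e2 : gg w R (n+2) t y = BB q w r c t y * Dt^[n+2] w t y + f t y := he t hx y hy'
    rw [e1, e2, add_sub_cancel_left]
    have i1 := hN1 t ⟨ht.1.le, ht.2⟩ y ⟨hy.1, hy.2.le⟩
    rw [Real.rpow_zero, mul_one] at i1
    linarith
  · intro t ht y hy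
    have i2 := hb1 t ⟨ht.1.le, ht.2⟩ y ⟨hy.1, hy.2.le⟩
    linarith
  · intro t ht
    exact hb1 t ht δ ⟨δ0, le_rfl⟩
  · intro ν hν
    obtain ⟨κ, k0, hk⟩ := small_rpow (C := N2) (a := 1/2) (by norm_num) hν
    exact ⟨κ, k0, fun t ht y hy hyk => (hN2 t ht y hy).trans (hk y hy.1 hyk)⟩

end Setup
end

noncomputable section

lemma Bd.const {X ε δ : ℝ} (c : ℝ) : Bd X ε δ 0 (fun _ _ => c) := ⟨|c|, fun _ _ _ _ => by simp⟩

lemma Bd.sub {X ε δ a : ℝ} {f g : ℝ → ℝ → ℝ} (hf : Bd X ε δ a f) (hg : Bd X ε δ a g) :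
    Bd X ε δ a (f - g) := by
  rw [sub_eq_add_neg]; exact hf.add hg.neg

namespace Setup
variable {X d μ M C₀ α : ℝ} {q : ℝ → ℝ} {w r R : ℝ → ℝ → ℝ}
variable (S : Setup X d μ M C₀ α q w r R)
include S

lemma bd_dtB {ε δ : ℝ} (hε : 0 < ε) (hδ : δ < d) (h1 : Bd X ε δ 1 (Dt w))
    (h2 : Bd X ε δ (-1) (Dt (Dt w))) (c : ℝ) : Bd X ε δ (-2) (Dt (BB q w r c)) := by
  have hδ1 : δ ≤ 1 := hδ.le.trans S.hd1
  have hq' : ContDiff ℝ (⊤ : ℕ∞) (deriv q) := (contDiff_infty_iff_deriv.1 S.hq).2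
  have hr := S.bd_r hε hδ
  have bq : Bd X ε δ 0 (fun x _ => q x) := (Cl.ofT (n := 0) (m := 0) hε hδ S.hq).bd
  have bq' : Bd X ε δ 0 (fun x _ => deriv q x) := (Cl.ofT (n := 0) (m := 0) hε hδ hq').bd
  have a1 := (((Bd.const c).mul h2).cast (zero_add _)).sub (bq'.weak hδ1 (show (-1:ℝ) ≤ 0 by norm_num))
  have a2 := (((Bd.const (1/2)).mul (hr.mul (hr.mul a1))).cast
    (show (0 + (-1/2 + (-1/2 + -1)) : ℝ) = -2 by norm_num))
  have a3 := ((((Bd.const c).mul h1).cast (zero_add _)).weak hδ1 (show (0:ℝ) ≤ 1 by norm_num)).sub bq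
  have a4 := ((Bd.const (1/2)).mul (hr.mul (hr.mul (hr.mul (hr.mul (h1.mul a3)))))).cast
    (show (0 + (-1/2 + (-1/2 + (-1/2 + (-1/2 + (1 + 0))))) : ℝ) = -1 by norm_num)
  have a5 := a2.sub (a4.weak hδ1 (show (-2:ℝ) ≤ -1 by norm_num))
  refine a5.congr hε hδ fun x hx y hy => ?_
  rw [S.dtB c hx hy]
  simp only [Pi.sub_apply, Pi.mul_apply]
  ring

lemma step2 {ε ε' δ : ℝ} (hε : 0 < ε) (hεε : ε < ε') (δ0 : 0 < δ) (hδ : δ < d) {n : ℕ}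
    (h : Cl X ε δ (n+1) 0 1 w) (hv : Bd X ε δ (-1) (Dt^[n+2] w)) : Bd X ε' δ (1/2) (Dt^[n+2] w) := by
  have hδ1 : δ ≤ 1 := hδ.le.trans S.hd1
  obtain ⟨c, f, sf, he, hf⟩ := S.key n
  have h1 := S.bd_dtw h
  have h2 : Bd X ε δ (-1) (Dt (Dt w)) := by
    rcases n with _ | n
    · exact hv
    · have := h 2 (by omega) 0 le_rfl
      simp at this
      exact this.weak hδ1 (by norm_num)
  obtain ⟨K, k0, hK⟩ := S.B_ub hε hδ h1 c
  have su := S.s_u (n+1)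
  have ev : Dt (Dt^[n+1] w) = Dt^[n+2] w := by rw [Function.iterate_succ' Dt (n+1)]; rfl
  have buyy : Bd X ε δ (-3/2) (Dy (Dy (Dt^[n+1] w))) := by
    have := ((S.bd_r hε hδ).mul (hv.sub ((S.bd_gg hε hδ h).weak hδ1 (show (-1:ℝ) ≤ 0 by norm_num)))).cast
      (show (-1/2 + -1 : ℝ) = -3/2 by norm_num)
    refine this.congr hε hδ fun x hx y hy => ?_
    rw [S.uyy (n+1) hx hy]; rfl
  obtain ⟨CR, cr0, hR⟩ := Bd.diff S.sR hε hδ (S.bd_dtR hε hδ h1)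
  obtain ⟨Cf, cf0, hF⟩ := Bd.diff sf hε hδ
    ((hf ε δ hε hδ 1 0 h).dt hε hδ sf).bd
  obtain ⟨CB, cb0, hB⟩ := Bd.diff (S.s_B c) hε hδ (S.bd_dtB hε hδ h1 h2 c)
  obtain ⟨Cu, cu0, hU⟩ := Bd.diff su hε hδ (by rw [ev]; exact hv)
  obtain ⟨Cy, cy0, hY⟩ := buyy.pos
  obtain ⟨C1, c10, hC1⟩ := (S.bd_iter h).pos
  obtain ⟨t0, ht0, ht0'⟩ := exists_between hεε
  have t00 : 0 < t0 := hε.trans ht0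
  obtain ⟨C, hC⟩ := S.liftB (t0 := t0) (ε := ε') (δ := δ) (N := Cf + Cy * CR + C1 * CB + Cu) (K := K)
    (L := Cu * δ⁻¹) t00 ht0' δ0 hδ (by positivity) k0 (by positivity)
  generalize hu : Dt^[n+1] w = u at *
  have hz : ∀ h ∈ Ioo 0 (t0 - ε), ∀ t ∈ Ico ε' X, ∀ y ∈ Ioc 0 δ,
      |(u t y - u (t - h) y) / h| ≤ C * y ^ ((1:ℝ)/2) := by
    intro h hh
    have hp := hh.1
    have sh : ∀ t ∈ Ico t0 X, t - h ∈ Ico ε X := fun t ht => ⟨by linarith [hh.2, ht.1], by linarith [ht.2]⟩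
    have sh0 : ∀ t ∈ Ico t0 X, t ∈ Ico ε X := fun t ht => ⟨by linarith [hh.2, ht.1], by linarith [ht.2]⟩
    have inX : ∀ t ∈ Ico ε X, t ∈ Ioo 0 X := fun t ht => ⟨hε.trans_le ht.1, ht.2⟩
    have uz : ∀ t ∈ Ico t0 X, ∀ y ∈ Ioc 0 δ, |(u t y - u (t - h) y) / h| ≤ Cu * y⁻¹ := by
      intro t ht y hy
      have := hU t (sh0 t ht) (t-h) (sh t ht) y hy
      rw [abs_div, abs_of_pos hp, div_le_iff₀ hp]
      rwa [sub_sub_cancel, abs_of_pos hp, Real.rpow_neg_one] at this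
    refine hC (fun t y => (u t y - u (t - h) y) / h)
      (fun t y => (Dt u t y - Dt u (t - h) y) / h)
      (fun t y => (Dy u t y - Dy u (t - h) y) / h)
      (fun t y => (Dy (Dy u) t y - Dy (Dy u) (t - h) y) / h) (BB q w r c) ?_ ?_ ?_ ?_ ?_ ?_ ?_ ?_ ?_
    · have c1 := su.contOn (t0 := ε) hε hδ
      refine ContinuousOn.div_const (ContinuousOn.sub (c1.mono (prod_mono sh0 le_rfl)) ?_) _
      exact c1.comp (f := fun x : ℝ × ℝ => (x.1 - h, x.2)) (by fun_prop) fun x hx => ⟨sh _ hx.1, hx.2⟩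
    · intro t ht y hy
      have hy' : y ∈ Ioo 0 d := ⟨hy.1, hy.2.trans hδ⟩
      have a1 := su.hasDt (inX t (sh0 t ⟨ht.1.le, ht.2⟩)) hy'
      have a2 := su.hasDt (inX _ (sh t ⟨ht.1.le, ht.2⟩)) hy'
      have a3 : HasDerivAt (fun s => u (s - h) y) (Dt u (t - h) y) t := by
        simpa using a2.comp_sub_const t h
      exact (a1.sub a3).div_const h
    · intro t ht y hy
      have hy' : y ∈ Ioo 0 d := ⟨hy.1, hy.2.trans hδ⟩
      have a1 := su.hasDy (inX t (sh0 t ⟨ht.1.le, ht.2⟩)) hy'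
      have a2 := su.hasDy (inX _ (sh t ⟨ht.1.le, ht.2⟩)) hy'
      exact (a1.sub a2).div_const h
    · intro t ht y hy
      have hy' : y ∈ Ioo 0 d := ⟨hy.1, hy.2.trans hδ⟩
      have a1 := su.dyU.hasDy (inX t (sh0 t ⟨ht.1.le, ht.2⟩)) hy'
      have a2 := su.dyU.hasDy (inX _ (sh t ⟨ht.1.le, ht.2⟩)) hy'
      exact (a1.sub a2).div_const h
    · intro t ht y hy
      exact hK t (sh0 t ⟨ht.1.le, ht.2⟩) y ⟨hy.1, hy.2.le⟩
    · intro t ht y hy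
      have ht' : t ∈ Ico t0 X := ⟨ht.1.le, ht.2⟩
      have y0 := hy.1
      have hyc : y ∈ Ioc 0 δ := ⟨hy.1, hy.2.le⟩
      have hy' : y ∈ Ioo 0 d := ⟨hy.1, hy.2.trans hδ⟩
      have eqn : ∀ t ∈ Ico ε X, Dt u t y = R t y * Dy (Dy u) t y + BB q w r c t y * u t y + f t y := by
        intro t ht
        have e2 : gg w R (n+1) t y = BB q w r c t y * u t y + f t y := he t (inX t ht) y hy'
        have e1 : gg w R (n+1) t y = Dt u t y - R t y * Dy (Dy u) t y := by
          rw [gg, hu, ev]; rfl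
        linarith
      have q1 := eqn t (sh0 t ht')
      have q2 := eqn (t - h) (sh t ht')
      have id1 : (Dt u t y - Dt u (t - h) y) / h - R t y * ((Dy (Dy u) t y - Dy (Dy u) (t - h) y) / h)
        - BB q w r c t y * ((u t y - u (t - h) y) / h) =
        ((f t y - f (t - h) y) + Dy (Dy u) (t - h) y * (R t y - R (t - h) y)
          + u (t - h) y * (BB q w r c t y - BB q w r c (t - h) y)) / h := by
        rw [q1, q2]; ring
      rw [id1, abs_div, abs_of_pos hp, div_le_iff₀ hp]
      have b1 := hF t (sh0 t ht') (t-h) (sh t ht') y hyc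
      have b2 := hR t (sh0 t ht') (t-h) (sh t ht') y hyc
      have b3 := hB t (sh0 t ht') (t-h) (sh t ht') y hyc
      have b4 := hY (t-h) (sh t ht') y hyc
      have b5 := hC1 (t-h) (sh t ht') y hyc
      rw [sub_sub_cancel, abs_of_pos hp] at b1 b2 b3
      have d1 : |Dy (Dy u) (t - h) y * (R t y - R (t - h) y)| ≤ Cy * CR * y⁻¹ * h := by
        rw [abs_mul]
        calc _ ≤ (Cy * y ^ (-3/2:ℝ)) * (CR * y ^ (1/2:ℝ) * h) := by gcongr
          _ = Cy * CR * (y ^ (-3/2:ℝ) * y ^ (1/2:ℝ)) * h := by ring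
          _ = _ := by rw [← Real.rpow_add y0, show (-3/2 + 1/2 : ℝ) = -1 by norm_num, Real.rpow_neg_one]
      have d2 : |u (t - h) y * (BB q w r c t y - BB q w r c (t - h) y)| ≤ C1 * CB * y⁻¹ * h := by
        rw [abs_mul]
        calc _ ≤ (C1 * y ^ (1:ℝ)) * (CB * y ^ (-2:ℝ) * h) := by gcongr
          _ = C1 * CB * (y ^ (1:ℝ) * y ^ (-2:ℝ)) * h := by ring
          _ = _ := by rw [← Real.rpow_add y0, show (1 + -2 : ℝ) = -1 by norm_num, Real.rpow_neg_one]
      have d3 : |f t y - f (t - h) y| ≤ Cf * y⁻¹ * h := by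
        refine b1.trans ?_
        have : (1:ℝ) ≤ y⁻¹ := (one_le_inv₀ y0).2 (hyc.2.trans hδ1)
        rw [Real.rpow_zero]
        gcongr
      have d4 := abs_add_three (f t y - f (t - h) y) (Dy (Dy u) (t - h) y * (R t y - R (t - h) y))
        (u (t - h) y * (BB q w r c t y - BB q w r c (t - h) y))
      have d5 : 0 ≤ Cu * y⁻¹ * h := by positivity
      linarith
    · intro t ht y hy
      refine (uz t ⟨ht.1.le, ht.2⟩ y ⟨hy.1, hy.2.le⟩).trans ?_
      have y0 := hy.1
      gcongr
      have : 0 ≤ Cf + Cy * CR + C1 * CB := by positivity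
      linarith
    · intro t ht
      exact uz t ht δ ⟨δ0, le_rfl⟩
    · intro ν hν
      refine ⟨ν * h / (2 * C1), by positivity, fun t ht y hy hyk => ?_⟩
      have b5 := hC1 (t-h) (sh t ht) y hy
      have b6 := hC1 t (sh0 t ht) y hy
      rw [Real.rpow_one] at b5 b6
      rw [abs_div, abs_of_pos hp, div_le_iff₀ hp]
      rw [lt_div_iff₀ (by positivity)] at hyk
      have := abs_sub (u t y) (u (t - h) y)
      linarith
  refine ⟨C, fun t ht y hy => ?_⟩
  have hy' : y ∈ Ioo 0 d := ⟨hy.1, hy.2.trans_lt hδ⟩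
  have a1 := su.hasDt (x := t) (y := y) ⟨by linarith [ht.1], ht.2⟩ hy'
  rw [ev] at a1
  have a2 := a1.tendsto_slope_zero_left.abs
  refine le_of_tendsto a2 ?_
  have : Ioo (-(t0 - ε)) 0 ∈ nhdsWithin (0:ℝ) (Iio 0) := Ioo_mem_nhdsLT (by linarith)
  filter_upwards [this] with s hs
  have := hz (-s) ⟨by linarith [hs.2], by linarith [hs.1]⟩ t ht y hy
  rw [sub_neg_eq_add] at this
  have e : s⁻¹ • (u (t + s) y - u t y) = (u t y - u (t + s) y) / -s := by
    rw [smul_eq_mul, div_neg, ← neg_div, neg_sub, div_eq_inv_mul]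
  rw [e]; exact this

end Setup
end

noncomputable section

namespace Setup
variable {X d μ M C₀ α : ℝ} {q : ℝ → ℝ} {w r R : ℝ → ℝ → ℝ}
variable (S : Setup X d μ M C₀ α q w r R)
include S

lemma dyB (c : ℝ) {x y : ℝ} (hx : x ∈ Ioo 0 X) (hy : y ∈ Ioo 0 d) :
    Dy (BB q w r c) x y = 1/2 * (r x y * (r x y * c)) * Dy (Dt w) x y
      - 1/2 * (r x y * (r x y * (r x y * (r x y * (Dy w x y * (c * Dt w x y - q x)))))) := by
  have h1 := S.sr.hasDy hx hy
  have h2 := S.sw.dt.hasDy hx hy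
  have h4 := ((h1.mul (h1.mul ((h2.const_mul c).sub (hasDerivAt_const y (q x))))).const_mul (1/2)).deriv
  have h5 : Dy (BB q w r c) x y = deriv (fun y' => 1/2 * (r x y' * (r x y' * (c * Dt w x y' - q x)))) y := rfl
  rw [h5]
  refine h4.trans ?_
  simp only [Pi.mul_apply, Pi.sub_apply]
  rw [S.dyr hx hy]; ring

lemma bd_gy {ε δ : ℝ} (hε : 0 < ε) (hδ : δ < d) {n : ℕ} (h : Cl X ε δ (n+1) 0 1 w)
    (h2 : Cl X ε δ n 2 1 w) : ∃ C > 0, ∀ t ∈ Ico ε X, ∀ y ∈ Ioc 0 δ,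
      |Dy (gg w R (n+1)) t y| ≤ C * (|Dy (Dt^[n+1] w) t y| + 1) * y⁻¹ := by
  have hδ1 : δ ≤ 1 := hδ.le.trans S.hd1
  obtain ⟨c, f, sf, he, hf⟩ := S.key n
  have su := S.s_u (n+1)
  have h1 := S.bd_dtw h
  have hr := S.bd_r hε hδ
  have hwy : Bd X ε δ 0 (Dy w) := ((h2.mono (Nat.zero_le _) (show 0+1 ≤ 2 by norm_num)).dy.bd).cast (by norm_num)
  have bq : Bd X ε δ 0 (fun x _ => q x) := (Cl.ofT (n := 0) (m := 0) hε hδ S.hq).bd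
  have a3 := ((((Bd.const c).mul h1).cast (zero_add _)).weak hδ1 (show (0:ℝ) ≤ 1 by norm_num)).sub bq
  obtain ⟨CE, ce0, hE⟩ := (((Bd.const (1/2)).mul (hr.mul (hr.mul (hr.mul (hr.mul (hwy.mul a3)))))).cast
    (show (0 + (-1/2 + (-1/2 + (-1/2 + (-1/2 + (0 + 0))))) : ℝ) = -2 by norm_num)).pos
  obtain ⟨CA, ca0, hA⟩ := (((Bd.const (1/2)).mul (hr.mul (hr.mul (Bd.const c)))).cast
    (show (0 + (-1/2 + (-1/2 + 0)) : ℝ) = -1 by norm_num)).pos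
  obtain ⟨CB, cb0, hB⟩ := (S.cl_B hε hδ (n := 0) (m := 0) c (h.mono (by omega) le_rfl)).bd.pos
  obtain ⟨Cf, cf0, hF⟩ := (((hf ε δ hε hδ 0 1 (h2.mono (by omega) (by omega))).dy (m := 0)).bd.cast
    (show (0 - 1 : ℝ) = -1 by norm_num)).pos
  obtain ⟨Cu, cu0, hU⟩ := (S.bd_iter h).pos
  obtain ⟨C1, c10, hC1⟩ : ∃ C > 0, ∀ t ∈ Ico ε X, ∀ y ∈ Ioc 0 δ,
      |Dy (Dt w) t y| ≤ C * (|Dy (Dt^[n+1] w) t y| + 1) := by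
    rcases n with _ | n
    · exact ⟨1, one_pos, fun t _ y _ => by simp⟩
    · obtain ⟨C, c0, hC⟩ := (((h2.mono (show n + 1 ≤ n + 1 from le_rfl) (show 0+1 ≤ 2 by norm_num)).dt hε hδ S.sw).dy.bd.cast
        (show (1-1:ℝ) = 0 by norm_num)).pos
      refine ⟨C, c0, fun t ht y hy => ?_⟩
      have := hC t ht y hy
      rw [Real.rpow_zero, mul_one] at this
      have := mul_nonneg c0.le (abs_nonneg (Dy (Dt^[n+1+1] w) t y))
      linarith
  refine ⟨CA * C1 * Cu + CE * Cu + CB + Cf, by positivity, fun t ht y hy => ?_⟩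
  have hx : t ∈ Ioo 0 X := ⟨hε.trans_le ht.1, ht.2⟩
  have hy' : y ∈ Ioo 0 d := ⟨hy.1, hy.2.trans_lt hδ⟩
  have y0 := hy.1
  have i1 : (1:ℝ) ≤ y⁻¹ := (one_le_inv₀ y0).2 (hy.2.trans hδ1)
  have e1 : Dy (gg w R (n+1)) t y = Dy (BB q w r c) t y * Dt^[n+1] w t y
      + BB q w r c t y * Dy (Dt^[n+1] w) t y + Dy f t y := by
    rw [he.dy t hx y hy', dy_add ((S.s_B c).mul su) sf t hx y hy']
    simp only [Pi.add_apply]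
    rw [dy_mul (S.s_B c) su t hx y hy']; rfl
  rw [e1, S.dyB c hx hy']
  have b1 := hE t ht y hy
  have b2 := hA t ht y hy
  have b3 := hB t ht y hy
  have b4 := hF t ht y hy
  have b5 := hU t ht y hy
  have b6 := hC1 t ht y hy
  simp only [Pi.mul_apply, Pi.sub_apply] at b1 b2
  rw [Real.rpow_neg_one] at b2 b3 b4
  rw [Real.rpow_one] at b5
  have e2 : y ^ (-2:ℝ) = y⁻¹ * y⁻¹ := by
    rw [show (-2:ℝ) = -1 + -1 by norm_num, Real.rpow_add y0, Real.rpow_neg_one]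
  rw [e2] at b1
  set A := 1/2 * (r t y * (r t y * c))
  set E := 1/2 * (r t y * (r t y * (r t y * (r t y * (Dy w t y * (c * Dt w t y - q t))))))
  set U := |Dy (Dt^[n+1] w) t y|
  have U0 : 0 ≤ U := abs_nonneg _
  have t1 : |A * Dy (Dt w) t y * Dt^[n+1] w t y| ≤ CA * C1 * Cu * (U + 1) * y⁻¹ := by
    rw [abs_mul, abs_mul]
    calc _ ≤ CA * y⁻¹ * (C1 * (U + 1)) * (Cu * y) := by gcongr
      _ = CA * C1 * Cu * (U + 1) * (y⁻¹ * y) := by ring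
      _ ≤ _ := by
        rw [inv_mul_cancel₀ y0.ne']; gcongr
  have t2 : |E * Dt^[n+1] w t y| ≤ CE * Cu * (U + 1) * y⁻¹ := by
    rw [abs_mul]
    calc _ ≤ CE * (y⁻¹ * y⁻¹) * (Cu * y) := by gcongr
      _ = CE * Cu * y⁻¹ * (y⁻¹ * y) := by ring
      _ = CE * Cu * 1 * y⁻¹ := by rw [inv_mul_cancel₀ y0.ne']; ring
      _ ≤ _ := by gcongr; linarith
  have t3 : |BB q w r c t y * Dy (Dt^[n+1] w) t y| ≤ CB * (U + 1) * y⁻¹ := by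
    rw [abs_mul]
    calc _ ≤ CB * y⁻¹ * (U + 1) := by gcongr; linarith
      _ = _ := by ring
  have t4 : |Dy f t y| ≤ Cf * (U + 1) * y⁻¹ := by
    calc _ ≤ Cf * 1 * y⁻¹ := by simpa using b4
      _ ≤ _ := by gcongr; linarith
  have e3 : (A * Dy (Dt w) t y - E) * Dt^[n+1] w t y
      + BB q w r c t y * Dy (Dt^[n+1] w) t y + Dy f t y =
      (A * Dy (Dt w) t y * Dt^[n+1] w t y - E * Dt^[n+1] w t y)
      + BB q w r c t y * Dy (Dt^[n+1] w) t y + Dy f t y := by ring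
  rw [e3]
  have := abs_add_three (A * Dy (Dt w) t y * Dt^[n+1] w t y - E * Dt^[n+1] w t y)
    (BB q w r c t y * Dy (Dt^[n+1] w) t y) (Dy f t y)
  have := abs_sub (A * Dy (Dt w) t y * Dt^[n+1] w t y) (E * Dt^[n+1] w t y)
  linarith

lemma step1 {ε ε' δ : ℝ} (hε : 0 < ε) (hεε : ε < ε') (δ0 : 0 < δ) (hδ : δ < d) {n : ℕ}
    (h : Cl X ε δ (n+1) 0 1 w) : Bd X ε' (δ/3) (-1) (Dt^[n+2] w) := by
  have hδ' : δ/2 < d := by linarith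
  have hδ1 : δ ≤ 1 := hδ.le.trans S.hd1
  have h2 := S.cl_y hε hδ δ0 h
  replace h := h.mono' (le_refl ε) (show δ/2 ≤ δ by linarith)
  have hwy : Bd X ε (δ/2) 0 (Dy w) := ((h2.mono (Nat.zero_le _) (show 0+1 ≤ 2 by norm_num)).dy.bd).cast (by norm_num)
  obtain ⟨K1, k10, hK1⟩ := (S.bd_iter h).pos
  obtain ⟨K2, k20, hK2⟩ := (S.bd_dyR hε hδ' hwy).pos
  obtain ⟨K3, k30, hK3⟩ := (S.bd_gg hε hδ' h).pos
  obtain ⟨K4, k40, hK4⟩ := S.bd_gy hε hδ' h h2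
  obtain ⟨c, f, sf, he, hf⟩ := S.key (n+1)
  obtain ⟨K5, k50, hK5⟩ := (hf ε (δ/2) hε hδ' 0 0 h).bd.pos
  obtain ⟨K6, k60, hK6⟩ := S.B_ub hε hδ' (S.bd_dtw h) c
  have sM : 0 < √M := Real.sqrt_pos.2 S.hM
  have sm : 0 < √μ := Real.sqrt_pos.2 S.hμ
  have hX := S.hX
  obtain ⟨K, hKK⟩ : ∃ K, K = 1 + X + 2 * K1 + 2 * K2 + K3 + 2 * K4 + K5 + K6 + 2 * √M + 2 / √μ := ⟨_, rfl⟩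
  have hs2 : 0 < 2 / √μ := by positivity
  have su := S.s_u (n+1)
  have ev : Dt (Dt^[n+1] w) = Dt^[n+2] w := by rw [Function.iterate_succ' Dt (n+1)]; rfl
  obtain ⟨D, hD⟩ : ∃ D, D = (fun K : ℝ => (K * (2 + 354 * K ^ 2) * (1 + 2 * K ^ 4 + 531 * K ^ 2) * K) * K ^ 2
        + (2 * K ^ 3 + 2 * K * (2 + 354 * K ^ 2) * (K ^ 2 + K ^ 4) +
          2 * (K * (2 + 354 * K ^ 2) * (1 + 2 * K ^ 4 + 531 * K ^ 2) * K) * K ^ 2 + 1) * K) K := ⟨_, rfl⟩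
  have main : ∀ T ∈ Ico ε' X, ∀ s ∈ Ioc 0 (δ/3), (T - ε) ^ 2 * Dt (Dt^[n+1] w) T s ^ 2 ≤ D * ((√s)⁻¹) ^ 4 := by
    intro T hT s hs
    have s0 := hs.1
    have ss : 0 < √s := Real.sqrt_pos.2 s0
    have ss2 : √s ^ 2 = s := Real.sq_sqrt s0.le
    have inX : ∀ t ∈ Icc ε T, t ∈ Ico ε X := fun t ht => ⟨ht.1, ht.2.trans_lt hT.2⟩
    have inX' : ∀ t ∈ Ioc ε T, t ∈ Ico ε X := fun t ht => ⟨ht.1.le, ht.2.trans_lt hT.2⟩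
    have inXo : ∀ t ∈ Ioc ε T, t ∈ Ioo 0 X := fun t ht => ⟨hε.trans ht.1, ht.2.trans_lt hT.2⟩
    have inY : ∀ y ∈ Icc (s/2) (3*s/2), y ∈ Ioc 0 (δ/2) := fun y hy =>
      ⟨by linarith [hy.1], by linarith [hy.2, hs.2]⟩
    have inYo : ∀ y ∈ Ioo (s/2) (3*s/2), y ∈ Ioc 0 (δ/2) := fun y hy =>
      ⟨by linarith [hy.1], by linarith [hy.2, hs.2]⟩
    have inYd : ∀ y ∈ Ioo (s/2) (3*s/2), y ∈ Ioo 0 d := fun y hy =>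
      ⟨by linarith [hy.1], by linarith [hy.2, hs.2]⟩
    have yl : ∀ y ∈ Ioo (s/2) (3*s/2), 1/2 ≤ y ^ (1/2:ℝ) * (√s)⁻¹ := by
      intro y hy
      rw [← div_eq_mul_inv, le_div_iff₀ ss, ← Real.sqrt_eq_rpow]
      apply Real.le_sqrt_of_sq_le
      rw [mul_pow, ss2]; linarith [hy.1]
    have yu : ∀ y ∈ Ioo (s/2) (3*s/2), y ^ (1/2:ℝ) * (√s)⁻¹ ≤ 2 := by
      intro y hy
      rw [← div_eq_mul_inv, div_le_iff₀ ss, ← Real.sqrt_eq_rpow]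
      apply Real.sqrt_le_iff.2 ⟨by positivity, ?_⟩
      rw [mul_pow, ss2]; linarith [hy.2]
    have yi : ∀ y ∈ Ioo (s/2) (3*s/2), y ^ (-1/2:ℝ) ≤ 2 * (√s)⁻¹ := by
      intro y hy
      have := yl y hy
      have y0 := (inYd y hy).1
      have yp : 0 < y ^ (1/2:ℝ) := Real.rpow_pos_of_pos y0 _
      rw [show (-1/2:ℝ) = -(1/2) by norm_num, Real.rpow_neg y0.le, inv_le_iff_one_le_mul₀ yp]
      linarith
    have yi1 : ∀ y ∈ Ioo (s/2) (3*s/2), y⁻¹ ≤ 2 * (√s)⁻¹ ^ 2 := by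
      intro y hy
      have y0 := (inYd y hy).1
      rw [inv_pow, ss2, inv_le_iff_one_le_mul₀ y0]
      field_simp
      linarith [hy.1]
    have box : Icc ε T ×ˢ Icc (s/2) (3*s/2) ⊆ Ico ε X ×ˢ Ioc 0 (δ/2) := prod_mono inX inY
    have := bern_main (K := K) (t0 := ε) (T := T) (s := s) (j := (√s)⁻¹)
      (Dt^[n+1] w) (Dy (Dt^[n+1] w)) (Dy (Dy (Dt^[n+1] w))) (Dy (Dy (Dy (Dt^[n+1] w))))
      (Dt (Dt^[n+1] w)) (Dy (Dt (Dt^[n+1] w))) (Dy (Dy (Dt (Dt^[n+1] w)))) (Dt (Dt (Dt^[n+1] w)))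
      R (Dy R) (gg w R (n+1)) (Dy (gg w R (n+1))) (gg w R (n+2))
      (by linarith) ((one_le_inv₀ ss).2 (Real.sqrt_le_one.2 (by linarith [hs.2])))
      (by rw [inv_pow, ss2, inv_mul_cancel₀ s0.ne']) (by linarith [hT.2])
      ((su.contOn hε hδ').mono box) ((su.dyU.contOn hε hδ').mono box) ((su.dt.contOn hε hδ').mono box)
      (fun t ht y hy => su.hasDt (inXo t ht) (inYd y hy))
      (fun t ht y hy => by
        rw [← dt_dy_comm su t (inXo t ht) y (inYd y hy)]
        exact su.dyU.hasDt (inXo t ht) (inYd y hy))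
      (fun t ht y hy => su.dt.hasDt (inXo t ht) (inYd y hy))
      (fun t ht y hy => su.hasDy (inXo t ht) (inYd y hy))
      (fun t ht y hy => su.dyU.hasDy (inXo t ht) (inYd y hy))
      (fun t ht y hy => su.dyU.dyU.hasDy (inXo t ht) (inYd y hy))
      (fun t ht y hy => su.dt.hasDy (inXo t ht) (inYd y hy))
      (fun t ht y hy => su.dt.dyU.hasDy (inXo t ht) (inYd y hy))
      ?_ ?_ ?_ ?_ ?_ ?_ ?_ ?_ ?_ ?_ ?_
    · obtain ⟨D', hD', hfin⟩ := this
      have := hfin T ⟨by linarith [hT.1], le_rfl⟩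
      rw [hD', ← hD] at this
      exact this
    · intro t ht y hy
      rw [gg, ev]; simp only [Pi.sub_apply, Pi.mul_apply]; ring
    · intro t ht y hy
      have a1 := dy_sub (S.s_u (n+2)) (S.sR.mul su.dyU.dyU) t (inXo t ht) y (inYd y hy)
      have a2 := dy_mul S.sR su.dyU.dyU t (inXo t ht) y (inYd y hy)
      simp only [Pi.sub_apply, Pi.mul_apply, Pi.add_apply] at a1 a2
      have a3 : Dy (gg w R (n+1)) t y = _ := a1
      rw [a3, a2, ev]; ring
    · intro t ht y hy
      have e1 : Dt (Dt^[n+2] w) t y - R t y * Dy (Dy (Dt^[n+2] w)) t y = gg w R (n+2) t y := by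
        rw [gg, Function.iterate_succ' Dt (n+2)]; rfl
      rw [ev]; linarith
    · intro t ht y hy
      exact S.Rpos t (inXo t ht) y (inYd y hy)
    · intro t ht y hy
      calc _ ≤ √M * y ^ (1/2:ℝ) * (√s)⁻¹ := by
            gcongr; exact S.Rub (inXo t ht) (inYd y hy)
        _ = √M * (y ^ (1/2:ℝ) * (√s)⁻¹) := by ring
        _ ≤ √M * 2 := by gcongr; exact yu y hy
        _ ≤ K := by linarith
    · intro t ht y hy
      have a1 : √μ * (1/2) ≤ R t y * (√s)⁻¹ := by
        calc √μ * (1/2) ≤ √μ * (y ^ (1/2:ℝ) * (√s)⁻¹) := by gcongr; exact yl y hy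
          _ = √μ * y ^ (1/2:ℝ) * (√s)⁻¹ := by ring
          _ ≤ _ := by gcongr; exact S.Rlb (inXo t ht) (inYd y hy)
      calc (1:ℝ) = 2 / √μ * (√μ * (1/2)) := by field_simp
        _ ≤ K * (R t y * (√s)⁻¹) :=
          mul_le_mul (by linarith) a1 (by positivity) (by linarith)
    · intro t ht y hy
      calc _ ≤ K2 * y ^ (-1/2:ℝ) := hK2 t (inX' t ht) y (inYo y hy)
        _ ≤ K2 * (2 * (√s)⁻¹) := by gcongr; exact yi y hy
        _ = (2 * K2) * (√s)⁻¹ := by ring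
        _ ≤ _ := by gcongr; linarith
    · intro t ht y hy
      have := hK3 t (inX' t ht) y (inYo y hy)
      rw [Real.rpow_zero] at this; linarith
    · intro t ht y hy
      refine (hK4 t (inX' t ht) y (inYo y hy)).trans ?_
      have := abs_nonneg (Dy (Dt^[n+1] w) t y)
      calc _ ≤ K4 * (|Dy (Dt^[n+1] w) t y| + 1) * (2 * (√s)⁻¹ ^ 2) := by gcongr; exact yi1 y hy
        _ = 2 * K4 * (|Dy (Dt^[n+1] w) t y| + 1) * (√s)⁻¹ ^ 2 := by ring
        _ ≤ _ := by gcongr; linarith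
    · intro t ht y hy
      have e2 : gg w R (n+2) t y = BB q w r c t y * Dt^[n+2] w t y + f t y := he t (inXo t ht) y (inYd y hy)
      have b1 := hK5 t (inX' t ht) y (inYo y hy)
      have b2 := hK6 t (inX' t ht) y (inYo y hy)
      rw [Real.rpow_zero, mul_one] at b1
      rw [ev, e2]
      set v := Dt^[n+2] w t y
      have b3 : v * f t y ≤ K5 * (v ^ 2 + 1) := by
        have : v * f t y ≤ |v| * K5 := (le_abs_self _).trans (by rw [abs_mul]; gcongr)
        have : |v| ≤ v ^ 2 + 1 := by
          rw [← sq_abs]; nlinarith [sq_nonneg (|v| - 1)]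
        nlinarith
      have b4 : BB q w r c t y * v ^ 2 ≤ K6 * (v ^ 2 + 1) := by nlinarith [sq_nonneg v]
      have b5 : (K5 + K6) * (v ^ 2 + 1) ≤ K * (v ^ 2 + 1) := by gcongr; linarith
      linarith
    · intro t ht y hy
      have := hK1 t (inX t ht) y (inY y hy)
      rw [Real.rpow_one] at this
      have : K1 * y ≤ K1 * (2 * s) := by gcongr; linarith [hy.2]
      have : (2 * K1) * s ≤ K * s := by gcongr; linarith
      linarith
  have D0 : 0 ≤ D := by
    have : 0 ≤ K := by linarith
    rw [hD]; positivity
  have e0 : 0 < ε' - ε := by linarith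
  refine ⟨√D / (ε' - ε), fun t ht s hs => ?_⟩
  have hm := main t ht s hs
  rw [ev] at hm
  have s0 := hs.1
  rw [Real.rpow_neg_one, div_mul_eq_mul_div, le_div_iff₀ e0]
  apply abs_le_of_sq_le_sq' _ (by positivity) |>.2 |> fun h => h
  rw [mul_pow, sq_abs, mul_pow, Real.sq_sqrt D0]
  have e4 : ((√s)⁻¹) ^ 4 = s⁻¹ ^ 2 := by
    rw [show 4 = 2 * 2 from rfl, pow_mul, inv_pow, Real.sq_sqrt s0.le]
  rw [e4] at hm
  refine le_trans ?_ hm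
  rw [mul_comm]
  have : ε' - ε ≤ t - ε := by linarith [ht.1]
  gcongr

end Setup
end

noncomputable section

namespace Setup
variable {X d μ M C₀ α : ℝ} {q : ℝ → ℝ} {w r R : ℝ → ℝ → ℝ}
variable (S : Setup X d μ M C₀ α q w r R)
include S

lemma cl_n (n : ℕ) : ∀ ε > 0, ∃ δ, 0 < δ ∧ δ < d ∧ Cl X ε δ (n+1) 0 1 w := by
  have hd := S.hd
  induction n with
  | zero => exact fun ε hε => ⟨d/2, by linarith, by linarith, S.base_step hε⟩
  | succ n ih =>
    intro ε hε
    obtain ⟨δ, δ0, hδ, h⟩ := ih (ε/8) (by positivity)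
    have h1 := S.step1 (ε' := ε/4) (by positivity) (by linarith) δ0 hδ h
    have h2 := S.step2 (ε := ε/4) (ε' := ε/2) (δ := δ/3) (by positivity) (by linarith) (by linarith)
      (by linarith) (h.mono' (by linarith) (by linarith)) h1
    have h3 := S.step3 (ε := ε/2) (ε' := ε) (δ := δ/3) (by positivity) (by linarith) (by linarith)
      (by linarith) (h.mono' (by linarith) (by linarith)) h2
    refine ⟨δ/3, by linarith, by linarith, fun j hj l hl => ?_⟩
    rcases Nat.lt_or_ge j (n+2) with hj' | hj'
    · exact (h.mono' (show ε/8 ≤ ε by linarith) (show δ/3 ≤ δ by linarith)) j (by omega) l hl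
    · obtain rfl : j = n + 2 := by omega
      obtain rfl : l = 0 := by omega
      simpa using h3

lemma cl_n2 (n : ℕ) (ε : ℝ) (hε : 0 < ε) : ∃ δ, 0 < δ ∧ δ < d ∧ Cl X ε δ n 2 1 w := by
  obtain ⟨δ, δ0, hδ, h⟩ := S.cl_n n ε hε
  exact ⟨δ/2, by linarith, by linarith, S.cl_y hε hδ δ0 h⟩

lemma cl_all (m : ℕ) : ∀ n : ℕ, ∀ ε > 0, ∃ δ, 0 < δ ∧ δ < d ∧ Cl X ε δ n m 1 w := by
  induction m with
  | zero =>
    intro n ε hε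
    obtain ⟨δ, δ0, hδ, h⟩ := S.cl_n2 n ε hε
    exact ⟨δ, δ0, hδ, h.mono le_rfl (by omega)⟩
  | succ m ih =>
    intro n ε hε
    obtain ⟨δ, δ0, hδ, h⟩ := S.cl_n2 n ε hε
    obtain ⟨δ', δ0', hδ', h'⟩ := ih (n+1) ε hε
    have hm : min δ δ' < d := (min_le_left _ _).trans_lt hδ
    refine ⟨min δ δ', lt_min δ0 δ0', hm, ?_⟩
    have := S.cl_yy hε hm (h'.mono' le_rfl (min_le_right _ _))
      ((h.mono' le_rfl (min_le_left δ δ')).mono le_rfl (by omega))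
    exact this.mono le_rfl (by omega)

lemma final (k m : ℕ) (ε : ℝ) (hε : 0 < ε) :
    ∃ δ, 0 < δ ∧ δ < d ∧ Bd X ε δ (-1/2 - m) (Dt^[k] (Dy^[m] r)) := by
  obtain ⟨δ, δ0, hδ, h⟩ := S.cl_all m k ε hε
  exact ⟨δ, δ0, hδ, S.cl_r hε hδ h k le_rfl m le_rfl⟩

end Setup

lemma end_deriv {G : ℝ → ℝ} {ε X B : ℝ} (hεX : ε < X)
    (hd : ∀ t ∈ Ioo ε X, DifferentiableAt ℝ G t) (hb : ∀ t ∈ Ioo ε X, |deriv G t| ≤ B) :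
    |deriv G X| ≤ B := by
  by_cases hG : DifferentiableAt ℝ G X
  · have h1 := hG.hasDerivAt.tendsto_slope_zero_left.abs
    refine le_of_tendsto h1 ?_
    have : Ioo (-(X - ε)) 0 ∈ nhdsWithin (0:ℝ) (Iio 0) := Ioo_mem_nhdsLT (by linarith)
    filter_upwards [this] with s hs
    obtain ⟨c, hc, he⟩ := exists_deriv_eq_slope G (show X + s < X by linarith [hs.2])
      (fun x hx => by
        rcases eq_or_lt_of_le hx.2 with h | h
        · rw [h]; exact hG.continuousAt.continuousWithinAt
        · exact (hd x ⟨by linarith [hx.1, hs.1], h⟩).continuousAt.continuousWithinAt)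
      (fun x hx => (hd x ⟨by linarith [hx.1, hs.1], hx.2⟩).differentiableWithinAt)
    have e : s⁻¹ • (G (X + s) - G X) = deriv G c := by
      rw [he, smul_eq_mul, show X - (X + s) = -s by ring, div_neg, ← neg_div, neg_sub, div_eq_inv_mul]
    rw [e]
    exact hb c ⟨by linarith [hc.1, hs.1], hc.2⟩
  · rw [deriv_zero_of_not_differentiableAt hG, abs_zero]
    exact (abs_nonneg _).trans (hb ((ε + X)/2) ⟨by linarith, by linarith⟩)

end

section
variable {X : ℝ} {p : ℝ → ℝ} {w : ℝ → ℝ → ℝ} {α m M C₀ δ₁ : ℝ}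

lemma OleinikSolution.wpos (hw : OleinikSolution X p w α m M C₀ δ₁) {x y : ℝ} (hx : x ∈ Ioc 0 X)
    (hy : y ∈ Ioo 0 δ₁) : 0 < w x y :=
  (mul_pos hw.hm hy.1).trans (hw.growth_lb x ⟨hx.1.le, hx.2⟩ y ⟨hy.1, hy.2.le⟩)

lemma OleinikSolution.sR (hw : OleinikSolution X p w α m M C₀ δ₁) :
    SmI (Ioc 0 X) δ₁ (fun x y => √(w x y)) :=
  ContDiffOn.sqrt (hw.smooth.mono (prod_mono le_rfl (fun _ h => h.1)))
    (fun _ hz => (hw.wpos hz.1 hz.2).ne')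

lemma OleinikSolution.sr (hw : OleinikSolution X p w α m M C₀ δ₁) :
    SmI (Ioc 0 X) δ₁ (fun x y => (√(w x y))⁻¹) :=
  ContDiffOn.inv hw.sR (fun _ hz => (Real.sqrt_pos.2 (hw.wpos hz.1 hz.2)).ne')

lemma OleinikSolution.setup (hw : OleinikSolution X p w α m M C₀ δ₁) :
    Setup X δ₁ m M C₀ α (fun x => -2 * deriv p x) w (fun x y => (√(w x y))⁻¹)
      (fun x y => √(w x y)) := by
  have hI : Ioo 0 X ⊆ Ioc 0 X := Ioo_subset_Ioc_self
  refine ⟨hw.hX, hw.hδ₁.1, hw.hδ₁.2.le, hw.hm, hw.hm.trans hw.hmM, hw.hC₀, hw.hα.1, ?_, ?_, ?_,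
    hw.sr.mono hI, hw.sR.mono hI, ?_, ?_, ?_, ?_, ?_, ?_, ?_⟩
  · exact contDiff_const.mul (contDiff_infty_iff_deriv.1 hw.hp).2
  · intro x; have := hw.hfav x; linarith
  · exact hw.smooth.mono (prod_mono hI (fun _ h => h.1))
  · intro x hx y hy; exact Real.sqrt_pos.2 (hw.wpos (hI hx) hy)
  · intro x hx y hy; exact inv_mul_cancel₀ (Real.sqrt_pos.2 (hw.wpos (hI hx) hy)).ne'
  · intro x hx y hy; exact Real.sq_sqrt (hw.wpos (hI hx) hy).le
  · intro x hx y hy; exact (hw.growth_lb x ⟨hx.1.le, hx.2.le⟩ y ⟨hy.1, hy.2.le⟩).le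
  · intro x hx y hy; exact (hw.growth_ub x ⟨hx.1.le, hx.2.le⟩ y ⟨hy.1, hy.2.le⟩).le
  · intro x hx y hy
    have := hw.eqn x (hI hx) y hy.1
    simp only [pd, pd_eq] at this
    simp only [Function.iterate_succ, Function.iterate_zero, Function.comp, id] at this
    linarith
  · intro x hx y hy
    have := hw.dx_bound x ⟨hx.1.le, hx.2.le⟩ y ⟨hy.1.le, hy.2.le⟩
    simp only [pd, pd_eq] at this
    exact this
end

theorem inv_sqrt_derivatives_estimate (X : ℝ) (p : ℝ → ℝ) (w : ℝ → ℝ → ℝ)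
    (α m M C₀ δ₁ : ℝ)
    (hw : OleinikSolution X p w α m M C₀ δ₁)
    (ε : ℝ) (hε : 0 < ε) (hεX : ε < X) (k mm : ℕ) :
    ∃ δ > 0, ∃ C > 0,
      ∀ x ∈ Set.Icc ε X, ∀ ψ ∈ Set.Ioc (0 : ℝ) δ,
        |pd k mm (fun x' ψ' => (Real.sqrt (w x' ψ'))⁻¹) x ψ|
          ≤ C * ψ ^ (-(1 : ℝ) / 2 - mm) := by
  have S := hw.setup
  obtain ⟨δ, δ0, hδ, h⟩ := S.final k mm ε hε
  obtain ⟨C, c0, hC⟩ := h.pos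
  refine ⟨δ, δ0, C, c0, fun x hx y hy => ?_⟩
  rw [pd, pd_eq]
  rcases lt_or_eq_of_le hx.2 with hxX | rfl
  · exact hC x ⟨hx.1, hxX⟩ y hy
  have hy' : y ∈ Ioo 0 δ₁ := ⟨hy.1, hy.2.trans_lt hδ⟩
  rcases k with _ | k
  · have s1 := hw.sr.dy_iter (uniqueDiffOn_Ioc 0 x) mm
    have c1 := (ContDiffOn.continuousOn s1) (x, y) ⟨⟨hw.hX, le_rfl⟩, hy'⟩
    have c2 : ContinuousWithinAt (fun t => (t, y)) (Ioo ε x) x := by fun_prop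
    have c3 := ContinuousWithinAt.comp (f := fun t => (t, y)) (s := Ioo ε x) (x := x) c1 c2 (fun t ht => ⟨⟨hε.trans ht.1, ht.2.le⟩, hy'⟩)
    have : (nhdsWithin x (Ioo ε x)).NeBot := by
      rw [← mem_closure_iff_nhdsWithin_neBot, closure_Ioo hεX.ne]; exact ⟨hεX.le, le_rfl⟩
    refine le_of_tendsto (Filter.Tendsto.abs c3) ?_
    filter_upwards [self_mem_nhdsWithin] with t ht
    exact hC t ⟨ht.1.le, ht.2⟩ y hy
  · rw [Function.iterate_succ', Function.comp]
    have s1 : Sm x δ₁ _ := (S.sr.dy_iter isOpen_Ioo.uniqueDiffOn mm).dt_iter k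
    refine end_deriv (G := fun t => Dt^[k] (Dy^[mm] fun x' ψ' => (√(w x' ψ'))⁻¹) t y) hεX ?_ ?_
    · intro t ht
      exact (s1.hasDt ⟨hε.trans ht.1, ht.2⟩ hy').differentiableAt
    · intro t ht
      have := hC t ⟨ht.1.le, ht.2⟩ y hy
      rwa [Function.iterate_succ', Function.comp] at this
end

section
/- Let k ≥ 1 be an integer, m > 0, C₁ > 0, K > 0. Suppose w is a positive function, k times continuously differentiable in x on a neighborhood of a point (x,ψ) with ψ > 0, such that w(x,ψ) ≥ mψ, |∂ₓ^j √w(x,ψ)| ≤ C₁ψ^{1/2} for all 1 ≤ j ≤ k−1, and |∂ₓ^k w(x,ψ)| ≤ Kψ. Then |∂ₓ^k √w(x,ψ)| ≤ C' ψ^{1/2}, where C' depends only on m, C₁, K and k. (The proof uses the Leibniz identity ∂ₓ^k w = 2√w ∂ₓ^k√w + Σ_{j=1}^{k−1} binom(k,j) (∂ₓ^j√w)(∂ₓ^{k−j}√w).) -/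
open Set

/-- From `|∂ₓ^k w| ≤ Kψ` and `|∂ₓ^j √w| ≤ C₁ψ^{1/2}` for `1 ≤ j ≤ k-1`, together
with the lower bound `w ≥ mψ`, one deduces `|∂ₓ^k √w| ≤ C'ψ^{1/2}` with a
constant `C'` depending only on `m, C₁, K` and `k`.  (This uses the Leibniz
identity `∂ₓ^k w = 2√w ∂ₓ^k√w + Σ_{j=1}^{k-1} binom(k,j)(∂ₓ^j√w)(∂ₓ^{k-j}√w)`.) -/
theorem sqrt_w_kth_derivative_bound (k : ℕ) (hk : 1 ≤ k) (m C₁ K : ℝ)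
    (hm : 0 < m) (hC₁ : 0 < C₁) (hK : 0 < K) :
    ∃ C' > 0, ∀ (w : ℝ → ℝ → ℝ) (x ψ : ℝ), 0 < ψ →
      (∃ ε > (0 : ℝ),
        (∀ x' ∈ Set.Ioo (x - ε) (x + ε), 0 < w x' ψ) ∧
        ContDiffOn ℝ k (fun x' => w x' ψ) (Set.Ioo (x - ε) (x + ε))) →
      m * ψ ≤ w x ψ →
      (∀ j : ℕ, 1 ≤ j → j ≤ k - 1 →
        |pd j 0 (fun x' ψ' => Real.sqrt (w x' ψ')) x ψ| ≤ C₁ * ψ ^ ((1 : ℝ) / 2)) →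
      |pd k 0 w x ψ| ≤ K * ψ →
      |pd k 0 (fun x' ψ' => Real.sqrt (w x' ψ')) x ψ| ≤ C' * ψ ^ ((1 : ℝ) / 2) := by
  have hsm : 0 < Real.sqrt m := Real.sqrt_pos.2 hm
  refine ⟨(K + (∑ i ∈ Finset.range (k - 1), (k.choose (i + 1) : ℝ)) * C₁ ^ 2) / (2 * Real.sqrt m),
    by positivity, ?_⟩
  rintro w x ψ hψ ⟨ε, hε, hpos, hcd⟩ hlow hj hw
  obtain ⟨n, rfl⟩ : ∃ n, k = n + 1 := ⟨k - 1, by omega⟩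
  simp only [pd, iteratedDeriv_zero, Nat.add_sub_cancel, ← Real.sqrt_eq_rpow] at *
  have hmem : Set.Ioo (x - ε) (x + ε) ∈ nhds x := Ioo_mem_nhds (by linarith) (by linarith)
  have hx : 0 < w x ψ := hpos x (mem_of_mem_nhds hmem)
  have hcs : ContDiffAt ℝ ((n + 1 : ℕ) : WithTop ℕ∞) (fun x' => Real.sqrt (w x' ψ)) x :=
    (hcd.contDiffAt hmem).sqrt hx.ne'
  have heq : (fun x' => w x' ψ) =ᶠ[nhds x]
      ((fun x' => Real.sqrt (w x' ψ)) * (fun x' => Real.sqrt (w x' ψ))) := by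
    filter_upwards [hmem] with y hy
    simp [Real.mul_self_sqrt (hpos y hy).le]
  have hD := (heq.iteratedDeriv (n + 1)).eq_of_nhds
  rw [iteratedDeriv_mul hcs hcs, Finset.sum_range_succ, Finset.sum_range_succ'] at hD
  simp only [Nat.choose_zero_right, Nat.choose_self, Nat.sub_self, Nat.sub_zero,
    iteratedDeriv_zero, Nat.cast_one, one_mul] at hD
  set f := fun x' => Real.sqrt (w x' ψ) with hf
  have hψ2 : Real.sqrt ψ * Real.sqrt ψ = ψ := Real.mul_self_sqrt hψ.le
  have hsψ : 0 < Real.sqrt ψ := Real.sqrt_pos.2 hψ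
  have hsum : |∑ i ∈ Finset.range n, ((n + 1).choose (i + 1) : ℝ) *
      iteratedDeriv (i + 1) f x * iteratedDeriv (n + 1 - (i + 1)) f x| ≤
      (∑ i ∈ Finset.range n, ((n + 1).choose (i + 1) : ℝ)) * C₁ ^ 2 * ψ := by
    rw [mul_assoc, Finset.sum_mul]
    refine (Finset.abs_sum_le_sum_abs _ _).trans (Finset.sum_le_sum fun i hi => ?_)
    have hi' := Finset.mem_range.1 hi
    rw [mul_assoc, abs_mul, Nat.abs_cast, abs_mul]
    have h1 := hj (i + 1) (by omega) (by omega)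
    have h2 := hj (n + 1 - (i + 1)) (by omega) (by omega)
    refine mul_le_mul_of_nonneg_left ?_ (by positivity)
    calc _ ≤ (C₁ * Real.sqrt ψ) * (C₁ * Real.sqrt ψ) :=
          mul_le_mul h1 h2 (abs_nonneg _) (by positivity)
      _ = C₁ ^ 2 * (Real.sqrt ψ * Real.sqrt ψ) := by ring
      _ = _ := by rw [hψ2]
  have hfx : Real.sqrt m * Real.sqrt ψ ≤ f x := by
    rw [← Real.sqrt_mul hm.le]; exact Real.sqrt_le_sqrt hlow
  set S := ∑ i ∈ Finset.range n, ((n + 1).choose (i + 1) : ℝ) *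
      iteratedDeriv (i + 1) f x * iteratedDeriv (n + 1 - (i + 1)) f x
  set B := (∑ i ∈ Finset.range n, ((n + 1).choose (i + 1) : ℝ)) * C₁ ^ 2
  set D := iteratedDeriv (n + 1) f x
  have hfx0 : 0 < f x := lt_of_lt_of_le (by positivity) hfx
  have h2 : 2 * f x * |D| ≤ (K + B) * ψ := by
    have : 2 * f x * D = iteratedDeriv (n + 1) (fun x' => w x' ψ) x - S := by
      rw [hD]; ring
    rw [← abs_of_pos (show 0 < 2 * f x by positivity), ← abs_mul, this]
    refine (abs_sub _ _).trans ?_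
    linarith
  have h3 : 2 * (Real.sqrt m * Real.sqrt ψ) * |D| ≤ 2 * f x * |D| := by gcongr
  rw [div_mul_eq_mul_div, le_div_iff₀ (by positivity)]
  refine le_of_mul_le_mul_right ?_ hsψ
  calc _ = 2 * (Real.sqrt m * Real.sqrt ψ) * |D| := by ring
    _ ≤ (K + B) * ψ := h3.trans h2
    _ = _ := by rw [mul_assoc, hψ2]
end
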